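/- Suppose γ > 1 and max{1, (γ+2)/4} < β ≤ γ. Then for the global radially symmetric strong solution (ρ, u) of the system on Ω (with initial data as in the global existence theorem), there is a positive constant C depending only on μ, β, γ, ‖ρ₀‖_{L^∞}, and ‖u₀‖_{H¹} (in particular independent of time) such that sup_{0 ≤ t < ∞} ‖ρ(·,t)‖_{L^∞(Ω)} ≤ C. Moreover, lim_{t→∞} ( ‖ρ(·,t) − ρ_s‖_{L^p(Ω)} + ‖∇u(·,t)‖_{L^p(Ω)} ) = 0 for every p ∈ [1, ∞), where ρ_s = (1/|Ω|) ∫_Ω ρ₀ dx. -/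

import Mathlib

open MeasureTheory Set Filter

noncomputable section

/-- Radial divergence `u_r + u/r` of the 2D radial vector field `x ↦ u(|x|,t) x/|x|`. -/
def rdiv (u : ℝ → ℝ → ℝ) (r t : ℝ) : ℝ := deriv (fun s => u s t) r + u r t / r

/-- Squared gradient `u_r² + u²/r²` of the 2D radial vector field. -/
def gradSq (u : ℝ → ℝ → ℝ) (r t : ℝ) : ℝ :=
  (deriv (fun s => u s t) r) ^ 2 + (u r t / r) ^ 2

/-- A global-in-time radially symmetric (smooth, strong) solution on `[0,R] × [0,∞)` of the
isentropic compressible Navier–Stokes system with `μ > 0`, `λ(ρ) = ρ^β`, `P(ρ) = ρ^γ`,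
written in radial coordinates, with Dirichlet boundary conditions `u(0,t) = u(R,t) = 0`. -/
structure RadialSolutionGlobal (μ β γ R : ℝ) (ρ u : ℝ → ℝ → ℝ) : Prop where
  hμ : 0 < μ
  hβ : 1 < β
  hγ : 1 < γ
  hR : 0 < R
  smooth_ρ : ∀ n : ℕ, ContDiff ℝ n (Function.uncurry ρ)
  smooth_u : ∀ n : ℕ, ContDiff ℝ n (Function.uncurry u)
  ρ_pos : ∀ r ∈ Icc 0 R, ∀ t ∈ Ici (0:ℝ), 0 < ρ r t
  mass : ∀ r ∈ Ioo 0 R, ∀ t ∈ Ici (0:ℝ),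
    deriv (fun τ => ρ r τ) t + deriv (fun s => ρ s t * u s t) r + ρ r t * u r t / r = 0
  momentum : ∀ r ∈ Ioo 0 R, ∀ t ∈ Ici (0:ℝ),
    deriv (fun τ => ρ r τ * u r τ) t + deriv (fun s => ρ s t * u s t ^ 2) r
      + ρ r t * u r t ^ 2 / r + deriv (fun s => ρ s t ^ γ) r
      = deriv (fun s => (2 * μ + ρ s t ^ β) * rdiv u s t) r
  bc0 : ∀ t ∈ Ici (0:ℝ), u 0 t = 0
  bcR : ∀ t ∈ Ici (0:ℝ), u R t = 0

section
open scoped ContDiff Topology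

namespace NS

/-- smoothness of parametric integrals over `[0,1]`. -/
theorem contDiff_param_nat (n : ℕ) : ∀ (F : Type) [NormedAddCommGroup F] [NormedSpace ℝ F]
    (G : (ℝ × ℝ) × ℝ → F), ContDiff ℝ ∞ G →
    ContDiff ℝ n (fun x : ℝ × ℝ => ∫ σ in (0:ℝ)..1, G (x, σ)) := by
  induction n with
  | zero =>
    intro F _ _ G hG
    refine contDiff_zero.2 ?_
    exact intervalIntegral.continuous_parametric_intervalIntegral_of_continuous'
      (f := fun x σ => G (x, σ)) hG.continuous 0 1
  | succ n ih =>
    intro F _ _ G hG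
    have hGd : Differentiable ℝ G := hG.differentiable (by simp)
    have hG' : ContDiff ℝ ∞ (fun y : (ℝ × ℝ) × ℝ =>
        (fderiv ℝ G y).comp (ContinuousLinearMap.inl ℝ (ℝ × ℝ) ℝ)) := by
      have : ContDiff ℝ ∞ (fderiv ℝ G) := hG.fderiv_right (by simp)
      exact this.clm_comp contDiff_const
    push_cast
    rw [contDiff_succ_iff_hasFDerivAt]
    refine ⟨_, ih _ _ hG', ?_⟩
    intro x
    have hc : Continuous (fun y : (ℝ × ℝ) × ℝ =>
        (fderiv ℝ G y).comp (ContinuousLinearMap.inl ℝ (ℝ × ℝ) ℝ)) := hG'.continuous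
    obtain ⟨B, hB⟩ := ((isCompact_closedBall x 1).prod (isCompact_Icc (a := (0:ℝ)) (b := 1))).exists_bound_of_continuousOn
      hc.continuousOn
    refine intervalIntegral.hasFDerivAt_integral_of_dominated_of_fderiv_le (𝕜 := ℝ) (bound := fun _ => B)
      (s := Metric.ball x 1)
      (F := fun x σ => G (x, σ)) (F' := fun x σ => (fderiv ℝ G (x,σ)).comp (ContinuousLinearMap.inl ℝ (ℝ × ℝ) ℝ))
      (Metric.ball_mem_nhds x one_pos) ?_ ?_ ?_ ?_ ?_ ?_
    · refine Eventually.of_forall fun y => ?_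
      exact (hG.continuous.comp (by fun_prop : Continuous fun σ : ℝ => (y, σ))).aestronglyMeasurable
    · exact (hG.continuous.comp (by fun_prop : Continuous fun σ : ℝ => (x, σ))).intervalIntegrable _ _
    · exact (hc.comp (by fun_prop : Continuous fun σ : ℝ => (x, σ))).aestronglyMeasurable
    · refine Eventually.of_forall fun σ hσ y hy => ?_
      rw [uIoc_of_le zero_le_one] at hσ
      exact hB (y, σ) ⟨Metric.ball_subset_closedBall hy, hσ.1.le, hσ.2⟩
    · simp
    · refine Eventually.of_forall fun σ hσ y hy => ?_
      have h1 := (hGd (y, σ)).hasFDerivAt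
      have h2 : HasFDerivAt (fun y : ℝ × ℝ => (y, σ)) (ContinuousLinearMap.inl ℝ (ℝ × ℝ) ℝ) y := by
        exact hasFDerivAt_prodMk_left y σ
      exact h1.comp y h2

/-- average along rays -/
def avg (f : ℝ × ℝ → ℝ) (x : ℝ × ℝ) : ℝ := ∫ σ in (0:ℝ)..1, f (x.1 * σ, x.2)

theorem avg_smooth {f : ℝ × ℝ → ℝ} (hf : ContDiff ℝ ∞ f) : ContDiff ℝ ∞ (avg f) := by
  rw [contDiff_infty]
  intro n
  have := contDiff_param_nat n ℝ (fun y => f (y.1.1 * y.2, y.1.2))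
    (hf.comp (by fun_prop))
  exact this

theorem mul_avg (f : ℝ × ℝ → ℝ) (r t : ℝ) : r * avg f (r, t) = ∫ s in (0:ℝ)..r, f (s, t) := by
  have := intervalIntegral.mul_integral_comp_mul_left (a := 0) (b := 1) (f := fun s => f (s, t)) r
  simpa [avg] using this

def dr (f : ℝ × ℝ → ℝ) (x : ℝ × ℝ) : ℝ := fderiv ℝ f x (1, 0)
def dt (f : ℝ × ℝ → ℝ) (x : ℝ × ℝ) : ℝ := fderiv ℝ f x (0, 1)

/-- closed space-time cylinder -/
def Kc (R : ℝ) : Set (ℝ × ℝ) := Icc 0 R ×ˢ Ici 0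
/-- open cylinder -/
def Oc (R : ℝ) : Set (ℝ × ℝ) := Ioo 0 R ×ˢ Ioi 0

theorem Oc_sub (R : ℝ) : Oc R ⊆ Kc R := fun x hx =>
  ⟨⟨hx.1.1.le, hx.1.2.le⟩, (show (0:ℝ) < x.2 from hx.2).le⟩

theorem closure_Oc {R : ℝ} (hR : 0 < R) : closure (Oc R) = Kc R := by
  rw [Oc, closure_prod_eq, closure_Ioo hR.ne, closure_Ioi]; rfl

theorem isOpen_Oc (R : ℝ) : IsOpen (Oc R) := isOpen_Ioo.prod isOpen_Ioi

/-- smooth near every point of the closed cylinder -/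
def Sm (R : ℝ) (f : ℝ × ℝ → ℝ) : Prop := ∀ x ∈ Kc R, ContDiffAt ℝ ∞ f x

variable {R : ℝ} {f g : ℝ × ℝ → ℝ}

theorem _root_.ContDiff.sm (hf : ContDiff ℝ ∞ f) : Sm R f := fun _ _ => hf.contDiffAt

namespace Sm
theorem add (hf : Sm R f) (hg : Sm R g) : Sm R (fun x => f x + g x) := fun x hx => (hf x hx).add (hg x hx)
theorem sub (hf : Sm R f) (hg : Sm R g) : Sm R (fun x => f x - g x) := fun x hx => (hf x hx).sub (hg x hx)
theorem mul (hf : Sm R f) (hg : Sm R g) : Sm R (fun x => f x * g x) := fun x hx => (hf x hx).mul (hg x hx)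
theorem neg (hf : Sm R f) : Sm R (fun x => - f x) := fun x hx => (hf x hx).neg
theorem pow (hf : Sm R f) (n : ℕ) : Sm R (fun x => f x ^ n) := fun x hx => (hf x hx).pow n
theorem const (c : ℝ) : Sm R (fun _ => c) := fun _ _ => contDiffAt_const
theorem fst : Sm R (fun x => x.1) := fun _ _ => contDiffAt_fst
theorem snd : Sm R (fun x => x.2) := fun _ _ => contDiffAt_snd
theorem rpow (hf : Sm R f) (h0 : ∀ x ∈ Kc R, 0 < f x) (p : ℝ) : Sm R (fun x => f x ^ p) :=
  fun x hx => (hf x hx).rpow_const_of_ne (h0 x hx).ne'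
theorem log (hf : Sm R f) (h0 : ∀ x ∈ Kc R, 0 < f x) : Sm R (fun x => Real.log (f x)) :=
  fun x hx => (hf x hx).log (h0 x hx).ne'
theorem inv (hf : Sm R f) (h0 : ∀ x ∈ Kc R, 0 < f x) : Sm R (fun x => (f x)⁻¹) :=
  fun x hx => (hf x hx).inv (h0 x hx).ne'
theorem dr (hf : Sm R f) : Sm R (dr f) := fun x hx =>
  ((hf x hx).fderiv_right (m := ∞) (by simp)).clm_apply contDiffAt_const
theorem dt (hf : Sm R f) : Sm R (dt f) := fun x hx =>
  ((hf x hx).fderiv_right (m := ∞) (by simp)).clm_apply contDiffAt_const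
theorem diff (hf : Sm R f) {x} (hx : x ∈ Kc R) : DifferentiableAt ℝ f x := (hf x hx).differentiableAt (by simp)
theorem cont (hf : Sm R f) : ContinuousOn f (Kc R) := fun x hx => (hf x hx).continuousAt.continuousWithinAt

theorem hr (hf : Sm R f) {r t : ℝ} (hx : (r, t) ∈ Kc R) :
    HasDerivAt (fun s => f (s, t)) (NS.dr f (r, t)) r := by
  have h1 := (hf.diff hx).hasFDerivAt
  have h2 : HasDerivAt (fun s : ℝ => (s, t)) ((1:ℝ), (0:ℝ)) r := (hasDerivAt_id r).prodMk (hasDerivAt_const r t)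
  exact h1.comp_hasDerivAt r h2
theorem ht (hf : Sm R f) {r t : ℝ} (hx : (r, t) ∈ Kc R) :
    HasDerivAt (fun s => f (r, s)) (NS.dt f (r, t)) t := by
  have h1 := (hf.diff hx).hasFDerivAt
  have h2 : HasDerivAt (fun s : ℝ => (r, s)) ((0:ℝ), (1:ℝ)) t := (hasDerivAt_const t r).prodMk (hasDerivAt_id t)
  exact h1.comp_hasDerivAt t h2

theorem symm (hf : Sm R f) {x} (hx : x ∈ Kc R) : NS.dt (NS.dr f) x = NS.dr (NS.dt f) x := by
  have h1 : DifferentiableAt ℝ (fderiv ℝ f) x :=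
    ((hf x hx).fderiv_right (m := ∞) (by simp)).differentiableAt (by simp)
  have hs := (hf x hx).isSymmSndFDerivAt (by simp; exact WithTop.coe_le_coe.2 (le_top : (2:ℕ∞) ≤ ⊤))
  have e1 : NS.dt (NS.dr f) x = fderiv ℝ (fderiv ℝ f) x (0,1) (1,0) := by
    simp only [NS.dt]
    change fderiv ℝ (fun y => fderiv ℝ f y (1,0)) x (0,1) = _
    rw [fderiv_clm_apply h1 (differentiableAt_const _)]
    simp
  have e2 : NS.dr (NS.dt f) x = fderiv ℝ (fderiv ℝ f) x (1,0) (0,1) := by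
    simp only [NS.dr]
    change fderiv ℝ (fun y => fderiv ℝ f y (0,1)) x (1,0) = _
    rw [fderiv_clm_apply h1 (differentiableAt_const _)]
    simp
  rw [e1, e2]
  exact hs _ _

theorem cr (hf : Sm R f) {t : ℝ} (ht : 0 ≤ t) : ContinuousOn (fun s => f (s, t)) (Icc 0 R) := fun r hr =>
  ((hf.hr (r := r) (t := t) ⟨hr, ht⟩).continuousAt).continuousWithinAt
end Sm

theorem _root_.ContinuousOn.cr (hf : ContinuousOn f (Kc R)) {t : ℝ} (ht : 0 ≤ t) :
    ContinuousOn (fun s => f (s, t)) (Icc 0 R) :=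
  hf.comp (by fun_prop) (fun _ hs => ⟨hs, ht⟩)

theorem eqOn_K (hR : 0 < R) (hf : ContinuousOn f (Kc R)) (hg : ContinuousOn g (Kc R))
    (h : ∀ x ∈ Oc R, f x = g x) : ∀ x ∈ Kc R, f x = g x := by
  have : EqOn f g (Kc R) := EqOn.of_subset_closure (s := Oc R) (t := Kc R) h hf hg (Oc_sub R) (closure_Oc hR).ge
  exact this

theorem dr_congr (h : ∀ x ∈ Oc R, f x = g x) {x} (hx : x ∈ Oc R) : dr f x = dr g x := by
  have : f =ᶠ[𝓝 x] g := by
    filter_upwards [(isOpen_Oc R).mem_nhds hx] with y hy using h y hy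
  simp [dr, this.fderiv_eq]
theorem dt_congr (h : ∀ x ∈ Oc R, f x = g x) {x} (hx : x ∈ Oc R) : dt f x = dt g x := by
  have : f =ᶠ[𝓝 x] g := by
    filter_upwards [(isOpen_Oc R).mem_nhds hx] with y hy using h y hy
  simp [dt, this.fderiv_eq]

theorem dr_eq (hR : 0 < R) (hf : Sm R f) (hg : Sm R g) (h : ∀ x ∈ Kc R, f x = g x) :
    ∀ x ∈ Kc R, dr f x = dr g x :=
  eqOn_K hR hf.dr.cont hg.dr.cont (fun _ hx => dr_congr (fun y hy => h y (Oc_sub R hy)) hx)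
theorem dt_eq (hR : 0 < R) (hf : Sm R f) (hg : Sm R g) (h : ∀ x ∈ Kc R, f x = g x) :
    ∀ x ∈ Kc R, dt f x = dt g x :=
  eqOn_K hR hf.dt.cont hg.dt.cont (fun _ hx => dt_congr (fun y hy => h y (Oc_sub R hy)) hx)

/-- spatial integral -/
def I (R : ℝ) (f : ℝ × ℝ → ℝ) (t : ℝ) : ℝ := ∫ r in (0:ℝ)..R, f (r, t)

theorem ii (hR : 0 < R) (hf : ContinuousOn f (Kc R)) {t : ℝ} (ht : 0 ≤ t) :
    IntervalIntegrable (fun r => f (r, t)) volume 0 R :=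
  ((hf.cr ht).mono (by rw [uIcc_of_le hR.le])).intervalIntegrable

theorem exists_bound (hf : ContinuousOn f (Kc R)) (T : ℝ) :
    ∃ B, ∀ r ∈ Icc 0 R, ∀ t ∈ Icc 0 T, |f (r, t)| ≤ B := by
  obtain ⟨B, hB⟩ := ((isCompact_Icc (a := (0:ℝ)) (b := R)).prod (isCompact_Icc (a := (0:ℝ)) (b := T))).exists_bound_of_continuousOn
    (hf.mono (fun x hx => ⟨hx.1, hx.2.1⟩))
  exact ⟨B, fun r hr t ht => hB (r, t) ⟨hr, ht⟩⟩

theorem I_cont (hR : 0 < R) (hf : ContinuousOn f (Kc R)) : ContinuousOn (I R f) (Ici 0) := by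
  intro t0 ht0
  obtain ⟨B, hB⟩ := exists_bound hf (t0 + 1)
  have hmem : ∀ᶠ t in 𝓝[Ici 0] t0, t ∈ Icc (0:ℝ) (t0 + 1) := by
    filter_upwards [self_mem_nhdsWithin, mem_nhdsWithin_of_mem_nhds (Iic_mem_nhds (show t0 < t0 + 1 by linarith))] with t h1 h2
    exact ⟨h1, h2⟩
  refine intervalIntegral.continuousWithinAt_of_dominated_interval (bound := fun _ => B) ?_ ?_ ?_ ?_
  · filter_upwards [hmem] with t ht
    have := (ii hR hf ht.1).aestronglyMeasurable
    rwa [uIoc_of_le hR.le]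
  · filter_upwards [hmem] with t ht
    refine Eventually.of_forall fun r hr => ?_
    rw [uIoc_of_le hR.le] at hr
    exact hB r ⟨hr.1.le, hr.2⟩ t ht
  · simp
  · refine Eventually.of_forall fun r hr => ?_
    rw [uIoc_of_le hR.le] at hr
    have h := hf (r, t0) ⟨⟨hr.1.le, hr.2⟩, ht0⟩
    exact h.comp (f := fun t => (r, t)) (t := Kc R) (by fun_prop) (fun t ht => ⟨⟨hr.1.le, hr.2⟩, ht⟩)

theorem I_deriv (hR : 0 < R) (hf : Sm R f) {t : ℝ} (ht : 0 < t) : HasDerivAt (I R f) (I R (dt f) t) t := by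
  obtain ⟨B, hB⟩ := exists_bound hf.dt.cont (t + 1)
  have hmem : Ioo 0 (t+1) ∈ 𝓝 t := Ioo_mem_nhds ht (by linarith)
  refine (intervalIntegral.hasDerivAt_integral_of_dominated_loc_of_deriv_le (𝕜 := ℝ) (bound := fun _ => B)
    (F := fun t r => f (r, t)) (F' := fun t r => dt f (r, t)) hmem ?_ ?_ ?_ ?_ ?_ ?_).2
  · filter_upwards [hmem] with t ht
    have := (ii hR hf.cont ht.1.le).aestronglyMeasurable
    rwa [uIoc_of_le hR.le]
  · exact ii hR hf.cont ht.le
  · have := (ii hR hf.dt.cont ht.le).aestronglyMeasurable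
    rwa [uIoc_of_le hR.le]
  · refine Eventually.of_forall fun r hr s hs => ?_
    rw [uIoc_of_le hR.le] at hr
    exact hB r ⟨hr.1.le, hr.2⟩ s ⟨hs.1.le, hs.2.le⟩
  · simp
  · refine Eventually.of_forall fun r hr s hs => ?_
    rw [uIoc_of_le hR.le] at hr
    exact hf.ht ⟨⟨hr.1.le, hr.2⟩, hs.1.le⟩

theorem I_dr (hR : 0 < R) (hf : Sm R f) {t : ℝ} (ht : 0 ≤ t) : I R (dr f) t = f (R, t) - f (0, t) := by
  refine intervalIntegral.integral_eq_sub_of_hasDerivAt (f := fun r => f (r, t)) ?_ (ii hR hf.dr.cont ht)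
  intro r hr
  rw [uIcc_of_le hR.le] at hr
  exact hf.hr ⟨hr, ht⟩

theorem I_add (hR : 0 < R) (hf : ContinuousOn f (Kc R)) (hg : ContinuousOn g (Kc R)) {t : ℝ} (ht : 0 ≤ t) :
    I R (fun x => f x + g x) t = I R f t + I R g t :=
  intervalIntegral.integral_add (ii hR hf ht) (ii hR hg ht)
theorem I_sub (hR : 0 < R) (hf : ContinuousOn f (Kc R)) (hg : ContinuousOn g (Kc R)) {t : ℝ} (ht : 0 ≤ t) :
    I R (fun x => f x - g x) t = I R f t - I R g t :=
  intervalIntegral.integral_sub (ii hR hf ht) (ii hR hg ht)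
theorem I_mul (c : ℝ) (f : ℝ × ℝ → ℝ) (t : ℝ) : I R (fun x => c * f x) t = c * I R f t :=
  intervalIntegral.integral_const_mul _ _
theorem I_mono (hR : 0 < R) (hf : ContinuousOn f (Kc R)) (hg : ContinuousOn g (Kc R)) {t : ℝ} (ht : 0 ≤ t)
    (h : ∀ r ∈ Icc 0 R, f (r, t) ≤ g (r, t)) : I R f t ≤ I R g t :=
  intervalIntegral.integral_mono_on hR.le (ii hR hf ht) (ii hR hg ht) h
theorem I_congr (hR : 0 < R) {t : ℝ} (h : ∀ r ∈ Icc 0 R, f (r, t) = g (r, t)) : I R f t = I R g t := by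
  refine intervalIntegral.integral_congr ?_
  rw [uIcc_of_le hR.le]; exact h
theorem I_congr' (hR : 0 < R) {t : ℝ} (h : ∀ r ∈ Ioo 0 R, f (r, t) = g (r, t)) : I R f t = I R g t := by
  unfold I
  rw [intervalIntegral.integral_of_le hR.le, intervalIntegral.integral_of_le hR.le,
    integral_Ioc_eq_integral_Ioo, integral_Ioc_eq_integral_Ioo]
  exact setIntegral_congr_fun measurableSet_Ioo h
theorem I_nonneg (hR : 0 < R) {t : ℝ} (h : ∀ r ∈ Icc 0 R, 0 ≤ f (r, t)) : 0 ≤ I R f t :=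
  intervalIntegral.integral_nonneg hR.le h

/-- local balance law -/
theorem balance (hR : 0 < R) {J S : ℝ × ℝ → ℝ} (hg : Sm R g) (hJ : Sm R J) (hS : ContinuousOn S (Kc R))
    (h : ∀ r t, (r, t) ∈ Oc R → ∃ gt Jr, HasDerivAt (fun s => g (r, s)) gt t ∧
      HasDerivAt (fun s => J (s, t)) Jr r ∧ gt = Jr + S (r, t)) {t : ℝ} (ht : 0 < t) :
    HasDerivAt (I R g) (J (R, t) - J (0, t) + I R S t) t := by
  have h1 := I_deriv hR hg ht
  have h2 : I R (dt g) t = I R (fun x => dr J x + S x) t := by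
    refine I_congr' hR fun r hr => ?_
    have hx : (r, t) ∈ Oc R := ⟨hr, ht⟩
    obtain ⟨gt, Jr, e1, e2, e3⟩ := h r t hx
    rw [(hg.ht (Oc_sub R hx)).unique e1, (hJ.hr (Oc_sub R hx)).unique e2, e3]
  rw [h2, I_add hR hJ.dr.cont hS ht.le, I_dr hR hJ ht.le] at h1
  exact h1

/-- Cauchy-Schwarz -/
theorem I_CS (hR : 0 < R) (hf : ContinuousOn f (Kc R)) (hg : ContinuousOn g (Kc R)) {t : ℝ} (ht : 0 ≤ t) :
    (I R (fun x => f x * g x) t) ^ 2 ≤ I R (fun x => f x ^ 2) t * I R (fun x => g x ^ 2) t := by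
  have key : ∀ s : ℝ, 0 ≤ I R (fun x => f x ^ 2) t * (s * s) + (-2 * I R (fun x => f x * g x) t) * s + I R (fun x => g x ^ 2) t := by
    intro s
    have e : I R (fun x => (s * f x - g x) ^ 2) t = I R (fun x => f x ^ 2) t * (s * s) + (-2 * I R (fun x => f x * g x) t) * s + I R (fun x => g x ^ 2) t := by
      have e1 : I R (fun x => (s * f x - g x) ^ 2) t = I R (fun x => ((s*s) * f x ^ 2 + (-2*s) * (f x * g x)) + g x ^ 2) t :=
        I_congr hR fun r _ => by ring
      rw [e1, I_add hR (by fun_prop) (by fun_prop) ht, I_add hR (by fun_prop) (by fun_prop) ht, I_mul, I_mul]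
      ring
    rw [← e]
    exact I_nonneg hR fun r _ => sq_nonneg _
  have := discrim_le_zero key
  unfold discrim at this
  nlinarith

end NS
end

section
open scoped ContDiff Topology
namespace NS

/-- divergence -/
def dv (u V : ℝ × ℝ → ℝ) (x : ℝ × ℝ) : ℝ := dr u x + V x
/-- effective viscous flux -/
def Fx (μ β γ : ℝ) (ρ u V : ℝ × ℝ → ℝ) (x : ℝ × ℝ) : ℝ :=
  (2 * μ + ρ x ^ β) * dv u V x - ρ x ^ γ

/-- The smooth solution in a form that is regular up to `r = 0`: `u = r V`. -/
structure Sol (μ β γ R : ℝ) (ρ u V : ℝ × ℝ → ℝ) : Prop where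
  hμ : 0 < μ
  hβ : 1 < β
  hγ : 1 < γ
  hR : 0 < R
  cρ : ContDiff ℝ ∞ ρ
  cu : ContDiff ℝ ∞ u
  cV : ContDiff ℝ ∞ V
  pos : ∀ x ∈ Kc R, 0 < ρ x
  uV : ∀ x ∈ Kc R, u x = x.1 * V x
  uR : ∀ t, 0 ≤ t → u (R, t) = 0
  drV : ∀ x ∈ Kc R, dr u x = V x + x.1 * dr V x
  dtV : ∀ x ∈ Kc R, dt u x = x.1 * dt V x
  mass : ∀ x ∈ Kc R, dt ρ x = - (u x * dr ρ x) - ρ x * dv u V x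
  mom : ∀ x ∈ Kc R, dr (Fx μ β γ ρ u V) x = ρ x * (dt u x + u x * dr u x)

namespace Sol
variable {μ β γ R : ℝ} {ρ u V : ℝ × ℝ → ℝ}
theorem sρ (S : Sol μ β γ R ρ u V) : Sm R ρ := S.cρ.sm
theorem su (S : Sol μ β γ R ρ u V) : Sm R u := S.cu.sm
theorem sV (S : Sol μ β γ R ρ u V) : Sm R V := S.cV.sm
theorem sd (S : Sol μ β γ R ρ u V) : Sm R (dv u V) := S.su.dr.add S.sV
theorem sp (S : Sol μ β γ R ρ u V) (p : ℝ) : Sm R (fun x => ρ x ^ p) := S.sρ.rpow S.pos p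
theorem sF (S : Sol μ β γ R ρ u V) : Sm R (Fx μ β γ ρ u V) :=
  (((Sm.const (2 * μ)).add (S.sp β)).mul S.sd).sub (S.sp γ)
theorem u0 (S : Sol μ β γ R ρ u V) {t : ℝ} (ht : 0 ≤ t) : u (0, t) = 0 := by
  rw [S.uV (0, t) ⟨⟨le_rfl, S.hR.le⟩, ht⟩]; simp
theorem V_R (S : Sol μ β γ R ρ u V) {t : ℝ} (ht : 0 ≤ t) : V (R, t) = 0 := by
  have := S.uV (R, t) ⟨⟨S.hR.le, le_rfl⟩, ht⟩
  rw [S.uR t ht] at this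
  simpa [S.hR.ne'] using this.symm
end Sol

theorem sol_of_radial {μ β γ R : ℝ} {ρ u : ℝ → ℝ → ℝ} (h : RadialSolutionGlobal μ β γ R ρ u) :
    Sol μ β γ R (Function.uncurry ρ) (Function.uncurry u) (avg (dr (Function.uncurry u))) := by
  have cρ : ContDiff ℝ ∞ (Function.uncurry ρ) := contDiff_infty.2 h.smooth_ρ
  have cu : ContDiff ℝ ∞ (Function.uncurry u) := contDiff_infty.2 h.smooth_u
  set ρ' := Function.uncurry ρ with hρ'
  set u' := Function.uncurry u with hu'
  have cdu : ContDiff ℝ ∞ (dr u') := by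
    have : ContDiff ℝ ∞ (fderiv ℝ u') := cu.fderiv_right (by simp)
    exact this.clm_apply contDiff_const
  have cV : ContDiff ℝ ∞ (avg (dr u')) := avg_smooth cdu
  set V := avg (dr u') with hV
  have sρ : Sm R ρ' := cρ.sm
  have su : Sm R u' := cu.sm
  have sV : Sm R V := cV.sm
  have hdr : ∀ r t, HasDerivAt (fun s => u' (s, t)) (dr u' (r, t)) r := by
    intro r t
    have h1 := (cu.differentiable (by simp) (r, t)).hasFDerivAt
    have h2 : HasDerivAt (fun s : ℝ => (s, t)) ((1:ℝ), (0:ℝ)) r := (hasDerivAt_id r).prodMk (hasDerivAt_const r t)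
    exact h1.comp_hasDerivAt r h2
  have pos : ∀ x ∈ Kc R, 0 < ρ' x := fun x hx => h.ρ_pos x.1 hx.1 x.2 hx.2
  have uV : ∀ x ∈ Kc R, u' x = x.1 * V x := by
    rintro ⟨r, t⟩ hx
    rw [hV, mul_avg, intervalIntegral.integral_eq_sub_of_hasDerivAt (f := fun r => u' (r, t)) (fun s _ => hdr s t)]
    · have := h.bc0 t hx.2
      simp [hu', this]
    · exact (cdu.continuous.comp (by fun_prop : Continuous fun s : ℝ => (s, t))).intervalIntegrable _ _
  have hp : ∀ p : ℝ, Sm R (fun x => ρ' x ^ p) := fun p => sρ.rpow pos p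
  have sF : Sm R (Fx μ β γ ρ' u' V) :=
    (((Sm.const (2 * μ)).add (hp β)).mul (su.dr.add sV)).sub (hp γ)
  have smass : ∀ x ∈ Kc R, dt ρ' x = - (u' x * dr ρ' x) - ρ' x * dv u' V x := by
    refine eqOn_K h.hR sρ.dt.cont (((su.mul sρ.dr).neg).sub (sρ.mul (su.dr.add sV))).cont ?_
    rintro ⟨r, t⟩ hx
    have hk := Oc_sub R hx
    have hm := h.mass r hx.1 t hk.2
    have e1 : deriv (fun τ => ρ r τ) t = dt ρ' (r, t) := (sρ.ht hk).deriv
    have e2 : deriv (fun s => ρ s t * u s t) r = dr ρ' (r, t) * u r t + ρ r t * dr u' (r, t) :=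
      ((sρ.hr hk).mul (su.hr hk)).deriv
    have e3 : u r t = r * V (r, t) := uV (r, t) hk
    have hr0 : r ≠ 0 := hx.1.1.ne'
    rw [e1, e2] at hm
    have e4 : ρ r t * u r t / r = ρ r t * V (r, t) := by rw [e3]; field_simp
    rw [e4] at hm
    simp only [dv, hρ', hu', Function.uncurry] at hm ⊢
    linarith
  refine ⟨h.hμ, h.hβ, h.hγ, h.hR, cρ, cu, cV, pos, uV, fun t ht => h.bcR t ht, ?_, ?_, smass, ?_⟩
  · have := dr_eq h.hR su (Sm.fst.mul sV) uV
    rintro ⟨r, t⟩ hx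
    rw [this _ hx]
    have h1 := (Sm.fst.mul sV).hr hx
    have h2 := (hasDerivAt_id r).mul (sV.hr hx)
    rw [h1.unique h2]; simp
  · have := dt_eq h.hR su (Sm.fst.mul sV) uV
    rintro ⟨r, t⟩ hx
    rw [this _ hx]
    have h1 := (Sm.fst.mul sV).ht hx
    have h2 := (sV.ht hx).const_mul r
    rw [h1.unique h2]
  · refine eqOn_K h.hR sF.dr.cont (sρ.mul (su.dt.add (su.mul su.dr))).cont ?_
    rintro ⟨r, t⟩ hx
    have hk := Oc_sub R hx
    have hm := h.momentum r hx.1 t hk.2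
    have hms := smass (r, t) hk
    have e1 : deriv (fun τ => ρ r τ * u r τ) t = dt ρ' (r, t) * u r t + ρ r t * dt u' (r, t) :=
      ((sρ.ht hk).mul (su.ht hk)).deriv
    have e2 : deriv (fun s => ρ s t * u s t ^ 2) r = dr ρ' (r, t) * u r t ^ 2 + ρ r t * (2 * u r t * dr u' (r, t)) := by
      have := ((sρ.hr hk).mul ((su.hr hk).pow 2)).deriv
      refine (this : deriv (fun s => ρ s t * u s t ^ 2) r = _).trans ?_
      have a1 : u' (r, t) = u r t := rfl
      have a2 : ρ' (r, t) = ρ r t := rfl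
      simp only [Pi.pow_apply, a1, a2]
      norm_num
    have e3 : u r t = r * V (r, t) := uV (r, t) hk
    have hr0 : r ≠ 0 := hx.1.1.ne'
    have e4 : ρ r t * u r t ^ 2 / r = ρ r t * u r t * V (r, t) := by rw [e3]; field_simp
    have e5 : deriv (fun s => ρ s t ^ γ) r = dr (fun x => ρ' x ^ γ) (r, t) := ((hp γ).hr hk).deriv
    have e6 : deriv (fun s => (2 * μ + ρ s t ^ β) * rdiv u s t) r
        = dr (fun x => (2 * μ + ρ' x ^ β) * dv u' V x) (r, t) := by
      have s1 : Sm R (fun x => (2 * μ + ρ' x ^ β) * dv u' V x) := ((Sm.const (2 * μ)).add (hp β)).mul (su.dr.add sV)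
      rw [← (s1.hr hk).deriv]
      refine Filter.EventuallyEq.deriv_eq ?_
      filter_upwards [Ioo_mem_nhds hx.1.1 hx.1.2] with s hs
      have hk' : (s, t) ∈ Kc R := ⟨⟨hs.1.le, hs.2.le⟩, hk.2⟩
      have a1 : deriv (fun s => u s t) s = dr u' (s, t) := (hdr s t).deriv
      have a2 : u s t = s * V (s, t) := uV (s, t) hk'
      have : rdiv u s t = dv u' V (s, t) := by
        unfold rdiv dv
        rw [a1, a2, mul_div_cancel_left₀ _ hs.1.ne']
      rw [this]; rfl
    have e7 : dr (Fx μ β γ ρ' u' V) (r, t) = dr (fun x => (2 * μ + ρ' x ^ β) * dv u' V x) (r, t)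
        - dr (fun x => ρ' x ^ γ) (r, t) := by
      have s1 : Sm R (fun x => (2 * μ + ρ' x ^ β) * dv u' V x) := ((Sm.const (2 * μ)).add (hp β)).mul (su.dr.add sV)
      exact (sF.hr hk).unique ((s1.hr hk).sub ((hp γ).hr hk))
    rw [e1, e2, e4, e5, e6, hms] at hm
    rw [e7]
    have a1 : u' (r, t) = u r t := rfl
    have a2 : ρ' (r, t) = ρ r t := rfl
    simp only [dv, a1, a2] at hm ⊢
    linarith

end NS
end

section
open scoped ContDiff Topology
namespace NS
namespace Sol
variable {μ β γ R : ℝ} {ρ u V : ℝ × ℝ → ℝ}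

theorem pr (S : Sol μ β γ R ρ u V) (p : ℝ) {r t : ℝ} (hx : (r, t) ∈ Kc R) :
    HasDerivAt (fun s => ρ (s, t) ^ p) (dr ρ (r, t) * p * ρ (r, t) ^ (p - 1)) r :=
  (S.sρ.hr hx).rpow_const (Or.inl (S.pos _ hx).ne')
theorem pt (S : Sol μ β γ R ρ u V) (p : ℝ) {r t : ℝ} (hx : (r, t) ∈ Kc R) :
    HasDerivAt (fun s => ρ (r, s) ^ p) (dt ρ (r, t) * p * ρ (r, t) ^ (p - 1)) t :=
  (S.sρ.ht hx).rpow_const (Or.inl (S.pos _ hx).ne')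
theorem pe (S : Sol μ β γ R ρ u V) (p : ℝ) {x} (hx : x ∈ Kc R) : ρ x ^ p = ρ x ^ (p - 1) * ρ x := by
  rw [Real.rpow_sub_one (S.pos x hx).ne', div_mul_cancel₀ _ (S.pos x hx).ne']

def enW (γ : ℝ) (ρ u : ℝ × ℝ → ℝ) (w : ℝ → ℝ) (x : ℝ × ℝ) : ℝ :=
  (1/2 * ρ x * u x ^ 2 + (γ - 1)⁻¹ * ρ x ^ γ) * x.1 * w x.1

theorem s_enW (S : Sol μ β γ R ρ u V) {w : ℝ → ℝ} (hw : Sm R (fun x => w x.1)) :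
    Sm R (enW γ ρ u w) :=
  (((((Sm.const (1/2)).mul S.sρ).mul (S.su.pow 2)).add ((Sm.const _).mul (S.sp γ))).mul Sm.fst).mul hw

theorem energyW (S : Sol μ β γ R ρ u V) {w w' : ℝ → ℝ} (hw : Sm R (fun x => w x.1))
    (hw' : ∀ r ∈ Icc 0 R, HasDerivAt w (w' r) r) (hwc : ContinuousOn w' (Icc 0 R)) {t : ℝ} (ht : 0 < t) :
    HasDerivAt (I R (enW γ ρ u w)) (I R (fun x => 1/2 * ρ x * u x ^ 3 * x.1 * w' x.1
      - (2 * μ + ρ x ^ β) * dv u V x ^ 2 * x.1 * w x.1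
      - (2 * μ + ρ x ^ β) * dv u V x * u x * x.1 * w' x.1
      + (1 + (γ - 1)⁻¹) * ρ x ^ γ * u x * x.1 * w' x.1) t) t := by
  have hwc' : ContinuousOn (fun x : ℝ × ℝ => w' x.1) (Kc R) :=
    hwc.comp continuousOn_fst (fun x hx => hx.1)
  have hJ : Sm R (fun x => -(1/2) * ρ x * u x ^ 3 * x.1 * w x.1 + Fx μ β γ ρ u V x * u x * x.1 * w x.1
      - (γ - 1)⁻¹ * ρ x ^ γ * u x * x.1 * w x.1) :=
    ((((((Sm.const _).mul S.sρ).mul (S.su.pow 3)).mul Sm.fst).mul hw).add (((S.sF.mul S.su).mul Sm.fst).mul hw)).sub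
      (((((Sm.const _).mul (S.sp γ)).mul S.su).mul Sm.fst).mul hw)
  have c1 := S.sρ.cont
  have c2 := S.su.cont
  have c3 := S.sd.cont
  have c4 := (S.sp β).cont
  have c5 := (S.sp γ).cont
  have key : ∀ W W' L P : ℝ × ℝ → ℝ, ContinuousOn W (Kc R) → ContinuousOn W' (Kc R) → ContinuousOn L (Kc R) →
      ContinuousOn P (Kc R) → ContinuousOn (fun x => 1/2 * ρ x * u x ^ 3 * x.1 * W' x
      - (2 * μ + L x) * dv u V x ^ 2 * x.1 * W x
      - (2 * μ + L x) * dv u V x * u x * x.1 * W' x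
      + (1 + (γ - 1)⁻¹) * P x * u x * x.1 * W' x) (Kc R) := by intros; fun_prop
  have := balance S.hR (S.s_enW hw) hJ (S := fun x => 1/2 * ρ x * u x ^ 3 * x.1 * w' x.1
      - (2 * μ + ρ x ^ β) * dv u V x ^ 2 * x.1 * w x.1
      - (2 * μ + ρ x ^ β) * dv u V x * u x * x.1 * w' x.1
      + (1 + (γ - 1)⁻¹) * ρ x ^ γ * u x * x.1 * w' x.1) (key _ _ _ _ hw.cont hwc' c4 c5) ?_ ht
  · simpa [S.uR t ht.le, S.u0 ht.le] using this
  · intro r t hx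
    have hk := Oc_sub R hx
    refine ⟨_, _, ((((S.sρ.ht hk).const_mul (1/2)).fun_mul ((S.su.ht hk).fun_pow 2)).fun_add
        ((S.pt γ hk).const_mul (γ-1)⁻¹)).mul_const r |>.mul_const (w r),
      ((((((S.sρ.hr hk).const_mul (-(1/2))).fun_mul ((S.su.hr hk).fun_pow 3)).fun_mul (hasDerivAt_id' r)).fun_mul (hw' r hk.1)).fun_add
        ((((S.sF.hr hk).fun_mul (S.su.hr hk)).fun_mul (hasDerivAt_id' r)).fun_mul (hw' r hk.1))).fun_sub
        (((((S.pr γ hk).const_mul (γ-1)⁻¹).fun_mul (S.su.hr hk)).fun_mul (hasDerivAt_id' r)).fun_mul (hw' r hk.1)), ?_⟩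
    have hc : (γ - 1)⁻¹ * (γ - 1) = 1 := inv_mul_cancel₀ (by have := S.hγ; linarith)
    have h1 := S.mass _ hk
    have h2 := S.mom _ hk
    have h3 := S.uV _ hk
    have h4 := S.pe γ hk
    simp only at h3
    rw [h1, h2]
    simp only [Fx, dv, h4]
    rw [h3]
    push_cast
    generalize ρ (r, t) ^ (γ - 1) = Q
    generalize ρ (r, t) ^ β = L
    generalize dr u (r,t) = ur
    generalize ρ (r,t) = q
    generalize dr ρ (r,t) = qr
    generalize (γ - 1)⁻¹ = c at *
    linear_combination (- Q * q * w r * r * (ur + V (r,t))) * hc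
end Sol
end NS
end

section
open scoped ContDiff Topology
namespace NS

/-- radial primitive -/
def prim (f : ℝ × ℝ → ℝ) (x : ℝ × ℝ) : ℝ := x.1 * avg f x
theorem prim_smooth {f : ℝ × ℝ → ℝ} (hf : ContDiff ℝ ∞ f) : ContDiff ℝ ∞ (prim f) :=
  contDiff_fst.mul (avg_smooth hf)
theorem prim_eq (f : ℝ × ℝ → ℝ) (r t : ℝ) : prim f (r, t) = ∫ s in (0:ℝ)..r, f (s, t) := mul_avg f r t
theorem prim_hr {f : ℝ × ℝ → ℝ} (hf : ContDiff ℝ ∞ f) (r t : ℝ) :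
    HasDerivAt (fun s => prim f (s, t)) (f (r, t)) r := by
  have hc : Continuous (fun s => f (s, t)) := hf.continuous.comp (by fun_prop)
  have := intervalIntegral.integral_hasDerivAt_right (hc.intervalIntegrable 0 r)
    hc.stronglyMeasurable.stronglyMeasurableAtFilter hc.continuousAt
  refine this.congr_of_eventuallyEq (Eventually.of_forall fun s => prim_eq f s t)
theorem prim_dr {R : ℝ} {f : ℝ × ℝ → ℝ} (hf : ContDiff ℝ ∞ f) {x} (hx : x ∈ Kc R) :
    dr (prim f) x = f x := by
  obtain ⟨r, t⟩ := x
  exact ((prim_smooth hf).sm.hr hx).unique (prim_hr hf r t)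
theorem prim_zero (f : ℝ × ℝ → ℝ) (t : ℝ) : prim f (0, t) = 0 := by simp [prim]
theorem prim_R (R : ℝ) (f : ℝ × ℝ → ℝ) (t : ℝ) : prim f (R, t) = I R f t := prim_eq f R t

section oneD
variable {R : ℝ} {f g : ℝ × ℝ → ℝ}

theorem const_of_dr (hf : Sm R f) {t : ℝ} (ht : 0 ≤ t) (h : ∀ r ∈ Icc 0 R, dr f (r, t) = 0)
    {r : ℝ} (hr : r ∈ Icc 0 R) : f (r, t) = f (R, t) := by
  have hR : 0 ≤ R := hr.1.trans hr.2
  have := constant_of_has_deriv_right_zero (f := fun s => f (s, t)) (a := 0) (b := R) (hf.cr ht) (fun s hs => by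
    have := hf.hr (r := s) (t := t) ⟨⟨hs.1, hs.2.le⟩, ht⟩
    rw [h s ⟨hs.1, hs.2.le⟩] at this
    exact this.hasDerivWithinAt)
  rw [this r hr, this R ⟨hR, le_rfl⟩]

theorem grad_eq (hR : 0 < R) (hf : Sm R f) (hg : Sm R g) (h : ∀ x ∈ Kc R, f x = x.1 * g x)
    {t : ℝ} (ht : 0 ≤ t) (hfR : f (R, t) = 0) :
    I R (fun x => (dr f x + g x) ^ 2 * x.1) t = I R (fun x => (dr f x ^ 2 + g x ^ 2) * x.1) t := by
  have c1 := hf.dr.cont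
  have c2 := hg.cont
  have c3 := hf.cont
  have e1 : I R (dr (fun x => f x ^ 2)) t = 0 := by
    rw [I_dr hR (hf.pow 2) ht, hfR, h (0, t) ⟨⟨le_rfl, hR.le⟩, ht⟩]; simp
  have e2 : I R (fun x => (dr f x + g x) ^ 2 * x.1) t =
      I R (fun x => (dr f x ^ 2 + g x ^ 2) * x.1 + dr (fun x => f x ^ 2) x) t := by
    refine I_congr hR fun r hr => ?_
    have hk : (r, t) ∈ Kc R := ⟨hr, ht⟩
    have := ((hf.pow 2).hr hk).unique ((hf.hr hk).fun_pow 2)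
    rw [this, h _ hk]; push_cast; ring
  rw [e2, I_add hR (by fun_prop) (hf.pow 2).dr.cont ht, e1, add_zero]

theorem sup_le (hR : 0 < R) (hf : Sm R f) (hg : Sm R g) (h : ∀ x ∈ Kc R, f x = x.1 * g x)
    {t : ℝ} (ht : 0 ≤ t) (hfR : f (R, t) = 0) {r : ℝ} (hr : r ∈ Icc 0 R) :
    f (r, t) ^ 2 ≤ I R (fun x => (dr f x ^ 2 + g x ^ 2) * x.1) t := by
  have c1 := hf.dr.cont
  have c2 := hg.cont
  have c3 := hf.cont
  have s1 := (hf.pow 2).neg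
  have hsub : Icc r R ⊆ Icc 0 R := Icc_subset_Icc_left hr.1
  have hcont : ContinuousOn (fun x => (dr f x ^ 2 + g x ^ 2) * x.1) (Kc R) := by fun_prop
  have i1 : IntervalIntegrable (fun s => dr (fun x => - f x ^ 2) (s, t)) volume r R :=
    ((s1.dr.cr ht).mono (by rw [uIcc_of_le hr.2]; exact hsub)).intervalIntegrable
  have i2 : IntervalIntegrable (fun s => (dr f (s,t) ^ 2 + g (s,t) ^ 2) * s) volume r R :=
    ((hcont.cr ht).mono (by rw [uIcc_of_le hr.2]; exact hsub)).intervalIntegrable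
  have e1 : ∫ s in r..R, dr (fun x => - f x ^ 2) (s, t) = f (r, t) ^ 2 := by
    rw [intervalIntegral.integral_eq_sub_of_hasDerivAt (f := fun s => - f (s, t) ^ 2) (fun s hs => ?_) i1]
    · simp [hfR]
    · rw [uIcc_of_le hr.2] at hs
      exact s1.hr ⟨hsub hs, ht⟩
  rw [← e1]
  calc _ ≤ ∫ s in r..R, (dr f (s,t) ^ 2 + g (s,t) ^ 2) * s := by
        refine intervalIntegral.integral_mono_on hr.2 i1 i2 fun s hs => ?_
        have hk : (s, t) ∈ Kc R := ⟨hsub hs, ht⟩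
        have := (s1.hr hk).unique ((hf.hr hk).fun_pow 2).fun_neg
        have hs0 : 0 ≤ s := (hsub hs).1
        rw [this, h _ hk]; push_cast
        nlinarith [mul_nonneg hs0 (sq_nonneg (dr f (s,t) + g (s,t)))]
    _ ≤ ∫ s in (0:ℝ)..R, (dr f (s,t) ^ 2 + g (s,t) ^ 2) * s := by
        refine intervalIntegral.integral_mono_interval hr.1 hr.2 le_rfl ?_ (ii hR hcont ht)
        refine (ae_restrict_iff' measurableSet_Ioc).2 (Eventually.of_forall fun s hs => ?_)
        have : 0 ≤ s := hs.1.le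
        simp only [Pi.zero_apply]; positivity
end oneD

namespace Sol
variable {μ β γ R : ℝ} {ρ u V : ℝ × ℝ → ℝ}

/-- Dirichlet energy -/
def Dd (R : ℝ) (u V : ℝ × ℝ → ℝ) (t : ℝ) : ℝ := I R (fun x => dv u V x ^ 2 * x.1) t

theorem D_eq (S : Sol μ β γ R ρ u V) {t : ℝ} (ht : 0 ≤ t) :
    Dd R u V t = I R (fun x => (dr u x ^ 2 + V x ^ 2) * x.1) t :=
  grad_eq S.hR S.su S.sV S.uV ht (S.uR t ht)
theorem u_le (S : Sol μ β γ R ρ u V) {t : ℝ} (ht : 0 ≤ t) {r : ℝ} (hr : r ∈ Icc 0 R) :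
    u (r, t) ^ 2 ≤ Dd R u V t := by
  rw [S.D_eq ht]; exact sup_le S.hR S.su S.sV S.uV ht (S.uR t ht) hr
theorem V_le (S : Sol μ β γ R ρ u V) {t : ℝ} (ht : 0 ≤ t) :
    I R (fun x => V x ^ 2 * x.1) t ≤ Dd R u V t := by
  rw [S.D_eq ht]
  have c1 := S.su.dr.cont
  have c2 := S.sV.cont
  refine I_mono S.hR (by fun_prop) (by fun_prop) ht fun r hr => ?_
  have := hr.1
  nlinarith [mul_nonneg this (sq_nonneg (dr u (r,t)))]
theorem D_nonneg (S : Sol μ β γ R ρ u V) {t : ℝ} : 0 ≤ Dd R u V t :=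
  I_nonneg S.hR fun r hr => mul_nonneg (sq_nonneg _) hr.1
theorem d_int (S : Sol μ β γ R ρ u V) {t : ℝ} (ht : 0 ≤ t) : I R (fun x => dv u V x * x.1) t = 0 := by
  have e : I R (fun x => dv u V x * x.1) t = I R (dr (fun x => x.1 * u x)) t := by
    refine I_congr S.hR fun r hr => ?_
    have hk : (r, t) ∈ Kc R := ⟨hr, ht⟩
    have := ((Sm.fst.mul S.su).hr hk).unique ((hasDerivAt_id' r).fun_mul (S.su.hr hk))
    rw [this, S.uV _ hk, dv]; ring
  rw [e, I_dr S.hR (Sm.fst.mul S.su) ht, S.uR t ht]; simp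

theorem bal_beta (S : Sol μ β γ R ρ u V) {t : ℝ} (ht : 0 < t) :
    HasDerivAt (I R (fun x => ρ x ^ β * x.1)) (I R (fun x => -(β - 1) * (ρ x ^ β * dv u V x * x.1)) t) t := by
  have c3 := S.sd.cont
  have c4 := (S.sp β).cont
  have key : ∀ L : ℝ × ℝ → ℝ, ContinuousOn L (Kc R) → ContinuousOn (fun x => -(β - 1) * (L x * dv u V x * x.1)) (Kc R) := by
    intros; fun_prop
  have := balance S.hR ((S.sp β).mul Sm.fst) (((S.sp β).mul S.su).mul Sm.fst).neg (key _ c4) ?_ ht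
  · simpa [S.uR t ht.le] using this
  · intro r t hx
    have hk := Oc_sub R hx
    refine ⟨_, _, (S.pt β hk).mul_const r, (((S.pr β hk).fun_mul (S.su.hr hk)).fun_mul (hasDerivAt_id' r)).fun_neg, ?_⟩
    have h1 := S.mass _ hk
    have h3 := S.uV _ hk
    have h4 := S.pe β hk
    simp only at h3
    rw [h1]; simp only [dv, h4]; rw [h3]; ring

theorem bal_mom (S : Sol μ β γ R ρ u V) {t : ℝ} (ht : 0 < t) :
    HasDerivAt (I R (fun x => ρ x * u x * x.1 ^ 2))
      (R ^ 2 * Fx μ β γ ρ u V (R, t) + I R (fun x => ρ x * u x ^ 2 * x.1 - 2 * (Fx μ β γ ρ u V x * x.1)) t) t := by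
  have c1 := S.sρ.cont
  have c2 := S.su.cont
  have c3 := S.sF.cont
  have := balance S.hR ((S.sρ.mul S.su).mul (Sm.fst.pow 2)) ((Sm.fst.pow 2).mul (S.sF.sub (S.sρ.mul (S.su.pow 2))))
    (S := fun x => ρ x * u x ^ 2 * x.1 - 2 * (Fx μ β γ ρ u V x * x.1)) (by fun_prop) ?_ ht
  · simpa [S.uR t ht.le] using this
  · intro r t hx
    have hk := Oc_sub R hx
    refine ⟨_, _, ((S.sρ.ht hk).fun_mul (S.su.ht hk)).mul_const (r ^ 2),
      ((hasDerivAt_id' r).fun_pow 2).fun_mul ((S.sF.hr hk).fun_sub ((S.sρ.hr hk).fun_mul ((S.su.hr hk).fun_pow 2))), ?_⟩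
    have h1 := S.mass _ hk
    have h2 := S.mom _ hk
    have h3 := S.uV _ hk
    simp only at h3
    rw [h1, h2]; simp only [dv]; rw [h3]; push_cast; ring

theorem bal_mass (S : Sol μ β γ R ρ u V) {t : ℝ} (ht : 0 < t) :
    HasDerivAt (I R (fun x => ρ x * x.1)) 0 t := by
  have := balance S.hR (S.sρ.mul Sm.fst) ((S.sρ.mul S.su).mul Sm.fst).neg (S := fun _ => 0) (by fun_prop) ?_ ht
  · simpa [S.uR t ht.le, I] using this
  · intro r t hx
    have hk := Oc_sub R hx
    refine ⟨_, _, (S.sρ.ht hk).mul_const r, (((S.sρ.hr hk).fun_mul (S.su.hr hk)).fun_mul (hasDerivAt_id' r)).fun_neg, ?_⟩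
    have h1 := S.mass _ hk
    have h3 := S.uV _ hk
    simp only at h3
    rw [h1]; simp only [dv]; rw [h3]; ring

/-- potential of the viscosity -/
def th (μ β : ℝ) (ρ : ℝ × ℝ → ℝ) (x : ℝ × ℝ) : ℝ := 2 * μ * Real.log (ρ x) + β⁻¹ * ρ x ^ β

theorem s_th (S : Sol μ β γ R ρ u V) : Sm R (th μ β ρ) :=
  ((Sm.const _).mul (S.sρ.log S.pos)).add ((Sm.const _).mul (S.sp β))

theorem th_eq (S : Sol μ β γ R ρ u V) {r t : ℝ} (hk : (r, t) ∈ Kc R) :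
    dt (th μ β ρ) (r, t) + u (r, t) * dr (th μ β ρ) (r, t) = - Fx μ β γ ρ u V (r, t) - ρ (r, t) ^ γ := by
  have hp := S.pos _ hk
  have h1 := (S.s_th.ht hk).unique ((((S.sρ.ht hk).log hp.ne').const_mul (2 * μ)).fun_add ((S.pt β hk).const_mul β⁻¹))
  have h2 := (S.s_th.hr hk).unique ((((S.sρ.hr hk).log hp.ne').const_mul (2 * μ)).fun_add ((S.pr β hk).const_mul β⁻¹))
  have h3 := S.mass _ hk
  have h4 := S.pe β hk
  have hβ : β ≠ 0 := by have := S.hβ; linarith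
  rw [h1, h2, h3, Fx, h4]
  field_simp
  ring

theorem c_mom (S : Sol μ β γ R ρ u V) : ContDiff ℝ ∞ (fun x => ρ x * u x) := S.cρ.mul S.cu
theorem c_momV (S : Sol μ β γ R ρ u V) : ContDiff ℝ ∞ (fun x => ρ x * u x * V x) := S.c_mom.mul S.cV

theorem xi_t (S : Sol μ β γ R ρ u V) {r t : ℝ} (hk : (r, t) ∈ Kc R) :
    dt (prim (fun x => ρ x * u x)) (R, t) - dt (prim (fun x => ρ x * u x)) (r, t) =
      Fx μ β γ ρ u V (R, t) - Fx μ β γ ρ u V (r, t) + ρ (r, t) * u (r, t) ^ 2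
      - (prim (fun x => ρ x * u x * V x) (R, t) - prim (fun x => ρ x * u x * V x) (r, t)) := by
  have s1 : Sm R (prim (fun x => ρ x * u x)) := (prim_smooth S.c_mom).sm
  have s2 : Sm R (prim (fun x => ρ x * u x * V x)) := (prim_smooth S.c_momV).sm
  have sz := ((s1.dt.sub S.sF).add (S.sρ.mul (S.su.pow 2))).add s2
  have := const_of_dr sz hk.2 (fun s hs => ?_) hk.1
  · have e := S.uR t hk.2
    rw [e] at this
    linarith
  · have hk : (s, t) ∈ Kc R := ⟨hs, hk.2⟩
    have h1 := (sz.hr hk).unique ((((s1.dt.hr hk).fun_sub (S.sF.hr hk)).fun_add ((S.sρ.hr hk).fun_mul ((S.su.hr hk).fun_pow 2))).fun_add (s2.hr hk))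
    have h2 : dr (dt (prim (fun x => ρ x * u x))) (s, t) = dt ρ (s, t) * u (s, t) + ρ (s, t) * dt u (s, t) := by
      rw [← s1.symm hk]
      have a := dt_eq S.hR s1.dr S.c_mom.sm (fun x hx => prim_dr S.c_mom hx) _ hk
      rw [a]
      exact (S.c_mom.sm.ht hk).unique ((S.sρ.ht hk).fun_mul (S.su.ht hk))
    rw [h1, h2, prim_dr S.c_momV hk, S.mom _ hk, S.mass _ hk, dv]
    push_cast; ring
end Sol
end NS
end

section
open scoped ContDiff Topology
namespace NS

theorem le_of_deriv_nonpos {f : ℝ → ℝ} {a b : ℝ} (hab : a ≤ b) (hc : ContinuousOn f (Icc a b))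
    (h : ∀ t ∈ Ioo a b, ∃ f', HasDerivAt f f' t ∧ f' ≤ 0) : f b ≤ f a := by
  have := antitoneOn_of_deriv_nonpos (convex_Icc a b) hc
    (fun t ht => by
      rw [interior_Icc] at ht
      obtain ⟨f', h1, _⟩ := h t ht
      exact h1.differentiableAt.differentiableWithinAt)
    (fun t ht => by
      rw [interior_Icc] at ht
      obtain ⟨f', h1, h2⟩ := h t ht
      rw [h1.deriv]; exact h2)
  exact this ⟨le_rfl, hab⟩ ⟨hab, le_rfl⟩ hab

theorem exists_deriv_eq_diff {f : ℝ → ℝ} {a : ℝ} (hc : ContinuousOn f (Icc a (a + 1)))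
    (h : ∀ t ∈ Ioo a (a + 1), ∃ f', HasDerivAt f f' t) :
    ∃ t ∈ Ioo a (a + 1), HasDerivAt f (f (a + 1) - f a) t := by
  obtain ⟨c, hc1, hc2⟩ := exists_deriv_eq_slope f (by linarith : a < a + 1) hc
    (fun t ht => by
      obtain ⟨f', h1⟩ := h t ht
      exact h1.differentiableAt.differentiableWithinAt)
  refine ⟨c, hc1, ?_⟩
  obtain ⟨f', h1⟩ := h c hc1
  rw [h1.deriv] at hc2
  have : f' = f (a + 1) - f a := by rw [hc2]; simp
  rw [← this]; exact h1

/-- solution with controlled data -/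
def Data (μ β γ R M₁ M₂ : ℝ) (ρ u V : ℝ × ℝ → ℝ) : Prop :=
  Sol μ β γ R ρ u V ∧ (∀ r ∈ Icc 0 R, ρ (r, 0) ≤ M₁) ∧
    I R (fun x => (u x ^ 2 + (dr u x ^ 2 + V x ^ 2)) * x.1) 0 ≤ M₂

theorem I_id {R : ℝ} (t : ℝ) : I R (fun x => x.1) t = R ^ 2 / 2 := by
  simp [I]
theorem I_const {R : ℝ} (c t : ℝ) : I R (fun _ => c) t = R * c := by
  simp [I]

/-- bounded Lyapunov functional controlling `f` -/
def Lyap (H f : ℝ → ℝ) (E : ℝ) : Prop :=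
  ContinuousOn H (Ici 0) ∧ (∀ t, 0 ≤ t → |H t| ≤ E) ∧ ∀ t, 0 < t → ∃ h', HasDerivAt H h' t ∧ f t ≤ h'

theorem energy (μ β γ R M₁ M₂ : ℝ) : ∃ E, 0 < E ∧ ∀ ρ u V, Data μ β γ R M₁ M₂ ρ u V →
    (∃ H, Lyap H (Sol.Dd R u V) E) ∧ (∀ t, 0 ≤ t → I R (fun x => ρ x * u x ^ 2 * x.1) t ≤ E) ∧
    (∀ t, 0 ≤ t → I R (fun x => ρ x ^ γ * x.1) t ≤ E) ∧ Sol.Dd R u V 0 ≤ E := by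
  set E0 := 1/2 * M₁ * M₂ + (γ - 1)⁻¹ * M₁ ^ γ * (R ^ 2 / 2) with hE0
  refine ⟨1 + |E0| * (1 + (2 * μ)⁻¹ + 2 + (γ - 1)) + |E0| * |(2 * μ)⁻¹| + |M₂| + |E0| * |γ - 1| + |E0| * |γ-1| + |E0| * |(2*μ)⁻¹| + |E0| * |1 + (2 * μ)⁻¹ + 2 + (γ - 1)|, ?_, ?_⟩
  · have : |E0| * (1 + (2 * μ)⁻¹ + 2 + (γ - 1)) ≥ - (|E0| * |1 + (2 * μ)⁻¹ + 2 + (γ - 1)|) := by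
      have := neg_abs_le (1 + (2 * μ)⁻¹ + 2 + (γ - 1))
      nlinarith [abs_nonneg E0]
    have h1 : 0 ≤ |E0| * |(2 * μ)⁻¹| := by positivity
    have h2 : 0 ≤ |E0| * |γ - 1| := by positivity
    have h3 : 0 ≤ |M₂| := by positivity
    linarith
  rintro ρ u V ⟨S, h1, h2⟩
  have hμ := S.hμ
  have hγ : 0 < γ - 1 := by have := S.hγ; linarith
  have hR := S.hR
  have c1 := S.sρ.cont
  have c2 := S.su.cont
  have c3 := S.sd.cont
  have c4 := (S.sp β).cont
  have c5 := (S.sp γ).cont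
  have c6 := S.sV.cont
  have c7 := S.su.dr.cont
  have cg : 0 < (γ - 1)⁻¹ := by positivity
  have hM1 : 0 < M₁ := (S.pos (0,0) ⟨⟨le_rfl, hR.le⟩, self_mem_Ici⟩).trans_le (h1 0 ⟨le_rfl, hR.le⟩)
  set e := I R (Sol.enW γ ρ u (fun _ => 1)) with he
  have sw : Sm R (fun x : ℝ × ℝ => (fun _ : ℝ => (1:ℝ)) x.1) := Sm.const 1
  have sE := S.s_enW (w := fun _ => 1) sw
  have de : ∀ t, 0 < t → HasDerivAt e (- I R (fun x => (2 * μ + ρ x ^ β) * dv u V x ^ 2 * x.1) t) t := by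
    intro t ht
    have := S.energyW (w := fun _ => 1) (w' := fun _ => 0) sw (fun r _ => hasDerivAt_const r 1) continuousOn_const ht
    convert this using 1
    rw [← neg_one_mul, ← I_mul]
    refine I_congr hR fun r hr => by simp
  have kD : ∀ t, 0 ≤ t → 2 * μ * Sol.Dd R u V t ≤ I R (fun x => (2 * μ + ρ x ^ β) * dv u V x ^ 2 * x.1) t := by
    intro t ht
    rw [Sol.Dd, ← I_mul]
    have key : ∀ L : ℝ × ℝ → ℝ, ContinuousOn L (Kc R) → ContinuousOn (fun x => (2 * μ + L x) * dv u V x ^ 2 * x.1) (Kc R) := by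
      intros; fun_prop
    refine I_mono hR (by fun_prop) (key _ c4) ht fun r hr => ?_
    have := Real.rpow_nonneg (S.pos (r,t) ⟨hr, ht⟩).le β
    have h0 := hr.1
    have : 0 ≤ ρ (r,t) ^ β * dv u V (r,t) ^ 2 * r := by positivity
    simp only; linarith
  have ce : ContinuousOn e (Ici 0) := I_cont hR sE.cont
  have e0 : ∀ t, 0 ≤ t → 0 ≤ e t := fun t ht => I_nonneg hR fun r hr => by
    have := (S.pos (r,t) ⟨hr, ht⟩).le
    have h0 := hr.1
    simp only [Sol.enW]; positivity
  have hM2 : I R (fun x => u x ^ 2 * x.1) 0 ≤ M₂ := by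
    refine le_trans (I_mono hR (by fun_prop) (by fun_prop) le_rfl fun r hr => ?_) h2
    have h0 := hr.1
    have : 0 ≤ (dr u (r,0) ^ 2 + V (r,0) ^ 2) * r := by positivity
    simp only; linarith
  have hD0 : Sol.Dd R u V 0 ≤ M₂ := by
    rw [S.D_eq le_rfl]
    refine le_trans (I_mono hR (by fun_prop) (by fun_prop) le_rfl fun r hr => ?_) h2
    have h0 := hr.1
    have : 0 ≤ u (r,0) ^ 2 * r := by positivity
    simp only; linarith
  have ee : e 0 ≤ E0 := by
    have : e 0 ≤ I R (fun x => (1/2 * M₁) * (u x ^ 2 * x.1) + ((γ - 1)⁻¹ * M₁ ^ γ) * x.1) 0 := by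
      refine I_mono hR sE.cont (by fun_prop) le_rfl fun r hr => ?_
      have hp := (S.pos (r,0) ⟨hr, self_mem_Ici⟩).le
      have hq := h1 r hr
      have h0 := hr.1
      have hg : ρ (r,0) ^ γ ≤ M₁ ^ γ := Real.rpow_le_rpow hp hq (by linarith)
      have a1 : ρ (r,0) * (u (r,0) ^ 2 * r) ≤ M₁ * (u (r,0) ^ 2 * r) := by gcongr
      have a2 : ρ (r,0) ^ γ * ((γ - 1)⁻¹ * r) ≤ M₁ ^ γ * ((γ - 1)⁻¹ * r) := by gcongr
      simp only [Sol.enW]; linarith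
    rw [I_add hR (by fun_prop) (by fun_prop) le_rfl, I_mul, I_mul, I_id] at this
    have : 1/2 * M₁ * I R (fun x => u x ^ 2 * x.1) 0 ≤ 1/2 * M₁ * M₂ := by gcongr
    linarith
  have et : ∀ t, 0 ≤ t → e t ≤ E0 := fun t ht => by
    refine le_trans (le_of_deriv_nonpos ht (ce.mono fun s hs => hs.1) fun s hs => ⟨_, de s hs.1, ?_⟩) ee
    have := kD s hs.1.le
    have := S.D_nonneg (t := s)
    nlinarith
  have hE0 : 0 ≤ E0 := (e0 0 le_rfl).trans ee
  rw [abs_of_nonneg hE0]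
  have b1 : (0:ℝ) < (2*μ)⁻¹ := by positivity
  have b2 := mul_nonneg hE0 b1.le
  have b3 := mul_nonneg hE0 hγ.le
  have b4 := abs_nonneg M₂
  have b5 : 0 ≤ E0 * |(2*μ)⁻¹| := by positivity
  have b6 : 0 ≤ E0 * |γ - 1| := by positivity
  have b7 : 0 ≤ E0 * |1 + (2 * μ)⁻¹ + 2 + (γ - 1)| := by positivity
  refine ⟨⟨fun t => -(2*μ)⁻¹ * e t, ?_, ?_, ?_⟩, ?_, ?_, ?_⟩
  · exact continuousOn_const.mul ce
  · intro t ht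
    have : |-(2*μ)⁻¹ * e t| = (2*μ)⁻¹ * e t := by
      rw [abs_mul, abs_neg, abs_of_pos b1, abs_of_nonneg (e0 t ht)]
    rw [this]
    have : (2*μ)⁻¹ * e t ≤ (2*μ)⁻¹ * E0 := by gcongr; exact et t ht
    linarith
  · intro t ht
    refine ⟨_, (de t ht).const_mul _, ?_⟩
    have := kD t ht.le
    have h3 : (2*μ)⁻¹ * (2 * μ * Sol.Dd R u V t) ≤ (2*μ)⁻¹ * I R (fun x => (2 * μ + ρ x ^ β) * dv u V x ^ 2 * x.1) t := by gcongr
    rw [← mul_assoc, inv_mul_cancel₀ (by positivity), one_mul] at h3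
    linarith
  · intro t ht
    have : I R (fun x => 1/2 * (ρ x * u x ^ 2 * x.1)) t ≤ e t := by
      refine I_mono hR (by fun_prop) sE.cont ht fun r hr => ?_
      have h0 := hr.1
      have hp := (S.pos (r,t) ⟨hr, ht⟩).le
      have : 0 ≤ (γ - 1)⁻¹ * ρ (r,t) ^ γ * r := by positivity
      simp only [Sol.enW]; linarith
    rw [I_mul] at this
    have := et t ht
    linarith
  · intro t ht
    have : I R (fun x => (γ - 1)⁻¹ * (ρ x ^ γ * x.1)) t ≤ e t := by
      have key : ∀ L : ℝ × ℝ → ℝ, ContinuousOn L (Kc R) → ContinuousOn (fun x => (γ - 1)⁻¹ * (L x * x.1)) (Kc R) := by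
        intros; fun_prop
      refine I_mono hR (key _ c5) sE.cont ht fun r hr => ?_
      have h0 := hr.1
      have hp := (S.pos (r,t) ⟨hr, ht⟩).le
      have : 0 ≤ 1/2 * ρ (r,t) * u (r,t) ^ 2 * r := by positivity
      simp only [Sol.enW]; linarith
    rw [I_mul] at this
    have h3 := this.trans (et t ht)
    have : I R (fun x => ρ x ^ γ * x.1) t ≤ E0 * (γ - 1) := by
      rw [inv_mul_le_iff₀ hγ] at h3; linarith
    linarith
  · have := le_abs_self M₂
    linarith
end NS
end

section
open scoped ContDiff Topology
namespace NS

theorem exp_dom (b : ℝ) : ∃ C, 0 < C ∧ ∀ y, 1 ≤ y → y ^ b * Real.exp (-y) ≤ C := by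
  obtain ⟨n, hn⟩ := exists_nat_ge b
  refine ⟨n.factorial, by positivity, fun y hy => ?_⟩
  have h1 : y ^ b ≤ y ^ n := by
    rw [← Real.rpow_natCast]; exact Real.rpow_le_rpow_of_exponent_le hy hn
  have h2 := Real.pow_div_factorial_le_exp y (by linarith) n
  rw [div_le_iff₀ (by positivity)] at h2
  calc y ^ b * Real.exp (-y) ≤ (Real.exp y * n.factorial) * Real.exp (-y) := by gcongr; exact h1.trans h2
    _ = n.factorial * (Real.exp y * Real.exp (-y)) := by ring
    _ = n.factorial := by rw [← Real.exp_add]; simp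

/-- logarithmic weight -/
def ell (R ε δ r : ℝ) : ℝ := 1 + ε * (Real.log (R + δ) - Real.log (r + δ))

section
variable {R ε δ : ℝ} 
theorem one_le_ell (hε : 0 ≤ ε) (hδ : 0 < δ) {r : ℝ} (hr : r ∈ Icc 0 R) : 1 ≤ ell R ε δ r := by
  have := Real.log_le_log (by linarith [hr.1] : 0 < r + δ) (by linarith [hr.2] : r + δ ≤ R + δ)
  have : 0 ≤ ε * (Real.log (R + δ) - Real.log (r + δ)) := mul_nonneg hε (by linarith)
  unfold ell; linarith
theorem ell_deriv (hδ : 0 < δ) {r : ℝ} (hr : 0 ≤ r) : HasDerivAt (ell R ε δ) (- ε / (r + δ)) r := by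
  have h : HasDerivAt (fun s => Real.log (s + δ)) (1 / (r + δ)) r :=
    ((hasDerivAt_id' r).add_const δ).log (by positivity)
  have := ((h.const_sub (Real.log (R + δ))).const_mul ε).const_add 1
  refine this.congr_deriv ?_
  ring
theorem ell_sm (hδ : 0 < δ) : Sm R (fun x => ell R ε δ x.1) := by
  have : Sm R (fun x => Real.log (x.1 + δ)) := (Sm.fst.add (Sm.const δ)).log fun x hx => by
    have := hx.1.1; positivity
  exact (Sm.const 1).add ((Sm.const ε).mul ((Sm.const _).sub this))
end

theorem weight_pt (a β R : ℝ) (ha : 0 < a) (hβ : 0 < β) (hR : 0 < R) : ∃ C, 0 < C ∧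
    ∀ M q δ r, 1 ≤ M → 0 ≤ q → q ≤ M → 0 < δ → δ ≤ 1 → r ∈ Icc 0 R →
      q ^ a * r * ell R (M ^ (-β/2)) δ r ^ 2 ≤ 4 * (q ^ a * r) + C := by
  obtain ⟨C, hC, hC2⟩ := exp_dom (2 * a / β + 2)
  refine ⟨4 * (R + 1) * C, by positivity, fun M q δ r hM hq hqM hδ hδ1 hr => ?_⟩
  set ε := M ^ (-β/2) with hε
  have hM0 : 0 < M := by linarith
  have ε0 : 0 < ε := by positivity
  have ε1 : ε ≤ 1 := Real.rpow_le_one_of_one_le_of_nonpos hM (by linarith)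
  have hl := one_le_ell ε0.le hδ hr
  have hr0 := hr.1
  have hqa : 0 ≤ q ^ a := Real.rpow_nonneg hq a
  set y := Real.log (R + δ) - Real.log (r + δ) with hy
  have hell : ell R ε δ r = 1 + ε * y := rfl
  by_cases hc : ε * y ≤ 1
  · have : ell R ε δ r ^ 2 ≤ 4 := by nlinarith
    have : q ^ a * r * ell R ε δ r ^ 2 ≤ q ^ a * r * 4 := by gcongr
    have : 0 ≤ 4 * (R + 1) * C := by positivity
    linarith
  · push Not at hc
    have hy0 : 0 < y := by
      by_contra h; push Not at h; nlinarith
    have hy1 : M ^ (β/2) ≤ y := by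
      have e : M ^ (β/2) * ε = 1 := by rw [hε, ← Real.rpow_add hM0]; ring_nf; simp
      have : M ^ (β/2) * 1 ≤ M ^ (β/2) * (ε * y) := by gcongr
      rw [← mul_assoc, e] at this; linarith
    have hy2 : 1 ≤ y := (Real.one_le_rpow hM (by positivity)).trans hy1
    have h1 : q ^ a ≤ y ^ (2 * a / β) := by
      calc q ^ a ≤ M ^ a := Real.rpow_le_rpow hq hqM ha.le
        _ = (M ^ (β/2)) ^ (2 * a / β) := by rw [← Real.rpow_mul hM0.le]; congr 1; field_simp
        _ ≤ _ := Real.rpow_le_rpow (by positivity) hy1 (by positivity)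
    have h2 : r ≤ (R + 1) * Real.exp (-y) := by
      have : Real.exp (-y) = (r + δ) / (R + δ) := by
        rw [hy, neg_sub, Real.exp_sub, Real.exp_log (by linarith), Real.exp_log (by linarith)]
      rw [this]
      have h3 : R + δ ≤ R + 1 := by linarith
      rw [mul_div_assoc', le_div_iff₀ (by linarith)]
      nlinarith
    have h3 : ell R ε δ r ^ 2 ≤ 4 * y ^ 2 := by
      rw [hell]
      have : 1 + ε * y ≤ 2 * y := by nlinarith
      nlinarith
    calc q ^ a * r * ell R ε δ r ^ 2 ≤ y ^ (2 * a / β) * ((R + 1) * Real.exp (-y)) * (4 * y ^ 2) := by gcongr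
      _ = 4 * (R + 1) * (y ^ (2 * a / β + 2) * Real.exp (-y)) := by
        rw [Real.rpow_add hy0, Real.rpow_two]; ring
      _ ≤ 4 * (R + 1) * C := by gcongr; exact hC2 y hy2
      _ ≤ _ := by have : 0 ≤ q ^ a * r := by positivity
                  linarith
end NS
end

section
open scoped ContDiff Topology
namespace NS

theorem kcm {R : ℝ} {f : ℝ × ℝ → ℝ} (c : ℝ) (h : ContinuousOn f (Kc R)) : ContinuousOn (fun x => c * f x) (Kc R) := by fun_prop
theorem kad {R : ℝ} {f g : ℝ × ℝ → ℝ} (h : ContinuousOn f (Kc R)) (h' : ContinuousOn g (Kc R)) :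
    ContinuousOn (fun x => f x + g x) (Kc R) := by fun_prop
theorem ksb {R : ℝ} {f g : ℝ × ℝ → ℝ} (h : ContinuousOn f (Kc R)) (h' : ContinuousOn g (Kc R)) :
    ContinuousOn (fun x => f x - g x) (Kc R) := by fun_prop
theorem kml {R : ℝ} {f g : ℝ × ℝ → ℝ} (h : ContinuousOn f (Kc R)) (h' : ContinuousOn g (Kc R)) :
    ContinuousOn (fun x => f x * g x) (Kc R) := by fun_prop
theorem kct {R : ℝ} (c : ℝ) : ContinuousOn (fun _ => c) (Kc R) := by fun_prop
theorem kfs {R : ℝ} : ContinuousOn (fun x => x.1) (Kc R) := by fun_prop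

theorem alg_z {q L P N e l V d u D μ c : ℝ} (hq : 0 ≤ q) (hP : 0 ≤ P) (hN : 0 < N) (hc : 0 ≤ c) (hL : 0 ≤ 2 * μ + L)
    (h1 : q * e ^ 2 ≤ 1) (h2 : (2 * μ + L) * e ^ 2 ≤ 2 * μ + 1) (h3 : P * e ^ 2 ≤ N ^ 2) (hu : u ^ 2 ≤ D) :
    -(q * u ^ 2 * V * e * l) - (2 * μ + L) * d ^ 2 * l ^ 2 + 2 * (2 * μ + L) * d * V * e * l - 2 * c * P * V * e * l
      ≤ D * (1/2 * q * u ^ 2 * l ^ 2) + (1/2 + (2 * μ + 1) + c * N) * V ^ 2 + c * N * (P * l ^ 2) := by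
  have a1 : -(q * u ^ 2 * V * e * l) ≤ 1/2 * (q * u^2 * l^2) * D + 1/2 * V ^ 2 := by
    have b1 : (q * u ^ 2 * e * l) ^ 2 ≤ q * u^2 * l^2 * D := by
      calc (q * u ^ 2 * e * l) ^ 2 = (q * e ^ 2) * (q * u^2 * l^2) * u ^ 2 := by ring
        _ ≤ 1 * (q * u^2 * l^2) * D := by gcongr
        _ = _ := by ring
    nlinarith [sq_nonneg (q * u ^ 2 * e * l + V)]
  have a2 : - (2 * μ + L) * d ^ 2 * l ^ 2 + 2 * (2 * μ + L) * d * V * e * l ≤ (2 * μ + 1) * V ^ 2 := by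
    have : 0 ≤ (2 * μ + L) * (d * l - V * e) ^ 2 := by positivity
    have : ((2 * μ + L) * e ^ 2) * V ^ 2 ≤ (2 * μ + 1) * V ^ 2 := by gcongr
    linarith
  have a3 : -(2 * P * V * e * l) ≤ N * V ^ 2 + N * (P * l ^ 2) := by
    have b1 : P * e ^ 2 * V ^ 2 ≤ N ^ 2 * V ^ 2 := by gcongr
    have b2 : 0 ≤ P * (N * l + e * V) ^ 2 := by positivity
    have : N * (-(2 * P * V * e * l)) ≤ N * (N * V ^ 2 + N * (P * l ^ 2)) := by linarith
    exact le_of_mul_le_mul_left this hN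
  have a4 : c * (-(2 * P * V * e * l)) ≤ c * (N * V ^ 2 + N * (P * l ^ 2)) := by gcongr
  linarith

set_option maxHeartbeats 1600000 in
theorem zbound (μ β γ R M₁ M₂ : ℝ) (hγ : 1 < γ) (hβ : 1 < β) (hβγ : β ≤ γ) (hR : 0 < R) (hμ : 0 < μ) :
    ∃ C, 0 < C ∧ ∀ ρ u V, Data μ β γ R M₁ M₂ ρ u V → ∀ T M δ, 1 ≤ M →
      (∀ r ∈ Icc 0 R, ∀ t ∈ Icc 0 T, ρ (r, t) ≤ M) → 0 < δ → δ ≤ 1 → ∀ t ∈ Icc 0 T,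
      I R (fun x => ρ x * u x ^ 2 * x.1 * ell R (M ^ (-β/2)) δ x.1 ^ 2) t ≤ C * M ^ ((γ - β)/2) := by
  obtain ⟨E, hE, hEn⟩ := energy μ β γ R M₁ M₂
  obtain ⟨A1, hA1, hw1⟩ := weight_pt 1 β R one_pos (by linarith) hR
  obtain ⟨A2, hA2, hw2⟩ := weight_pt γ β R (by linarith) (by linarith) hR
  set K2 := 4 * E + R * A2 with hK2
  set K1 := 4 * (R ^ 2 / 2 + E) + R * A1 with hK1
  have hK2p : 0 < K2 := by positivity
  have hK1p : 0 < K1 := by positivity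
  set c := 1 + (γ - 1)⁻¹ with hc
  have hγ' : 0 < γ - 1 := by linarith
  have hcp : 0 < c := by positivity
  set C1 := (1/2 + (2 * μ + 1) + c) + c * K2 with hC1
  have hC1p : 0 < C1 := by positivity
  set Z0 := 1/2 * (2 * E) * K1 + (γ - 1)⁻¹ * K2 with hZ0
  have hZ0p : 0 < Z0 := by positivity
  refine ⟨2 * (Real.exp E * (Real.exp E * Z0 + C1 * Real.exp E * (1 + 2 * E))), by positivity, ?_⟩
  intro ρ u V hD T M δ hM hρM hδ hδ1 t ht
  obtain ⟨⟨H, hHc, hHb, hHd⟩, hE1, hE2, hD0⟩ := hEn ρ u V hD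
  have S := hD.1
  have hM0 : 0 < M := by linarith
  set ε := M ^ (-β/2) with hε
  set N := M ^ ((γ - β)/2) with hN
  have hN1 : 1 ≤ N := Real.one_le_rpow hM (by linarith)
  have ε0 : 0 < ε := by positivity
  set l := ell R ε δ with hl
  have c1 := S.sρ.cont
  have c2 := S.su.cont
  have c3 := S.sd.cont
  have c4 := (S.sp β).cont
  have c5 := (S.sp γ).cont
  have c6 := S.sV.cont
  have sl : Sm R (fun x => l x.1) := ell_sm hδ
  have sw : Sm R (fun x => (fun r => l r ^ 2) x.1) := sl.pow 2
  have cl := sl.cont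
  have l1 : ∀ r ∈ Icc 0 R, 1 ≤ l r := fun r hr => one_le_ell ε0.le hδ hr
  set z := I R (Sol.enW γ ρ u (fun r => l r ^ 2)) with hz
  have sz := S.s_enW (w := fun r => l r ^ 2) sw
  have cz : ContinuousOn z (Ici 0) := I_cont hR sz.cont
  -- weighted integrals of powers
  have key : ∀ P W : ℝ × ℝ → ℝ, ContinuousOn P (Kc R) → ContinuousOn W (Kc R) → ContinuousOn (fun x => P x * x.1 * W x ^ 2) (Kc R) := by
    intros; fun_prop
  have key4 : ∀ (P : ℝ × ℝ → ℝ) (A : ℝ), ContinuousOn P (Kc R) → ContinuousOn (fun x => 4 * (P x * x.1) + A) (Kc R) := by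
    intros; fun_prop
  have key5 : ∀ (P : ℝ × ℝ → ℝ), ContinuousOn P (Kc R) → ContinuousOn (fun x => (P x * x.1)) (Kc R) := by
    intros; fun_prop
  have IP : ∀ s ∈ Icc 0 T, I R (fun x => ρ x ^ γ * x.1 * l x.1 ^ 2) s ≤ K2 := by
    intro s hs
    calc _ ≤ I R (fun x => 4 * (ρ x ^ γ * x.1) + A2) s := by
          refine I_mono hR (key _ _ c5 cl) (key4 _ _ c5) hs.1 fun r hr => ?_
          exact hw2 M _ δ r hM (S.pos (r,s) ⟨hr, hs.1⟩).le (hρM r hr s hs) hδ hδ1 hr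
      _ = 4 * I R (fun x => ρ x ^ γ * x.1) s + R * A2 := by
          have k0 := key5 _ c5
          rw [I_add hR (kcm _ k0) (kct _) hs.1, I_mul, I_const]
      _ ≤ _ := by have := hE2 s hs.1; linarith
  have IR : ∀ s ∈ Icc 0 T, I R (fun x => ρ x * x.1 * l x.1 ^ 2) s ≤ K1 := by
    intro s hs
    have k0 := key5 _ c5
    have h1 : I R (fun x => ρ x * x.1) s ≤ R ^ 2 / 2 + E := by
      calc _ ≤ I R (fun x => x.1 + ρ x ^ γ * x.1) s := by
            refine I_mono hR (by fun_prop) (kad kfs k0) hs.1 fun r hr => ?_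
            have hp := S.pos (r,s) ⟨hr, hs.1⟩
            have : ρ (r,s) ≤ 1 + ρ (r,s) ^ γ := by
              rcases le_total (ρ (r,s)) 1 with h | h
              · have := Real.rpow_nonneg hp.le γ; linarith
              · have := Real.self_le_rpow_of_one_le h hγ.le; linarith
            have := mul_le_mul_of_nonneg_right this hr.1
            simp only; linarith
        _ = R ^ 2 / 2 + I R (fun x => ρ x ^ γ * x.1) s := by
            rw [I_add hR kfs k0 hs.1, I_id]
        _ ≤ _ := by have := hE2 s hs.1; linarith
    calc _ ≤ I R (fun x => 4 * (ρ x * x.1) + A1) s := by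
          refine I_mono hR (key _ _ c1 cl) (key4 _ _ c1) hs.1 fun r hr => ?_
          have := hw1 M _ δ r hM (S.pos (r,s) ⟨hr, hs.1⟩).le (hρM r hr s hs) hδ hδ1 hr
          simpa using this
      _ = 4 * I R (fun x => ρ x * x.1) s + R * A1 := by
          have k0 := key5 _ c1
          rw [I_add hR (kcm _ k0) (kct _) hs.1, I_mul, I_const]
      _ ≤ _ := by linarith
  have zsplit : ∀ s, 0 ≤ s → z s = 1/2 * I R (fun x => ρ x * u x ^ 2 * x.1 * l x.1 ^ 2) s + (γ - 1)⁻¹ * I R (fun x => ρ x ^ γ * x.1 * l x.1 ^ 2) s := by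
    intro s hs
    rw [← I_mul, ← I_mul, ← I_add hR (kcm _ (key (fun x => ρ x * u x ^ 2) _ (by fun_prop) cl)) (kcm _ (key _ _ c5 cl)) hs]
    refine I_congr hR fun r hr => ?_
    simp only [Sol.enW]; ring
  have zpos : ∀ s, 0 ≤ s → 0 ≤ z s := fun s hs => I_nonneg hR fun r hr => by
    have := (S.pos (r,s) ⟨hr, hs⟩).le
    have h0 := hr.1
    simp only [Sol.enW]; positivity
  have zle : ∀ s, 0 ≤ s → I R (fun x => ρ x * u x ^ 2 * x.1 * l x.1 ^ 2) s ≤ 2 * z s := fun s hs => by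
    have : 0 ≤ I R (fun x => ρ x ^ γ * x.1 * l x.1 ^ 2) s := I_nonneg hR fun r hr => by
      have := (S.pos (r,s) ⟨hr, hs⟩).le
      have h0 := hr.1
      simp only; positivity
    rw [zsplit s hs]
    have : 0 ≤ (γ - 1)⁻¹ * I R (fun x => ρ x ^ γ * x.1 * l x.1 ^ 2) s := by positivity
    linarith
  have zinit : ∀ s ∈ Icc 0 T, Sol.Dd R u V s ≤ 2 * E → z s ≤ Z0 := by
    intro s hs hDs
    have : I R (fun x => ρ x * u x ^ 2 * x.1 * l x.1 ^ 2) s ≤ 2 * E * K1 := by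
      calc _ ≤ I R (fun x => (2 * E) * (ρ x * x.1 * l x.1 ^ 2)) s := by
            refine I_mono hR (key (fun x => ρ x * u x ^ 2) _ (by fun_prop) cl) (kcm _ (key _ _ c1 cl)) hs.1 fun r hr => ?_
            have := (S.pos (r,s) ⟨hr, hs.1⟩).le
            have h0 := hr.1
            have hu := (S.u_le hs.1 hr).trans hDs
            calc ρ (r,s) * u (r,s) ^ 2 * r * l r ^ 2 = u (r,s) ^ 2 * (ρ (r,s) * r * l r ^ 2) := by ring
              _ ≤ 2 * E * (ρ (r,s) * r * l r ^ 2) := by gcongr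
        _ = 2 * E * I R (fun x => ρ x * x.1 * l x.1 ^ 2) s := I_mul _ _ _
        _ ≤ _ := by gcongr; exact IR s hs
    rw [zsplit s hs.1]
    have h2 : (γ - 1)⁻¹ * I R (fun x => ρ x ^ γ * x.1 * l x.1 ^ 2) s ≤ (γ - 1)⁻¹ * K2 := by gcongr; exact IP s hs
    linarith
  -- differential inequality
  have zder : ∀ s ∈ Icc 0 T, 0 < s → ∃ z', HasDerivAt z z' s ∧ z' ≤ Sol.Dd R u V s * z s + C1 * N * (1 + Sol.Dd R u V s) := by
    intro s hs hs0
    have hdl : ∀ r ∈ Icc 0 R, HasDerivAt (fun r => l r ^ 2) (-(2 * ε * l r * (r + δ)⁻¹)) r := fun r hr => by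
      refine ((ell_deriv hδ hr.1).fun_pow 2).congr_deriv ?_
      push_cast; ring
    have cw' : ContinuousOn (fun r => -(2 * ε * l r * (r + δ)⁻¹)) (Icc 0 R) := by
      have : ContinuousOn l (Icc 0 R) := fun r hr => (ell_deriv hδ hr.1).continuousAt.continuousWithinAt
      have h2 : ContinuousOn (fun r : ℝ => (r + δ)⁻¹) (Icc 0 R) := by
        refine ContinuousOn.inv₀ (by fun_prop) fun r hr => ?_
        have := hr.1; positivity
      exact ((continuousOn_const.mul this).mul h2).neg
    have hde := S.energyW sw hdl cw' hs0
    refine ⟨_, hde, ?_⟩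
    set D := Sol.Dd R u V s with hDdef
    have hD0 : 0 ≤ D := S.D_nonneg
    have cw'2 : ContinuousOn (fun x : ℝ × ℝ => -(2 * ε * l x.1 * (x.1 + δ)⁻¹)) (Kc R) :=
      cw'.comp continuousOn_fst (fun x hx => hx.1)
    have keyc : ∀ W W' L P : ℝ × ℝ → ℝ, ContinuousOn W (Kc R) → ContinuousOn W' (Kc R) → ContinuousOn L (Kc R) →
      ContinuousOn P (Kc R) → ContinuousOn (fun x => 1/2 * ρ x * u x ^ 3 * x.1 * W' x
      - (2 * μ + L x) * dv u V x ^ 2 * x.1 * W x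
      - (2 * μ + L x) * dv u V x * u x * x.1 * W' x
      + (1 + (γ - 1)⁻¹) * P x * u x * x.1 * W' x) (Kc R) := by intros; fun_prop
    have k1 := key (fun x => ρ x * u x ^ 2) _ (by fun_prop) cl
    have k2 : ContinuousOn (fun x => V x ^ 2 * x.1) (Kc R) := by fun_prop
    have k3 := key _ _ c5 cl
    calc _ ≤ I R (fun x => D * (1/2) * (ρ x * u x ^ 2 * x.1 * l x.1 ^ 2) + (1/2 + (2 * μ + 1) + c * N) * (V x ^ 2 * x.1) + c * N * (ρ x ^ γ * x.1 * l x.1 ^ 2)) s := by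
          refine I_mono hR (keyc _ _ _ _ sw.cont cw'2 c4 c5) (kad (kad (kcm _ k1) (kcm _ k2)) (kcm _ k3)) hs.1 fun r hr => ?_
          have hp := S.pos (r,s) ⟨hr, hs.1⟩
          have hpM := hρM r hr s hs
          have hu := S.u_le hs.1 hr
          have huV := S.uV (r,s) ⟨hr, hs.1⟩
          have hr0 := hr.1
          simp only at huV
          set e := ε * (r * (r + δ)⁻¹) with he
          have he0 : 0 ≤ e := by positivity
          have heε : e ≤ ε := by
            have : r * (r + δ)⁻¹ ≤ 1 := by
              rw [mul_inv_le_iff₀ (by positivity)]; linarith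
            calc e ≤ ε * 1 := by rw [he]; gcongr
              _ = ε := mul_one _
          have he2 : e ^ 2 ≤ M ^ (-β) := by
            calc e ^ 2 ≤ ε ^ 2 := by gcongr
              _ = _ := by rw [hε, ← Real.rpow_natCast, ← Real.rpow_mul hM0.le]; congr 1; push_cast; ring
          have hMβ : M ^ β * M ^ (-β) = 1 := by rw [← Real.rpow_add hM0]; simp
          have hb1 : ρ (r,s) * e ^ 2 ≤ 1 := by
            calc _ ≤ M ^ β * M ^ (-β) := by
                  gcongr
                  exact hpM.trans (Real.self_le_rpow_of_one_le hM hβ.le)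
              _ = 1 := hMβ
          have hb2 : (2 * μ + ρ (r,s) ^ β) * e ^ 2 ≤ 2 * μ + 1 := by
            have h1 : ρ (r,s) ^ β * e ^ 2 ≤ M ^ β * M ^ (-β) := by gcongr
            have h2 : e ^ 2 ≤ 1 := he2.trans (Real.rpow_le_one_of_one_le_of_nonpos hM (by linarith))
            nlinarith
          have hb3 : ρ (r,s) ^ γ * e ^ 2 ≤ N ^ 2 := by
            calc _ ≤ M ^ γ * M ^ (-β) := by gcongr
              _ = N ^ 2 := by rw [hN, ← Real.rpow_natCast, ← Real.rpow_mul hM0.le, ← Real.rpow_add hM0]; congr 1; push_cast; ring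
          have hPn := Real.rpow_nonneg hp.le γ
          have hLn := Real.rpow_nonneg hp.le β
          have := alg_z (l := l r) (V := V (r,s)) (d := dv u V (r,s)) (μ := μ) (c := c) hp.le hPn (by linarith : 0 < N) hcp.le (by positivity : 0 ≤ 2 * μ + ρ (r,s) ^ β) hb1 hb2 hb3 hu
          have := mul_le_mul_of_nonneg_left this hr0
          refine le_trans (le_of_eq ?_) (this.trans (le_of_eq ?_))
          · simp only [he, huV, ← hc]; ring
          · ring
      _ = D * (1/2) * I R (fun x => ρ x * u x ^ 2 * x.1 * l x.1 ^ 2) s + (1/2 + (2 * μ + 1) + c * N) * I R (fun x => V x ^ 2 * x.1) s + c * N * I R (fun x => ρ x ^ γ * x.1 * l x.1 ^ 2) s := by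
          rw [I_add hR (kad (kcm _ k1) (kcm _ k2)) (kcm _ k3) hs.1,
            I_add hR (kcm _ k1) (kcm _ k2) hs.1, I_mul, I_mul, I_mul]
      _ ≤ D * (1/2) * (2 * z s) + (1/2 + (2 * μ + 1) + c * N) * D + c * N * K2 := by
          have h1 := zle s hs.1
          have h2 := S.V_le hs.1
          have h3 := IP s hs
          gcongr
      _ ≤ _ := by
          rw [hC1]
          have : (1/2 + (2 * μ + 1)) * D ≤ (1/2 + (2 * μ + 1)) * D * N := le_mul_of_one_le_right (by positivity) hN1
          have t1 : 0 ≤ (1/2 + (2 * μ + 1) + c) * N := by positivity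
          have t2 : 0 ≤ c * K2 * N * D := by positivity
          linarith
  -- Gronwall
  have gron : ∀ t0, 0 ≤ t0 → t0 ≤ t → t ≤ t0 + 1 → z t0 ≤ Z0 → z t ≤ Real.exp E * (Real.exp E * Z0 + C1 * Real.exp E * (1 + 2 * E)) * N := by
    intro t0 h0 h1 h2 h3
    have hH := fun s hs => (abs_le.1 (hHb s hs))
    have := le_of_deriv_nonpos (f := fun s => z s * Real.exp (- H s) - C1 * N * Real.exp E * (s + H s)) h1
      (by
        have a1 := cz.mono (fun s (hs : s ∈ Icc t0 t) => (h0.trans hs.1 : 0 ≤ s))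
        have a2 := hHc.mono (fun s (hs : s ∈ Icc t0 t) => (h0.trans hs.1 : 0 ≤ s))
        fun_prop)
      (fun s hs => by
        have hs0 : 0 < s := h0.trans_lt hs.1
        obtain ⟨z', hz1, hz2⟩ := zder s ⟨hs0.le, hs.2.le.trans ht.2⟩ hs0
        obtain ⟨h', hh1, hh2⟩ := hHd s hs0
        refine ⟨_, (hz1.fun_mul hh1.fun_neg.exp).fun_sub (((hasDerivAt_id' s).fun_add hh1).const_mul _), ?_⟩
        have hDs : 0 ≤ Sol.Dd R u V s := S.D_nonneg
        have hx : Real.exp (- H s) ≤ Real.exp E := Real.exp_le_exp.2 (by linarith [(hH s hs0.le).1])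
        have hx0 := Real.exp_pos (- H s)
        have hzs := zpos s hs0.le
        have q1 : z' - h' * z s ≤ C1 * N * (1 + Sol.Dd R u V s) := by nlinarith
        have q2 : (z' - h' * z s) * Real.exp (- H s) ≤ C1 * N * (1 + Sol.Dd R u V s) * Real.exp (- H s) := by gcongr
        have h1' : 0 ≤ 1 + h' := by linarith
        have q3 : C1 * N * (1 + Sol.Dd R u V s) * Real.exp (- H s) ≤ C1 * N * (1 + h') * Real.exp E := by gcongr
        linarith)
    have hz0 := zpos t0 h0
    have q1 : z t0 * Real.exp (- H t0) ≤ Z0 * Real.exp E := by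
      gcongr; linarith [(hH t0 h0).1]
    have q2 : C1 * N * Real.exp E * (t + H t) - C1 * N * Real.exp E * (t0 + H t0) ≤ C1 * N * Real.exp E * (1 + 2 * E) := by
      have : (t + H t) - (t0 + H t0) ≤ 1 + 2 * E := by linarith [(hH t0 h0).1, (hH t ht.1).2]
      rw [← mul_sub]; gcongr
    have q3 : z t * Real.exp (- H t) ≤ (Real.exp E * Z0 + C1 * Real.exp E * (1 + 2 * E)) * N := by
      have : Z0 * Real.exp E ≤ Z0 * Real.exp E * N := le_mul_of_one_le_right (by positivity) hN1
      linarith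
    calc z t = Real.exp (H t) * (z t * Real.exp (- H t)) := by
          rw [mul_left_comm, ← Real.exp_add]; simp
      _ ≤ Real.exp E * ((Real.exp E * Z0 + C1 * Real.exp E * (1 + 2 * E)) * N) := by
          have := zpos t ht.1
          gcongr; exact (hH t ht.1).2
      _ = _ := by ring
  have fin : z t ≤ Real.exp E * (Real.exp E * Z0 + C1 * Real.exp E * (1 + 2 * E)) * N := by
    rcases le_total t 1 with h | h
    · exact gron 0 le_rfl ht.1 (by linarith) (zinit 0 ⟨le_rfl, ht.1.trans ht.2⟩ (by linarith))
    · obtain ⟨t0, ht0, hd⟩ := exists_deriv_eq_diff (f := H) (a := t - 1)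
        (hHc.mono fun s hs => (by linarith [hs.1] : (0:ℝ) ≤ s))
        (fun s hs => (hHd s (by linarith [hs.1])).imp fun _ h => h.1)
      have p0 : 0 < t0 := by linarith [ht0.1]
      rw [sub_add_cancel] at ht0 hd
      refine gron t0 p0.le ht0.2.le (by linarith [ht0.1]) (zinit t0 ⟨p0.le, ht0.2.le.trans ht.2⟩ ?_)
      obtain ⟨h', hh1, hh2⟩ := hHd t0 p0
      rw [hh1.unique hd] at hh2
      have a1 := abs_le.1 (hHb t ht.1)
      have a2 := abs_le.1 (hHb (t-1) (by linarith))
      linarith [a1.2, a2.1]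
  have := zle t ht.1
  linarith
end NS
end

section
open scoped ContDiff Topology
namespace NS

set_option maxHeartbeats 800000 in
theorem xibound (μ β γ R M₁ M₂ : ℝ) (hγ : 1 < γ) (hβ : 1 < β) (hβγ : β ≤ γ) (hR : 0 < R) (hμ : 0 < μ) :
    ∃ C, 0 < C ∧ ∀ ρ u V, Data μ β γ R M₁ M₂ ρ u V → ∀ T M, 1 ≤ M →
      (∀ r ∈ Icc 0 R, ∀ t ∈ Icc 0 T, ρ (r, t) ≤ M) → ∀ t ∈ Icc 0 T,
      I R (fun x => |ρ x * u x|) t ≤ C * M ^ (1/2 + γ/4) := by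
  obtain ⟨C, hC, hz⟩ := zbound μ β γ R M₁ M₂ hγ hβ hβγ hR hμ
  refine ⟨C + 2, by positivity, fun ρ u V hD T M hM hρM t ht => ?_⟩
  have S := hD.1
  have c1 := S.sρ.cont
  have c2 := S.su.cont
  have c6 := S.sV.cont
  obtain ⟨B, hB⟩ := exists_bound (f := fun x => ρ x * V x) (by fun_prop) t
  have hM0 : 0 < M := by linarith
  set δ := (1 + |B| * R)⁻¹ with hδd
  have hδ : 0 < δ := by positivity
  have hδ1 : δ ≤ 1 := inv_le_one_of_one_le₀ (by have : 0 ≤ |B| * R := by positivity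
                                                linarith)
  have hδB : δ * (|B| * R) ≤ 1 := by
    rw [hδd, inv_mul_le_iff₀ (by positivity)]; linarith
  have hz := hz ρ u V hD T M δ hM hρM hδ hδ1 t ht
  set ε := M ^ (-β/2) with hε
  have ε0 : 0 < ε := by positivity
  set l := ell R ε δ with hl
  have sl : Sm R (fun x => l x.1) := ell_sm hδ
  have l1 : ∀ r ∈ Icc 0 R, 1 ≤ l r := fun r hr => one_le_ell ε0.le hδ hr
  have sG : Sm R (fun x => (l x.1)⁻¹) := sl.inv fun x hx => one_pos.trans_le (l1 _ hx.1)
  have dG : ∀ r ∈ Icc 0 R, dr (fun x => (l x.1)⁻¹) (r, t) = ε / ((r + δ) * l r ^ 2) := fun r hr => by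
    have h1 := l1 r hr
    have h0 := hr.1
    have := (ell_deriv (R := R) (ε := ε) hδ hr.1).fun_inv (by change l r ≠ 0; positivity)
    rw [(sG.hr (r := r) (t := t) ⟨hr, ht.1⟩).unique this]
    change - (-ε / (r + δ)) / l r ^ 2 = _
    field_simp
  have IG : I R (dr (fun x => (l x.1)⁻¹)) t ≤ 1 := by
    rw [I_dr hR sG ht.1]
    have h1 := l1 R ⟨hR.le, le_rfl⟩
    have h2 := l1 0 ⟨le_rfl, hR.le⟩
    have h3 : (l R)⁻¹ ≤ 1 := inv_le_one_of_one_le₀ h1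
    have h4 : 0 ≤ (l 0)⁻¹ := by positivity
    simp only; linarith
  set α := M ^ (1/2 - γ/4 + β/2) with hα
  have α0 : 0 < α := by positivity
  have cl := sl.cont
  have cG := sG.dr.cont
  have k1 : ContinuousOn (fun x => ρ x * u x ^ 2 * x.1 * l x.1 ^ 2) (Kc R) := by
    have key : ∀ W : ℝ × ℝ → ℝ, ContinuousOn W (Kc R) → ContinuousOn (fun x => ρ x * u x ^ 2 * x.1 * W x ^ 2) (Kc R) := by
      intros; fun_prop
    exact key _ cl
  calc _ ≤ I R (fun x => (1/2 * α) * (ρ x * u x ^ 2 * x.1 * l x.1 ^ 2) + (1/2 * α⁻¹ * M * ε⁻¹) * dr (fun x => (l x.1)⁻¹) x + δ * |B|) t := by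
        refine I_mono hR (by fun_prop) (kad (kad (kcm _ k1) (kcm _ cG)) (kct _)) ht.1 fun r hr => ?_
        have hr0 := hr.1
        have hp := S.pos (r,t) ⟨hr, ht.1⟩
        have hpM := hρM r hr t ht
        have huV := S.uV (r,t) ⟨hr, ht.1⟩
        have hBr := (hB r hr t ⟨ht.1, le_rfl⟩).trans (le_abs_self B)
        have h1 := l1 r hr
        simp only at huV
        simp only
        rw [dG r hr]
        generalize l r = lr at *
        generalize ρ (r,t) = q at *
        generalize V (r,t) = v at *
        generalize u (r,t) = w at *
        have hl0 : 0 < lr := by linarith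
        have hd : 0 < r + δ := by positivity
        have e1 : |q * w| = q * |w| * (r / (r + δ)) + |q * v| * (r / (r + δ)) * δ := by
          rw [huV, abs_mul, abs_mul, abs_mul, abs_of_pos hp, abs_of_nonneg hr0]
          field_simp
        have hθ : r / (r + δ) ≤ 1 := by rw [div_le_one hd]; linarith
        have hθ0 : 0 ≤ r / (r + δ) := by positivity
        have e2 : |q * v| * (r / (r + δ)) * δ ≤ |B| * 1 * δ := by gcongr
        have e3 : |w| / (r + δ) ≤ 1/2 * (α * (w ^ 2 * lr ^ 2) + α⁻¹ * (1 / ((r + δ) * lr) ^ 2)) := by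
          have s1 : 0 ≤ α⁻¹ * (α * (|w| * lr) - 1 / ((r + δ) * lr)) ^ 2 := by positivity
          have s2 : α⁻¹ * (α * (|w| * lr) - 1 / ((r + δ) * lr)) ^ 2 = α * (|w|^2 * lr^2) + α⁻¹ * (1 / ((r + δ) * lr) ^ 2) - 2 * (|w| / (r + δ)) := by
            field_simp; ring
          rw [sq_abs] at s2
          linarith
        have e4 : q * |w| * (r / (r + δ)) ≤ q * r * (1/2 * (α * (w ^ 2 * lr ^ 2) + α⁻¹ * (1 / ((r + δ) * lr) ^ 2))) := by
          calc _ = q * r * (|w| / (r + δ)) := by ring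
            _ ≤ _ := by gcongr
        have e5 : q * r * (1/2 * (α⁻¹ * (1 / ((r + δ) * lr) ^ 2))) ≤ 1/2 * α⁻¹ * M * ε⁻¹ * (ε / ((r + δ) * lr ^ 2)) := by
          calc _ = 1/2 * α⁻¹ * q * (r / (r + δ)) * (1 / ((r + δ) * lr ^ 2)) := by field_simp
            _ ≤ 1/2 * α⁻¹ * M * 1 * (1 / ((r + δ) * lr ^ 2)) := by gcongr
            _ = _ := by field_simp
        linarith
    _ = (1/2 * α) * I R (fun x => ρ x * u x ^ 2 * x.1 * l x.1 ^ 2) t + (1/2 * α⁻¹ * M * ε⁻¹) * I R (dr (fun x => (l x.1)⁻¹)) t + R * (δ * |B|) := by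
        rw [I_add hR (kad (kcm _ k1) (kcm _ cG)) (kct _) ht.1, I_add hR (kcm _ k1) (kcm _ cG) ht.1, I_mul, I_mul, I_const]
    _ ≤ (1/2 * α) * (C * M ^ ((γ - β)/2)) + (1/2 * α⁻¹ * M * ε⁻¹) * 1 + 1 := by
        have : R * (δ * |B|) ≤ 1 := by linarith
        gcongr
    _ ≤ _ := by
        have e1 : α * M ^ ((γ - β)/2) = M ^ (1/2 + γ/4) := by
          rw [hα, ← Real.rpow_add hM0]; congr 1; ring
        have e2 : α⁻¹ * M * ε⁻¹ = M ^ (1/2 + γ/4) := by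
          rw [hα, hε, ← Real.rpow_neg hM0.le, ← Real.rpow_neg hM0.le]
          nth_rewrite 2 [← Real.rpow_one M]
          rw [← Real.rpow_add hM0, ← Real.rpow_add hM0]; congr 1; ring
        have e3 : 1 ≤ M ^ (1/2 + γ/4) := Real.one_le_rpow hM (by linarith)
        have : (1/2 * α) * (C * M ^ ((γ - β)/2)) + (1/2 * α⁻¹ * M * ε⁻¹) * 1 + 1 = 1/2 * C * (α * M ^ ((γ - β)/2)) + 1/2 * (α⁻¹ * M * ε⁻¹) + 1 := by ring
        rw [this, e1, e2]
        have : 0 ≤ C * M ^ (1/2 + γ/4) := by positivity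
        nlinarith
end NS
end

section
open scoped ContDiff Topology
namespace NS

theorem prim_diff {R : ℝ} {f : ℝ × ℝ → ℝ} (hf : ContDiff ℝ ∞ f) {r : ℝ} (t : ℝ) (hr : r ∈ Icc 0 R) :
    |prim f (R, t) - prim f (r, t)| ≤ I R (fun x => |f x|) t := by
  have hc : Continuous (fun s => f (s, t)) := hf.continuous.comp (by fun_prop)
  rw [prim_eq, prim_eq, intervalIntegral.integral_interval_sub_left (hc.intervalIntegrable _ _) (hc.intervalIntegrable _ _)]
  refine (intervalIntegral.abs_integral_le_integral_abs hr.2).trans ?_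
  exact intervalIntegral.integral_mono_interval hr.1 hr.2 le_rfl (Eventually.of_forall fun s => abs_nonneg _)
    (hc.abs.intervalIntegrable _ _)

theorem deriv_nonneg_of_left_max {f : ℝ → ℝ} {f' t : ℝ} (ht : 0 < t) (hf : HasDerivAt f f' t)
    (h : ∀ s ∈ Icc 0 t, f s ≤ f t) : 0 ≤ f' := by
  have h1 := hf.hasDerivWithinAt (s := Iio t)
  rw [hasDerivWithinAt_iff_tendsto_slope' (by simp)] at h1
  refine ge_of_tendsto h1 ?_
  have : Ioo 0 t ∈ 𝓝[<] t := Ioo_mem_nhdsLT ht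
  filter_upwards [this] with s hs
  rw [slope_def_field]
  have := h s ⟨hs.1.le, hs.2.le⟩
  exact div_nonneg_of_nonpos (by linarith) (by linarith [hs.2])

theorem self_le_one_add_rpow {q a b : ℝ} (hq : 0 ≤ q) (ha : 0 ≤ a) (hab : a ≤ b) : q ^ a ≤ 1 + q ^ b := by
  rcases le_total q 1 with h | h
  · have := Real.rpow_nonneg hq b
    have := Real.rpow_le_one hq h ha
    linarith
  · have := Real.rpow_le_rpow_of_exponent_le h hab
    linarith

set_option maxHeartbeats 800000 in
theorem maxprinc (μ β γ R M₁ M₂ : ℝ) (hγ : 1 < γ) (hβ : 1 < β) (hβγ : β ≤ γ) (hR : 0 < R) (hμ : 0 < μ) :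
    ∃ C, 0 < C ∧ ∀ ρ u V, Data μ β γ R M₁ M₂ ρ u V → ∀ T M, 0 ≤ T → 1 ≤ M →
      (∀ r ∈ Icc 0 R, ∀ t ∈ Icc 0 T, ρ (r, t) ≤ M) → ∀ r ∈ Icc 0 R, ∀ t ∈ Icc 0 T,
      Sol.th μ β ρ (r, t) ≤ C * (1 + M ^ (1/2 + γ/4) + M) := by
  obtain ⟨E, hE, hEn⟩ := energy μ β γ R M₁ M₂
  obtain ⟨X, hX, hXi⟩ := xibound μ β γ R M₁ M₂ hγ hβ hβγ hR hμ
  set C1 := (2 / R ^ 2) * (1/2 * E + E) with hC1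
  have C1p : 0 < C1 := by positivity
  set L := 1 + |M₁| + C1 ^ (1/γ) with hL
  have hL1 : 1 ≤ L := by
    have : 0 ≤ C1 ^ (1/γ) := by positivity
    have := abs_nonneg M₁
    linarith
  set A0 := (2 / R ^ 2) * ((β - 1)⁻¹ * (R ^ 2 / 2 + E) + 1/2 * (1/2 * R * (2 * E + R ^ 2 / 2))) with hA0
  have hβ' : 0 < β - 1 := by linarith
  have A0p : 0 < A0 := by positivity
  set tL := 2 * μ * Real.log L + β⁻¹ * L ^ β with htL
  have tLp : 0 ≤ tL := by
    have := Real.log_nonneg hL1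
    positivity
  refine ⟨tL + 2 * X + 2 * A0 + 2 * E, by positivity, ?_⟩
  intro ρ u V hD T M hT hM hρM r hr t ht
  obtain ⟨⟨H, hHc, hHb, hHd⟩, hE1, hE2, hD0⟩ := hEn ρ u V hD
  have S := hD.1
  have hXi := hXi ρ u V hD T M hM hρM
  have c1 := S.sρ.cont
  have c2 := S.su.cont
  have c3 := S.sd.cont
  have c4 := (S.sp β).cont
  have c5 := (S.sp γ).cont
  have c6 := S.sV.cont
  have kβ : ContinuousOn (fun x => ρ x ^ β * x.1) (Kc R) := kml c4 kfs
  have kγ : ContinuousOn (fun x => ρ x ^ γ * x.1) (Kc R) := kml c5 kfs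
  -- A
  set A : ℝ → ℝ := fun t => (2 / R ^ 2) * ((β - 1)⁻¹ * I R (fun x => ρ x ^ β * x.1) t - 1/2 * I R (fun x => ρ x * u x * x.1 ^ 2) t) with hA
  have cA : ContinuousOn A (Ici 0) := by
    have a1 := I_cont hR kβ
    have a2 := I_cont hR (f := fun x => ρ x * u x * x.1 ^ 2) (by fun_prop)
    exact continuousOn_const.mul ((continuousOn_const.mul a1).sub (continuousOn_const.mul a2))
  have mass : ∀ s, 0 ≤ s → ∀ a, 0 ≤ a → a ≤ γ → I R (fun x => ρ x ^ a * x.1) s ≤ R ^ 2 / 2 + E := by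
    intro s hs a ha0 ha
    calc _ ≤ I R (fun x => x.1 + ρ x ^ γ * x.1) s := by
          refine I_mono hR (kml (S.sp a).cont kfs) (kad kfs kγ) hs fun r hr => ?_
          have := mul_le_mul_of_nonneg_right (self_le_one_add_rpow (S.pos (r,s) ⟨hr, hs⟩).le ha0 ha) hr.1
          simp only; linarith
      _ = R ^ 2 / 2 + I R (fun x => ρ x ^ γ * x.1) s := by rw [I_add hR kfs kγ hs, I_id]
      _ ≤ _ := by have := hE2 s hs; linarith
  have bA : ∀ s, 0 ≤ s → |A s| ≤ A0 := by
    intro s hs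
    have h1 : |I R (fun x => ρ x ^ β * x.1) s| ≤ R ^ 2 / 2 + E := by
      rw [abs_of_nonneg]
      · exact mass s hs β (by linarith) hβγ
      · exact I_nonneg hR fun r hr => mul_nonneg (Real.rpow_nonneg (S.pos (r,s) ⟨hr, hs⟩).le β) hr.1
    have h2 : |I R (fun x => ρ x * u x * x.1 ^ 2) s| ≤ 1/2 * R * (2 * E + R ^ 2 / 2) := by
      have k1 : ContinuousOn (fun x => ρ x * u x ^ 2 * x.1) (Kc R) := by fun_prop
      have k2 : ContinuousOn (fun x => ρ x ^ (1:ℝ) * x.1) (Kc R) := kml (S.sp 1).cont kfs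
      calc _ ≤ I R (fun x => |ρ x * u x * x.1 ^ 2|) s := intervalIntegral.abs_integral_le_integral_abs hR.le
        _ ≤ I R (fun x => (1/2 * R) * (ρ x * u x ^ 2 * x.1 + ρ x ^ (1:ℝ) * x.1)) s := by
            refine I_mono hR (by fun_prop) (kcm _ (kad k1 k2)) hs fun r hr => ?_
            have hp := S.pos (r,s) ⟨hr, hs⟩
            have h0 := hr.1
            simp only [Real.rpow_one]
            rw [abs_mul, abs_mul, abs_of_pos hp, abs_of_nonneg (by positivity : 0 ≤ r^2)]
            have a1 : |u (r,s)| ≤ 1/2 * (u (r,s) ^ 2 + 1) := by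
              nlinarith [sq_abs (u (r,s)), sq_nonneg (|u (r,s)| - 1)]
            calc ρ (r,s) * |u (r,s)| * r ^ 2 = ρ (r,s) * |u (r,s)| * r * r := by ring
              _ ≤ ρ (r,s) * (1/2 * (u (r,s) ^ 2 + 1)) * r * R := by gcongr; exact hr.2
              _ = _ := by ring
        _ = (1/2 * R) * (I R (fun x => ρ x * u x ^ 2 * x.1) s + I R (fun x => ρ x ^ (1:ℝ) * x.1) s) := by
            rw [I_mul, I_add hR k1 k2 hs]
        _ ≤ _ := by
            have a1 := hE1 s hs
            have a2 := mass s hs 1 (by norm_num) hγ.le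
            have a3 : I R (fun x => ρ x * u x ^ 2 * x.1) s + I R (fun x => ρ x ^ (1:ℝ) * x.1) s ≤ 2 * E + R ^ 2 / 2 := by linarith
            exact mul_le_mul_of_nonneg_left a3 (by positivity)
    rw [hA, hA0]
    simp only [abs_mul]
    rw [abs_of_pos (by positivity : 0 < 2 / R ^ 2)]
    gcongr
    refine (abs_sub _ _).trans ?_
    rw [abs_mul, abs_mul, abs_of_pos (by positivity : 0 < (β - 1)⁻¹), abs_of_pos (by norm_num : (0:ℝ) < 1/2)]
    gcongr
  have dA : ∀ s, 0 < s → HasDerivAt A (- Fx μ β γ ρ u V (R, s) - (2 / R ^ 2) * (1/2 * I R (fun x => ρ x * u x ^ 2 * x.1) s + I R (fun x => ρ x ^ γ * x.1) s)) s := by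
    intro s hs
    refine (((S.bal_beta hs).const_mul _).fun_sub ((S.bal_mom hs).const_mul _) |>.const_mul _).congr_deriv ?_
    have k1 : ContinuousOn (fun x => ρ x * u x ^ 2 * x.1) (Kc R) := by fun_prop
    have k2 : ContinuousOn (fun x => Fx μ β γ ρ u V x * x.1) (Kc R) := kml S.sF.cont kfs
    have k3 : ContinuousOn (fun x => dv u V x * x.1) (Kc R) := by fun_prop
    have k4 : ContinuousOn (fun x => ρ x ^ β * dv u V x * x.1) (Kc R) := kml (kml c4 c3) kfs
    have eF : I R (fun x => Fx μ β γ ρ u V x * x.1) s = I R (fun x => ρ x ^ β * dv u V x * x.1) s - I R (fun x => ρ x ^ γ * x.1) s := by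
      have : I R (fun x => Fx μ β γ ρ u V x * x.1) s = I R (fun x => (2 * μ) * (dv u V x * x.1) + ρ x ^ β * dv u V x * x.1 - ρ x ^ γ * x.1) s :=
        I_congr hR fun r _ => by simp only [Fx]; ring
      rw [this, I_sub hR (kad (kcm _ k3) k4) kγ hs.le, I_add hR (kcm _ k3) k4 hs.le, I_mul, S.d_int hs.le]; ring
    rw [I_mul, I_sub hR k1 (kcm _ k2) hs.le, I_mul, eF]
    field_simp
    ring
  -- the functional
  set η := prim (fun x => ρ x * u x) with hη
  have sη : Sm R η := (prim_smooth S.c_mom).sm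
  set G : ℝ × ℝ → ℝ := fun x => Sol.th μ β ρ x - (η (R, x.2) - η x) - A x.2 - M * H x.2 with hG
  have hη' : ∀ r ∈ Icc 0 R, ∀ t ∈ Icc 0 T, |η (R, t) - η (r, t)| ≤ X * M ^ (1/2 + γ/4) := fun r hr t ht =>
    (prim_diff S.c_mom t hr).trans (hXi t ht)
  have cG : ContinuousOn G (Icc 0 R ×ˢ Icc 0 T) := by
    have sub : Icc 0 R ×ˢ Icc 0 T ⊆ Kc R := fun x hx => ⟨hx.1, hx.2.1⟩
    have a1 := S.s_th.cont.mono sub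
    have a2 := sη.cont.mono sub
    have a3 : ContinuousOn (fun x : ℝ × ℝ => A x.2) (Icc 0 R ×ˢ Icc 0 T) := cA.comp continuousOn_snd fun x hx => hx.2.1
    have a4 : ContinuousOn (fun x : ℝ × ℝ => H x.2) (Icc 0 R ×ˢ Icc 0 T) := hHc.comp continuousOn_snd fun x hx => hx.2.1
    have a5 : ContinuousOn (fun x : ℝ × ℝ => η (R, x.2)) (Icc 0 R ×ˢ Icc 0 T) :=
      ((prim_smooth S.c_mom).continuous.comp (by fun_prop : Continuous fun x : ℝ × ℝ => (R, x.2))).continuousOn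
    exact ((a1.sub (a5.sub a2)).sub a3).sub (continuousOn_const.mul a4)
  obtain ⟨⟨r1, t1⟩, hx1, hmax⟩ := (isCompact_Icc.prod isCompact_Icc).exists_isMaxOn
    ⟨(r, t), (⟨hr, ht⟩ : (r,t) ∈ Icc 0 R ×ˢ Icc 0 T)⟩ cG
  have hr1 : r1 ∈ Icc 0 R := hx1.1
  have ht1 : t1 ∈ Icc 0 T := hx1.2
  have hk : (r1, t1) ∈ Kc R := ⟨hr1, ht1.1⟩
  have hp1 := S.pos _ hk
  have hρL : ρ (r1, t1) ≤ L := by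
    have := Real.rpow_nonneg C1p.le (1/γ)
    have hab := abs_nonneg M₁
    rcases eq_or_lt_of_le ht1.1 with h0 | h0
    · rw [← h0]
      have := hD.2.1 r1 hr1
      have := le_abs_self M₁
      linarith
    · obtain ⟨h', hh1, hh2⟩ := hHd t1 h0
      have dr1 : HasDerivAt (fun s => G (s, t1)) (dr (Sol.th μ β ρ) (r1, t1) + ρ (r1,t1) * u (r1,t1)) r1 := by
        have := ((S.s_th.hr hk).fun_sub ((prim_hr S.c_mom r1 t1).const_sub (η (R, t1)))).sub_const (A t1) |>.sub_const (M * H t1)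
        refine this.congr_deriv ?_
        ring
      have hkR : (R, t1) ∈ Kc R := ⟨⟨hR.le, le_rfl⟩, ht1.1⟩
      have dt1 := (((S.s_th.ht hk).fun_sub ((sη.ht hkR).fun_sub (sη.ht hk))).fun_sub (dA t1 h0)).fun_sub (hh1.const_mul M)
      have ft := deriv_nonneg_of_left_max h0 dt1 (fun s hs => by
        have := hmax (show (r1, s) ∈ Icc 0 R ×ˢ Icc 0 T from ⟨hr1, hs.1, hs.2.trans ht1.2⟩)
        exact this)
      have ug : u (r1, t1) * (dr (Sol.th μ β ρ) (r1, t1) + ρ (r1,t1) * u (r1,t1)) = 0 := by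
        rcases eq_or_lt_of_le hr1.1 with ha | ha
        · rw [← ha, S.u0 ht1.1, zero_mul]
        rcases eq_or_lt_of_le hr1.2 with hb | hb
        · rw [hb, S.uR t1 ht1.1, zero_mul]
        have lm : IsLocalMax (fun s => G (s, t1)) r1 := by
          filter_upwards [Ioo_mem_nhds ha hb] with s hs
          exact hmax (show (s, t1) ∈ Icc 0 R ×ˢ Icc 0 T from ⟨⟨hs.1.le, hs.2.le⟩, ht1⟩)
        rw [lm.hasDerivAt_eq_zero dr1, mul_zero]
      have e1 := S.xi_t hk
      have e2 := S.th_eq hk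
      have eN : |prim (fun x => ρ x * u x * V x) (R, t1) - prim (fun x => ρ x * u x * V x) (r1, t1)| ≤ M * Sol.Dd R u V t1 := by
        refine (prim_diff S.c_momV t1 hr1).trans ?_
        calc _ ≤ I R (fun x => M * (V x ^ 2 * x.1)) t1 := by
              refine I_mono hR (by fun_prop) (by fun_prop) ht1.1 fun r hr => ?_
              have hp := S.pos (r,t1) ⟨hr, ht1.1⟩
              have h0 := hr.1
              have huV := S.uV (r,t1) ⟨hr, ht1.1⟩
              have hm := hρM r hr t1 ht1
              simp only at huV ⊢
              have : ρ (r,t1) * u (r,t1) * V (r,t1) = ρ (r,t1) * (V (r,t1) ^ 2 * r) := by rw [huV]; ring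
              rw [this, abs_of_nonneg (by positivity)]
              gcongr
          _ = M * I R (fun x => V x ^ 2 * x.1) t1 := I_mul _ _ _
          _ ≤ _ := by gcongr; exact S.V_le ht1.1
      have hMh : M * Sol.Dd R u V t1 ≤ M * h' := by gcongr
      have eN' := (le_abs_self _).trans eN
      have q1 := hE1 t1 ht1.1
      have q2 := hE2 t1 ht1.1
      have q3 : (2 / R ^ 2) * (1/2 * I R (fun x => ρ x * u x ^ 2 * x.1) t1 + I R (fun x => ρ x ^ γ * x.1) t1) ≤ C1 := by
        rw [hC1]; gcongr
      have hP : ρ (r1,t1) ^ γ ≤ C1 := by nlinarith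
      have : ρ (r1,t1) ≤ C1 ^ (1/γ) := by
        calc ρ (r1,t1) = (ρ (r1,t1) ^ γ) ^ (1/γ) := by
              rw [← Real.rpow_mul hp1.le, mul_one_div_cancel (by linarith), Real.rpow_one]
          _ ≤ _ := Real.rpow_le_rpow (by positivity) hP (by positivity)
      linarith
  have hth : Sol.th μ β ρ (r1, t1) ≤ tL := by
    have := Real.log_le_log hp1 hρL
    have := Real.rpow_le_rpow hp1.le hρL (by linarith : 0 ≤ β)
    rw [htL, Sol.th]; gcongr
  have hcomp : G (r, t) ≤ G (r1, t1) := hmax (show (r, t) ∈ Icc 0 R ×ˢ Icc 0 T from ⟨hr, ht⟩)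
  simp only [hG] at hcomp
  have a1 := abs_le.1 (hη' r hr t ht)
  have a2 := abs_le.1 (hη' r1 hr1 t1 ht1)
  have a3 := abs_le.1 (bA t ht.1)
  have a4 := abs_le.1 (bA t1 ht1.1)
  have a5 := abs_le.1 (hHb t ht.1)
  have a6 := abs_le.1 (hHb t1 ht1.1)
  have a7 : M * H t ≤ M * E := by gcongr; exact a5.2
  have a8 : M * (-E) ≤ M * H t1 := by gcongr; exact a6.1
  have hMp : 0 ≤ M ^ (1/2 + γ/4) := by positivity
  have p1 : 0 ≤ tL * (M ^ (1/2 + γ/4) + M) := by positivity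
  have p2 : 0 ≤ X * (1 + M) := by positivity
  have p3 : 0 ≤ A0 * (M ^ (1/2 + γ/4) + M) := by positivity
  have p4 : 0 ≤ E * (1 + M ^ (1/2 + γ/4)) := by positivity
  linarith [a1.2, a2.1, a3.2, a4.1]

theorem density_bound (μ β γ R M₁ M₂ : ℝ) (hμ : 0 < μ) (hγ : 1 < γ) (hβ : max 1 ((γ + 2) / 4) < β) (hβγ : β ≤ γ) (hR : 0 < R) :
    ∃ C, 0 < C ∧ ∀ ρ u V, Data μ β γ R M₁ M₂ ρ u V → ∀ r ∈ Icc 0 R, ∀ t, 0 ≤ t → ρ (r, t) ≤ C := by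
  have hβ1 : 1 < β := (le_max_left _ _).trans_lt hβ
  have hβ2 : (γ + 2) / 4 < β := (le_max_right _ _).trans_lt hβ
  obtain ⟨C, hC, hb⟩ := maxprinc μ β γ R M₁ M₂ hγ hβ1 hβγ hR hμ
  set e1 := max 1 ((γ + 2) / 4) with he1
  set K := 1 + β * (C * 3) with hK
  have hK1 : 1 ≤ K := by
    have : 0 ≤ β * (C * 3) := by positivity
    linarith
  refine ⟨K ^ (1 / (β - e1)), by positivity, fun ρ u V hD r hr t ht => ?_⟩
  have S := hD.1
  obtain ⟨⟨r1, t1⟩, hx1, hmax⟩ := (isCompact_Icc.prod isCompact_Icc).exists_isMaxOn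
    ⟨(r, t), (⟨hr, ht, le_rfl⟩ : (r,t) ∈ Icc 0 R ×ˢ Icc 0 t)⟩ (S.cρ.continuous.continuousOn)
  set M := max 1 (ρ (r1, t1)) with hMd
  have hM : 1 ≤ M := le_max_left _ _
  have hM0 : 0 < M := by linarith
  have hρM : ∀ r ∈ Icc 0 R, ∀ s ∈ Icc 0 t, ρ (r, s) ≤ M := fun r hr s hs =>
    le_trans (hmax (show (r, s) ∈ Icc 0 R ×ˢ Icc 0 t from ⟨hr, hs⟩)) (le_max_right _ _)
  have main : M ^ β ≤ K * M ^ e1 := by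
    have hMe : 1 ≤ M ^ e1 := Real.one_le_rpow hM (le_trans zero_le_one (le_max_left _ _))
    rcases le_total (ρ (r1, t1)) 1 with h | h
    · have : M = 1 := max_eq_left h
      rw [this]; simpa using hK1
    · have hMe' : M = ρ (r1, t1) := max_eq_right h
      have := hb ρ u V hD t M ht hM hρM r1 hx1.1 t1 hx1.2
      rw [Sol.th, ← hMe'] at this
      have hlog := Real.log_nonneg hM
      have l1 : M ≤ M ^ e1 := Real.self_le_rpow_of_one_le hM (le_max_left _ _)
      have l2 : M ^ (1/2 + γ/4) ≤ M ^ e1 := Real.rpow_le_rpow_of_exponent_le hM (by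
        refine le_trans (le_of_eq ?_) (le_max_right _ _); ring)
      have l3 : C * (1 + M ^ (1/2 + γ/4) + M) ≤ C * (3 * M ^ e1) := by gcongr; linarith
      have l4 : 0 ≤ 2 * μ * Real.log M := by positivity
      have l5 : β⁻¹ * M ^ β ≤ C * (3 * M ^ e1) := by linarith
      rw [inv_mul_le_iff₀ (by linarith)] at l5
      rw [hK]; nlinarith
  have : M ^ (β - e1) ≤ K := by
    rw [Real.rpow_sub hM0, div_le_iff₀ (by positivity)]; exact main
  have hfin : M ≤ K ^ (1 / (β - e1)) := by
    have hpos : 0 < β - e1 := by linarith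
    calc M = (M ^ (β - e1)) ^ (1 / (β - e1)) := by
          rw [← Real.rpow_mul hM0.le, mul_one_div_cancel hpos.ne', Real.rpow_one]
      _ ≤ _ := Real.rpow_le_rpow (by positivity) this (by positivity)
  exact (hρM r hr t ⟨ht, le_rfl⟩).trans hfin
end NS
end

section
open scoped ContDiff Topology
namespace NS

/-- solution with time-uniform information -/
structure Ev (μ β γ R σ m : ℝ) (ρ u V : ℝ × ℝ → ℝ) : Prop where
  S : Sol μ β γ R ρ u V
  bd : ∀ x ∈ Kc R, ρ x ≤ m
  σ0 : 0 < σ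
  σm : σ ≤ m
  mass : ∀ t, 0 ≤ t → I R (fun x => ρ x * x.1) t = σ * (R ^ 2 / 2)
  kin : ∃ E, ∀ t, 0 ≤ t → I R (fun x => ρ x * u x ^ 2 * x.1) t ≤ E
  lyap : ∃ H E, Lyap H (Sol.Dd R u V) E

theorem mass_cons {μ β γ R : ℝ} {ρ u V : ℝ × ℝ → ℝ} (S : Sol μ β γ R ρ u V) {t : ℝ} (ht : 0 ≤ t) :
    I R (fun x => ρ x * x.1) t = I R (fun x => ρ x * x.1) 0 := by
  have hc : ContinuousOn (I R (fun x => ρ x * x.1)) (Icc 0 t) :=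
    (I_cont S.hR (S.sρ.mul Sm.fst).cont).mono Icc_subset_Ici_self
  refine le_antisymm ?_ ?_
  · exact le_of_deriv_nonpos ht hc fun s hs => ⟨0, S.bal_mass hs.1, le_rfl⟩
  · have := le_of_deriv_nonpos (f := fun s => - I R (fun x => ρ x * x.1) s) ht hc.neg fun s hs => ⟨-0, (S.bal_mass hs.1).fun_neg, by simp⟩
    linarith

theorem I_pos_mass {μ β γ R : ℝ} {ρ u V : ℝ × ℝ → ℝ} (S : Sol μ β γ R ρ u V) :
    0 < I R (fun x => ρ x * x.1) 0 := by
  have hc : ContinuousOn (fun r => ρ (r, 0) * r) (Icc 0 R) := (S.sρ.mul Sm.fst).cr le_rfl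
  refine intervalIntegral.intervalIntegral_pos_of_pos_on ?_ (fun r hr => ?_) S.hR
  · exact (hc.mono (by rw [uIcc_of_le S.hR.le])).intervalIntegrable
  · exact mul_pos (S.pos _ ⟨⟨hr.1.le, hr.2.le⟩, self_mem_Ici⟩) hr.1

theorem mkEv {μ β γ R M₁ M₂ C : ℝ} {ρ u V : ℝ × ℝ → ℝ} (h : Data μ β γ R M₁ M₂ ρ u V)
    (hC : ∀ r ∈ Icc 0 R, ∀ t, 0 ≤ t → ρ (r, t) ≤ C) :
    ∃ m, Ev μ β γ R ((2 / R ^ 2) * I R (fun x => ρ x * x.1) 0) m ρ u V := by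
  obtain ⟨E, hE, h2⟩ := energy μ β γ R M₁ M₂
  obtain ⟨⟨H, hH⟩, h3, -, -⟩ := h2 ρ u V h
  have S := h.1
  have hR := S.hR
  refine ⟨max C ((2 / R ^ 2) * I R (fun x => ρ x * x.1) 0), S, ?_, ?_, le_max_right _ _, ?_, ⟨E, h3⟩, ⟨H, E, hH⟩⟩
  · rintro ⟨r, t⟩ hx
    exact (hC r hx.1 t hx.2).trans (le_max_left _ _)
  · exact mul_pos (by positivity) (I_pos_mass S)
  · intro t ht
    rw [mass_cons S ht]; field_simp

/-- weighted Cauchy-Schwarz -/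
theorem I_CSw {R : ℝ} {f g w : ℝ × ℝ → ℝ} (hR : 0 < R) (hf : ContinuousOn f (Kc R)) (hg : ContinuousOn g (Kc R))
    (hw : ContinuousOn w (Kc R)) {t : ℝ} (ht : 0 ≤ t) (h0 : ∀ r ∈ Icc 0 R, 0 ≤ w (r, t)) :
    (I R (fun x => f x * g x * w x) t) ^ 2 ≤ I R (fun x => f x ^ 2 * w x) t * I R (fun x => g x ^ 2 * w x) t := by
  have key : ∀ s : ℝ, 0 ≤ I R (fun x => f x ^ 2 * w x) t * (s * s) + (-2 * I R (fun x => f x * g x * w x) t) * s + I R (fun x => g x ^ 2 * w x) t := by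
    intro s
    have e : I R (fun x => (s * f x - g x) ^ 2 * w x) t = I R (fun x => f x ^ 2 * w x) t * (s * s) + (-2 * I R (fun x => f x * g x * w x) t) * s + I R (fun x => g x ^ 2 * w x) t := by
      have e1 : I R (fun x => (s * f x - g x) ^ 2 * w x) t = I R (fun x => ((s*s) * (f x ^ 2 * w x) + (-2*s) * (f x * g x * w x)) + g x ^ 2 * w x) t :=
        I_congr hR fun r _ => by ring
      rw [e1, I_add hR (by fun_prop) (by fun_prop) ht, I_add hR (by fun_prop) (by fun_prop) ht, I_mul, I_mul]
      ring
    rw [← e]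
    exact I_nonneg hR fun r hr => mul_nonneg (sq_nonneg _) (h0 r hr)
  have := discrim_le_zero key
  unfold discrim at this
  nlinarith

theorem p_lower {γ x y : ℝ} (hγ : 1 < γ) (hx : 0 < x) (hy : 0 < y) :
    y ^ (γ - 1) * (x - y) ^ 2 ≤ (x ^ γ - y ^ γ) * (x - y) := by
  have e1 : x ^ γ = x ^ (γ - 1) * x := by rw [Real.rpow_sub_one hx.ne', div_mul_cancel₀ _ hx.ne']
  have e2 : y ^ γ = y ^ (γ - 1) * y := by rw [Real.rpow_sub_one hy.ne', div_mul_cancel₀ _ hy.ne']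
  rw [e1, e2]
  have h : 0 ≤ (x ^ (γ - 1) - y ^ (γ - 1)) * (x - y) := by
    rcases le_total x y with h | h
    · exact mul_nonneg_of_nonpos_of_nonpos (sub_nonpos.2 (Real.rpow_le_rpow hx.le h (by linarith))) (by linarith)
    · exact mul_nonneg (sub_nonneg.2 (Real.rpow_le_rpow hy.le h (by linarith))) (by linarith)
  nlinarith [mul_nonneg hx.le h]

theorem p_upper {γ m x y : ℝ} (hγ : 1 < γ) (hx : 0 < x) (hy : 0 < y) (hxm : x ≤ m) (hym : y ≤ m) :
    |x ^ γ - y ^ γ| ≤ γ * m ^ (γ - 1) * |x - y| := by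
  have := Convex.norm_image_sub_le_of_norm_hasDerivWithin_le (f := fun z : ℝ => z ^ γ)
    (f' := fun z => γ * z ^ (γ - 1)) (s := Icc 0 m) (C := γ * m ^ (γ - 1)) (x := y) (y := x)
    (fun z _ => (Real.hasDerivAt_rpow_const (Or.inr hγ.le)).hasDerivWithinAt) (fun z hz => by
      have : 0 ≤ z ^ (γ - 1) := Real.rpow_nonneg hz.1 _
      rw [Real.norm_of_nonneg (by positivity)]
      gcongr
      · exact hz.1
      · exact hz.2) (convex_Icc _ _) ⟨hy.le, hym⟩ ⟨hx.le, hxm⟩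
  simpa using this

namespace Ev
variable {μ β γ R σ m : ℝ} {ρ u V : ℝ × ℝ → ℝ}

theorem hm (h : Ev μ β γ R σ m ρ u V) : 0 < m := h.σ0.trans_le h.σm

def qf (σ : ℝ) (ρ : ℝ × ℝ → ℝ) : ℝ × ℝ → ℝ := prim (fun x => (ρ x - σ) * x.1)
/-- density fluctuation -/
def Y (R σ : ℝ) (ρ : ℝ × ℝ → ℝ) : ℝ → ℝ := I R (fun x => (ρ x - σ) ^ 2 * x.1)

theorem cq (h : Ev μ β γ R σ m ρ u V) : ContDiff ℝ ∞ (fun x => (ρ x - σ) * x.1) :=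
  (h.S.cρ.sub contDiff_const).mul contDiff_fst
theorem sq (h : Ev μ β γ R σ m ρ u V) : Sm R (qf σ ρ) := (prim_smooth h.cq).sm

theorem q_R (h : Ev μ β γ R σ m ρ u V) {t : ℝ} (ht : 0 ≤ t) : qf σ ρ (R, t) = 0 := by
  have c1 := h.S.sρ.cont
  rw [qf, prim_R]
  have e : I R (fun x => (ρ x - σ) * x.1) t = I R (fun x => ρ x * x.1 - σ * x.1) t := I_congr h.S.hR fun r _ => by ring
  rw [e, I_sub h.S.hR (by fun_prop) (by fun_prop) ht, I_mul, I_id, h.mass t ht]; ring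
theorem q_0 (t : ℝ) : qf σ ρ (0, t) = 0 := prim_zero _ t

theorem q_t (h : Ev μ β γ R σ m ρ u V) {r t : ℝ} (hk : (r, t) ∈ Kc R) : dt (qf σ ρ) (r, t) = - (ρ (r, t) * u (r, t) * r) := by
  have S := h.S
  have s0 : Sm R (fun x => ρ x * u x * x.1) := (S.sρ.mul S.su).mul Sm.fst
  have sz := h.sq.dt.add s0
  have key : ∀ s ∈ Icc 0 R, dr (fun x => dt (qf σ ρ) x + ρ x * u x * x.1) (s, t) = 0 := by
    intro s hs
    have hk : (s, t) ∈ Kc R := ⟨hs, hk.2⟩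
    have h1 := (sz.hr hk).unique ((h.sq.dt.hr hk).fun_add (((S.sρ.hr hk).fun_mul (S.su.hr hk)).fun_mul (hasDerivAt_id' s)))
    have h2 : dr (dt (qf σ ρ)) (s, t) = dt ρ (s, t) * s := by
      rw [← h.sq.symm hk]
      have a := dt_eq S.hR h.sq.dr h.cq.sm (fun x hx => prim_dr h.cq hx) _ hk
      rw [a]
      exact (h.cq.sm.ht hk).unique (((S.sρ.ht hk).sub_const σ).mul_const s)
    have h3 := S.uV _ hk
    simp only at h3
    rw [h1, h2, S.mass _ hk, dv, h3]; ring
  have e1 := const_of_dr sz hk.2 key hk.1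
  have e2 := const_of_dr sz hk.2 key (⟨le_rfl, S.hR.le⟩ : (0:ℝ) ∈ Icc 0 R)
  have hk0 : ((0:ℝ), t) ∈ Kc R := ⟨⟨le_rfl, S.hR.le⟩, hk.2⟩
  have e3 : dt (qf σ ρ) (0, t) = 0 := by
    have := h.sq.ht hk0
    simp only [q_0] at this
    exact this.unique (hasDerivAt_const _ _)
  simp only [e3] at e1 e2
  rw [← e2] at e1
  simp only [mul_zero, add_zero] at e1
  linarith

theorem fl (h : Ev μ β γ R σ m ρ u V) {x} (hx : x ∈ Kc R) : |ρ x - σ| ≤ m := by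
  have := h.bd x hx; have := h.S.pos x hx; have := h.σ0; have := h.σm
  rw [abs_le]; constructor <;> linarith

theorem q_le (h : Ev μ β γ R σ m ρ u V) {r t : ℝ} (hk : (r, t) ∈ Kc R) : |qf σ ρ (r, t)| ≤ m * R * r := by
  have hm := h.hm
  have : |avg (fun x => (ρ x - σ) * x.1) (r, t)| ≤ m * R := by
    unfold avg
    have := intervalIntegral.norm_integral_le_of_norm_le_const (a := 0) (b := 1) (C := m * R)
      (f := fun s => (ρ (r * s, t) - σ) * (r * s)) (fun s hs => by
        rw [uIoc_of_le zero_le_one] at hs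
        have h1 : r * s ∈ Icc 0 R := ⟨mul_nonneg hk.1.1 hs.1.le, (mul_le_of_le_one_right hk.1.1 hs.2).trans hk.1.2⟩
        rw [norm_mul, Real.norm_eq_abs, Real.norm_of_nonneg h1.1]
        exact mul_le_mul (h.fl ⟨h1, hk.2⟩) h1.2 h1.1 hm.le)
    simpa using this
  have hr : 0 ≤ r := hk.1.1
  unfold qf prim
  rw [abs_mul, abs_of_nonneg hr]
  nlinarith

theorem bal_q (h : Ev μ β γ R σ m ρ u V) {t : ℝ} (ht : 0 < t) :
    HasDerivAt (I R (fun x => ρ x * u x * qf σ ρ x))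
     (I R (fun x => -((Fx μ β γ ρ u V x + σ ^ γ) - ρ x * u x ^ 2) * (ρ x - σ) * x.1 - ρ x * u x * V x * qf σ ρ x
       - ρ x ^ 2 * u x ^ 2 * x.1) t) t := by
  have S := h.S
  have c1 := S.sρ.cont
  have c2 := S.su.cont
  have c3 := S.sF.cont
  have c4 := S.sV.cont
  have c5 := h.sq.cont
  have := balance S.hR ((S.sρ.mul S.su).mul h.sq) (((S.sF.add (Sm.const (σ ^ γ))).sub (S.sρ.mul (S.su.pow 2))).mul h.sq)
    (S := fun x => -((Fx μ β γ ρ u V x + σ ^ γ) - ρ x * u x ^ 2) * (ρ x - σ) * x.1 - ρ x * u x * V x * qf σ ρ x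
       - ρ x ^ 2 * u x ^ 2 * x.1) (by fun_prop) ?_ ht
  · simpa [h.q_R ht.le, q_0] using this
  · intro r t hx
    have hk := Oc_sub R hx
    refine ⟨_, _, ((S.sρ.ht hk).fun_mul (S.su.ht hk)).fun_mul (h.sq.ht hk),
      (((S.sF.hr hk).add_const (σ ^ γ)).fun_sub ((S.sρ.hr hk).fun_mul ((S.su.hr hk).fun_pow 2))).fun_mul (prim_hr h.cq r t), ?_⟩
    have h1 := S.mass _ hk
    have h2 := S.mom _ hk
    rw [h1, h2, h.q_t hk]; simp only [dv]; push_cast; ring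

theorem bal_Y (h : Ev μ β γ R σ m ρ u V) {t : ℝ} (ht : 0 < t) :
    HasDerivAt (Y R σ ρ) (I R (fun x => -((ρ x - σ) * dv u V x * (ρ x + σ)) * x.1) t) t := by
  have S := h.S
  have c1 := S.sρ.cont
  have c2 := S.sd.cont
  have s1 := S.sρ.sub (Sm.const (R := R) σ)
  have := balance S.hR ((s1.pow 2).mul Sm.fst) (((s1.pow 2).mul S.su).mul Sm.fst).neg
    (S := fun x => -((ρ x - σ) * dv u V x * (ρ x + σ)) * x.1) (by fun_prop) ?_ ht
  · unfold Y; simpa [S.uR t ht.le] using this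
  · intro r t hx
    have hk := Oc_sub R hx
    refine ⟨_, _, (((S.sρ.ht hk).sub_const σ).fun_pow 2).mul_const r,
      (((((S.sρ.hr hk).sub_const σ).fun_pow 2).fun_mul (S.su.hr hk)).fun_mul (hasDerivAt_id' r)).fun_neg, ?_⟩
    have h1 := S.mass _ hk
    have h3 := S.uV _ hk
    simp only at h3
    rw [h1]; simp only [dv]; rw [h3]; push_cast; ring

/-- total dissipation -/
def aa (R σ : ℝ) (ρ u V : ℝ × ℝ → ℝ) (t : ℝ) : ℝ := Sol.Dd R u V t + Y R σ ρ t

theorem Y_nonneg (h : Ev μ β γ R σ m ρ u V) {t : ℝ} : 0 ≤ Y R σ ρ t :=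
  I_nonneg h.S.hR fun r hr => mul_nonneg (sq_nonneg _) hr.1
theorem a_nonneg (h : Ev μ β γ R σ m ρ u V) {t : ℝ} : 0 ≤ aa R σ ρ u V t :=
  add_nonneg h.S.D_nonneg h.Y_nonneg

theorem Y_deriv (h : Ev μ β γ R σ m ρ u V) : ∃ C, 0 < C ∧ ∀ t, 0 < t → ∃ y', HasDerivAt (Y R σ ρ) y' t ∧ y' ≤ C * aa R σ ρ u V t := by
  have hm := h.hm
  refine ⟨m, hm, fun t ht => ⟨_, h.bal_Y ht, ?_⟩⟩
  have S := h.S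
  have c1 := S.sρ.cont
  have c2 := S.sd.cont
  unfold aa Y Sol.Dd
  rw [← I_add S.hR (by fun_prop) (by fun_prop) ht.le, ← I_mul]
  refine I_mono S.hR (by fun_prop) (by fun_prop) ht.le fun r hr => ?_
  have hk : (r, t) ∈ Kc R := ⟨hr, ht.le⟩
  have h1 := h.bd _ hk; have h2 := S.pos _ hk; have h3 := h.σ0; have h4 := h.σm
  have hr0 := hr.1
  simp only
  have : -((ρ (r,t) - σ) * dv u V (r,t) * (ρ (r,t) + σ)) ≤ m * (dv u V (r,t) ^ 2 + (ρ (r,t) - σ) ^ 2) := by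
    nlinarith [mul_nonneg (by linarith : 0 ≤ ρ (r,t) + σ) (sq_nonneg (dv u V (r,t) + (ρ (r,t) - σ))),
      mul_nonneg (by linarith : 0 ≤ 2 * m - (ρ (r,t) + σ)) (add_nonneg (sq_nonneg (dv u V (r,t))) (sq_nonneg (ρ (r,t) - σ)))]
  nlinarith
end Ev
end NS
end

section
open scoped ContDiff Topology
namespace NS
namespace Ev
variable {μ β γ R σ m : ℝ} {ρ u V : ℝ × ℝ → ℝ}

theorem kap (h : Ev μ β γ R σ m ρ u V) {x} (hx : x ∈ Kc R) :
    2 * μ ≤ 2 * μ + ρ x ^ β ∧ 2 * μ + ρ x ^ β ≤ 2 * μ + m ^ β := by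
  have h1 := Real.rpow_nonneg (h.S.pos x hx).le β
  have h2 := Real.rpow_le_rpow (h.S.pos x hx).le (h.bd x hx) (by linarith [h.S.hβ] : 0 ≤ β)
  constructor <;> linarith

theorem alg_q {c k K e d PP q σ U v Q r D m R : ℝ} (hc : 0 < c) (hk0 : 0 ≤ k) (hkK : k ≤ K) (hP : c * e ^ 2 ≤ PP * e)
    (hq : 0 ≤ q) (hqm : q ≤ m) (hs : 0 ≤ σ) (hsm : σ ≤ m) (hr : 0 ≤ r) (hrR : r ≤ R) (hU : U = r * v) (hUD : U ^ 2 ≤ D)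
    (hQ : |Q| ≤ m * R * r) (he : e = q - σ) :
    c / 2 * (e ^ 2 * r) - K ^ 2 / (2 * c) * (d ^ 2 * r) - m ^ 2 * D * r - m ^ 2 * R ^ 2 * (v ^ 2 * r) ≤
      -((k * d - PP) - q * U ^ 2) * e * r - q * U * v * Q - q ^ 2 * U ^ 2 * r := by
  have hm : 0 ≤ m := hq.trans hqm
  have hR : 0 ≤ R := hr.trans hrR
  have h1 : k * d * e ≤ c / 2 * e ^ 2 + K ^ 2 / (2 * c) * d ^ 2 := by
    have a1 : k * d * e ≤ c / 2 * e ^ 2 + k ^ 2 / (2 * c) * d ^ 2 := by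
      have : c / 2 * e ^ 2 + k ^ 2 / (2 * c) * d ^ 2 - k * d * e = (c * e - k * d) ^ 2 / (2 * c) := by field_simp; ring
      have : 0 ≤ (c * e - k * d) ^ 2 / (2 * c) := by positivity
      linarith
    have a2 : k ^ 2 / (2 * c) * d ^ 2 ≤ K ^ 2 / (2 * c) * d ^ 2 := by gcongr
    linarith
  have h2 : q * U * v * Q ≤ m ^ 2 * R ^ 2 * (v ^ 2 * r) := by
    calc q * U * v * Q = (q * r * v ^ 2) * Q := by rw [hU]; ring
      _ ≤ (q * r * v ^ 2) * (m * R * r) := by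
        gcongr; exact (le_abs_self _).trans hQ
      _ ≤ (m * R * v ^ 2) * (m * R * r) := by gcongr
      _ = _ := by ring
  have h3 : q * σ * U ^ 2 ≤ m ^ 2 * D := by
    calc _ ≤ m * m * D := by gcongr
      _ = _ := by ring
  have h4 : c / 2 * e ^ 2 - K ^ 2 / (2 * c) * d ^ 2 - m ^ 2 * D ≤ -((k * d - PP) - q * U ^ 2) * e - q ^ 2 * U ^ 2 := by
    have : q * U ^ 2 * e - q ^ 2 * U ^ 2 = - (q * σ * U ^ 2) := by rw [he]; ring
    nlinarith
  nlinarith [mul_le_mul_of_nonneg_right h4 hr]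

theorem lyap2 (h : Ev μ β γ R σ m ρ u V) : ∃ H E, Lyap H (aa R σ ρ u V) E := by
  obtain ⟨H, E, hH1, hH2, hH3⟩ := h.lyap
  obtain ⟨E', hE'⟩ := h.kin
  have S := h.S
  have hR := S.hR
  have hm := h.hm
  have c1 := S.sρ.cont
  have c2 := S.su.cont
  have c3 := S.sd.cont
  have c4 := S.sV.cont
  have c5 := h.sq.cont
  have c6 := S.sF.cont
  set c := σ ^ (γ - 1) with hc
  have hc0 : 0 < c := Real.rpow_pos_of_pos h.σ0 _
  set K := 2 * μ + m ^ β with hK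
  set C1 := K ^ 2 / (2 * c) + m ^ 2 * (R ^ 2 / 2) + m ^ 2 * R ^ 2 with hC1
  have hC1p : 0 ≤ C1 := by positivity
  set G := I R (fun x => ρ x * u x * qf σ ρ x) with hG
  have dG : ∀ t, 0 < t → ∃ g', HasDerivAt G g' t ∧ c / 2 * Y R σ ρ t - C1 * Sol.Dd R u V t ≤ g' := by
    intro t ht
    refine ⟨_, h.bal_q ht, ?_⟩
    have hV := S.V_le ht.le
    have e : c / 2 * Y R σ ρ t - K ^ 2 / (2 * c) * Sol.Dd R u V t - m ^ 2 * Sol.Dd R u V t * (R ^ 2 / 2)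
        - m ^ 2 * R ^ 2 * I R (fun x => V x ^ 2 * x.1) t = I R (fun x => c / 2 * ((ρ x - σ) ^ 2 * x.1)
        - K ^ 2 / (2 * c) * (dv u V x ^ 2 * x.1) - m ^ 2 * Sol.Dd R u V t * x.1 - m ^ 2 * R ^ 2 * (V x ^ 2 * x.1)) t := by
      rw [I_sub hR (by fun_prop) (by fun_prop) ht.le, I_sub hR (by fun_prop) (by fun_prop) ht.le,
        I_sub hR (by fun_prop) (by fun_prop) ht.le, I_mul, I_mul, I_mul, I_mul, I_id]; rfl
    calc _ ≤ c / 2 * Y R σ ρ t - K ^ 2 / (2 * c) * Sol.Dd R u V t - m ^ 2 * Sol.Dd R u V t * (R ^ 2 / 2)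
        - m ^ 2 * R ^ 2 * I R (fun x => V x ^ 2 * x.1) t := by
          rw [hC1]; nlinarith [mul_le_mul_of_nonneg_left hV (by positivity : 0 ≤ m ^ 2 * R ^ 2)]
      _ ≤ _ := by
          rw [e]
          refine I_mono hR (by fun_prop) (by fun_prop) ht.le fun r hr => ?_
          have hk : (r, t) ∈ Kc R := ⟨hr, ht.le⟩
          have := alg_q (c := c) (k := 2 * μ + ρ (r,t) ^ β) (K := K) (e := ρ (r,t) - σ) (d := dv u V (r,t)) (PP := ρ (r,t) ^ γ - σ ^ γ)
            (q := ρ (r,t)) (σ := σ) (U := u (r,t)) (v := V (r,t)) (Q := qf σ ρ (r,t)) (r := r) (D := Sol.Dd R u V t) (m := m) (R := R)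
            hc0 (by linarith [(h.kap hk).1, S.hμ]) (h.kap hk).2 (p_lower S.hγ (S.pos _ hk) h.σ0) (S.pos _ hk).le (h.bd _ hk) h.σ0.le h.σm
            hr.1 hr.2 (S.uV _ hk) (S.u_le ht.le hr) (h.q_le hk) rfl
          simp only [Fx]
          refine this.trans (le_of_eq ?_)
          ring
  have bG : ∀ t, 0 ≤ t → |G t| ≤ m * R / 2 * (E' + σ * (R ^ 2 / 2)) := by
    intro t ht
    have k1 : ContinuousOn (fun x => ρ x * u x ^ 2 * x.1) (Kc R) := by fun_prop
    have k2 : ContinuousOn (fun x => ρ x * x.1) (Kc R) := by fun_prop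
    calc _ ≤ I R (fun x => |ρ x * u x * qf σ ρ x|) t := intervalIntegral.abs_integral_le_integral_abs hR.le
      _ ≤ I R (fun x => (m * R / 2) * (ρ x * u x ^ 2 * x.1 + ρ x * x.1)) t := by
          refine I_mono hR (by fun_prop) (by fun_prop) ht fun r hr => ?_
          have hk : (r, t) ∈ Kc R := ⟨hr, ht⟩
          have hp := S.pos (r,t) hk
          have h0 := hr.1
          simp only
          rw [abs_mul, abs_mul, abs_of_pos hp]
          have a1 : |u (r,t)| ≤ 1/2 * (u (r,t) ^ 2 + 1) := by
            nlinarith [sq_abs (u (r,t)), sq_nonneg (|u (r,t)| - 1)]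
          calc ρ (r,t) * |u (r,t)| * |qf σ ρ (r,t)| ≤ ρ (r,t) * (1/2 * (u (r,t) ^ 2 + 1)) * (m * R * r) := by
                gcongr; exact h.q_le hk
            _ = _ := by ring
      _ = (m * R / 2) * (I R (fun x => ρ x * u x ^ 2 * x.1) t + I R (fun x => ρ x * x.1) t) := by
          rw [I_mul, I_add hR k1 k2 ht]
      _ ≤ _ := by
          rw [h.mass t ht]
          have a1 := hE' t ht
          exact mul_le_mul_of_nonneg_left (by linarith) (by positivity)
  refine ⟨fun t => 2 / c * G t + (2 / c * C1 + 1) * H t, 2 / c * (m * R / 2 * (E' + σ * (R ^ 2 / 2))) + (2 / c * C1 + 1) * E, ?_, ?_, ?_⟩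
  · have := I_cont hR ((S.sρ.mul S.su).mul h.sq).cont
    have : ContinuousOn G (Ici 0) := this
    fun_prop
  · intro t ht
    refine (abs_add_le _ _).trans ?_
    rw [abs_mul, abs_mul, abs_of_pos (by positivity : 0 < 2 / c), abs_of_nonneg (by positivity : 0 ≤ 2 / c * C1 + 1)]
    have := bG t ht
    have := hH2 t ht
    gcongr
  · intro t ht
    obtain ⟨g', hg, hg'⟩ := dG t ht
    obtain ⟨h', hh, hh'⟩ := hH3 t ht
    refine ⟨_, (hg.const_mul _).fun_add (hh.const_mul _), ?_⟩
    have a1 := mul_le_mul_of_nonneg_left hg' (by positivity : 0 ≤ 2 / c)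
    have a2 := mul_le_mul_of_nonneg_left hh' (by positivity : 0 ≤ 2 / c * C1 + 1)
    have a3 : 2 / c * (c / 2 * Y R σ ρ t - C1 * Sol.Dd R u V t) = Y R σ ρ t - 2 / c * C1 * Sol.Dd R u V t := by
      field_simp
    unfold aa
    linarith

end Ev

theorem gronwall {f a H : ℝ → ℝ} {E C : ℝ} (hf : ContinuousOn f (Ici 0)) (h0 : ∀ t, 0 ≤ t → 0 ≤ f t) (hC : 0 ≤ C)
    (hd : ∀ t, 0 < t → ∃ f', HasDerivAt f f' t ∧ f' ≤ C * (a t * (1 + f t))) (hL : Lyap H a E) :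
    ∃ M, 0 < M ∧ ∀ t, 0 ≤ t → f t ≤ M := by
  obtain ⟨hH1, hH2, hH3⟩ := hL
  refine ⟨Real.exp (Real.log (1 + f 0) + 2 * C * E), Real.exp_pos _, fun t ht => ?_⟩
  have hp : ∀ s, 0 ≤ s → 0 < 1 + f s := fun s hs => by have := h0 s hs; linarith
  have hsub : Icc 0 t ⊆ Ici (0:ℝ) := Icc_subset_Ici_self
  have := le_of_deriv_nonpos (f := fun s => Real.log (1 + f s) - C * H s) ht
    (((continuousOn_const.add (hf.mono hsub)).log (fun s hs => (hp s hs.1).ne')).sub (continuousOn_const.mul (hH1.mono hsub)))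
    (fun s hs => by
      obtain ⟨f', e1, e2⟩ := hd s hs.1
      obtain ⟨h', e3, e4⟩ := hH3 s hs.1
      refine ⟨_, ((e1.const_add 1).log (hp s hs.1.le).ne').fun_sub (e3.const_mul C), ?_⟩
      have p := hp s hs.1.le
      have : f' / (1 + f s) ≤ C * a s := by
        rw [div_le_iff₀ p]; linarith
      have := mul_le_mul_of_nonneg_left e4 hC
      linarith)
  have b1 := abs_le.1 (hH2 t ht)
  have b2 := abs_le.1 (hH2 0 le_rfl)
  have l1 : Real.log (1 + f t) ≤ Real.log (1 + f 0) + 2 * C * E := by nlinarith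
  have := (Real.log_le_iff_le_exp (hp t ht)).1 l1
  linarith

theorem decay {f a H : ℝ → ℝ} {E C : ℝ} (hf : ContinuousOn f (Ici 0)) (h0 : ∀ t, 0 ≤ t → 0 ≤ f t) (hC : 0 ≤ C)
    (ha : ∀ t, 0 ≤ t → 0 ≤ a t) (hfa : ∀ t, 0 ≤ t → f t ≤ C * a t)
    (hd : ∀ t, 0 < t → ∃ f', HasDerivAt f f' t ∧ f' ≤ C * a t) (hL : Lyap H a E) :
    Tendsto f atTop (𝓝 0) := by
  obtain ⟨hH1, hH2, hH3⟩ := hL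
  have mono : ∀ s t, 0 ≤ s → s ≤ t → H s ≤ H t := by
    intro s t hs hst
    have hsub : Icc s t ⊆ Ici (0:ℝ) := fun x hx => hs.trans hx.1
    have := le_of_deriv_nonpos (f := fun s => - H s) hst (hH1.mono hsub).neg (fun x hx => by
      obtain ⟨h', e3, e4⟩ := hH3 x (hs.trans_lt hx.1)
      exact ⟨_, e3.fun_neg, by have := ha x (hs.trans hx.1.le); linarith⟩)
    linarith
  -- limit of H
  have hmono : Monotone (fun t => H (max t 0)) := fun s t hst => mono _ _ (le_max_right _ _) (max_le_max_right 0 hst)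
  have hbdd : BddAbove (range (fun t => H (max t 0))) := ⟨E, by
    rintro _ ⟨t, rfl⟩
    exact (abs_le.1 (hH2 _ (le_max_right _ _))).2⟩
  have lim := tendsto_atTop_ciSup hmono hbdd
  have lim2 := lim.comp (tendsto_atTop_add_const_right atTop (-1:ℝ) tendsto_id)
  have lim3 := (lim.sub lim2).const_mul (2 * C)
  rw [sub_self, mul_zero] at lim3
  refine tendsto_of_tendsto_of_tendsto_of_le_of_le' tendsto_const_nhds lim3 ?_ ?_
  · filter_upwards [eventually_ge_atTop 0] with t ht using h0 t ht
  · filter_upwards [eventually_ge_atTop 2] with t ht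
    simp only [Function.comp, id]
    rw [max_eq_left (by linarith), max_eq_left (by linarith : 0 ≤ t + -1)]
    have ht1 : (0:ℝ) ≤ t - 1 := by linarith
    have hs1 : t - 1 + 1 = t := by ring
    obtain ⟨c, hc, hcd⟩ := exists_deriv_eq_diff (f := H) (a := t - 1)
      (hH1.mono fun x hx => ht1.trans hx.1) (fun x hx => by
        obtain ⟨h', e3, e4⟩ := hH3 x (ht1.trans_lt hx.1)
        exact ⟨_, e3⟩)
    rw [hs1] at hc hcd
    have hc0 : 0 < c := ht1.trans_lt hc.1
    obtain ⟨h', e3, e4⟩ := hH3 c hc0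
    have e5 := e3.unique hcd
    have := le_of_deriv_nonpos (f := fun s => f s - C * H s) hc.2.le
      ((hf.mono fun x hx => hc0.le.trans hx.1).sub (continuousOn_const.mul (hH1.mono fun x hx => hc0.le.trans hx.1)))
      (fun x hx => by
        obtain ⟨f', a1, a2⟩ := hd x (hc0.trans hx.1)
        obtain ⟨h', a3, a4⟩ := hH3 x (hc0.trans hx.1)
        exact ⟨_, a1.fun_sub (a3.const_mul C), by have := mul_le_mul_of_nonneg_left a4 hC; linarith⟩)
    have m1 := mono (t - 1) c ht1 hc.1.le
    have m2 := hfa c hc0.le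
    have m3 : a c ≤ H t - H (t - 1) := by rw [← e5]; exact e4
    have m4 := mul_le_mul_of_nonneg_left m3 hC
    have m5 := mul_le_mul_of_nonneg_left m1 hC
    have : t + -1 = t - 1 := by ring
    rw [this]
    linarith
end NS
end

section
open scoped ContDiff Topology
namespace NS

/-- Ladyzhenskaya type inequality in radial variables -/
theorem lady {R : ℝ} {f : ℝ × ℝ → ℝ} (hR : 0 < R) (hf : Sm R f) {t : ℝ} (ht : 0 ≤ t) :
    (∃ w, 0 ≤ w ∧ w ^ 2 ≤ I R (fun x => f x ^ 2 * x.1) t * I R (fun x => dr f x ^ 2 * x.1) t ∧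
      R ^ 2 * f (R, t) ^ 2 ≤ 2 * I R (fun x => f x ^ 2 * x.1) t + 2 * R * w ∧
      I R (fun x => f x ^ 4 * x.1) t ≤ ((2 / R) * I R (fun x => f x ^ 2 * x.1) t + 6 * w) ^ 2) := by
  have c1 := hf.cont
  have c2 := hf.dr.cont
  set A := I R (fun x => f x ^ 2 * x.1) t with hA
  set w := I R (fun x => |f x| * |dr f x| * x.1) t with hw
  have hw0 : 0 ≤ w := I_nonneg hR fun r hr => by have := hr.1; simp only; positivity
  have hw2 : w ^ 2 ≤ A * I R (fun x => dr f x ^ 2 * x.1) t := by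
    have := I_CSw (f := fun x => |f x|) (g := fun x => |dr f x|) (w := fun x => x.1) hR (by fun_prop) (by fun_prop) (by fun_prop) ht (fun r hr => hr.1)
    simpa only [sq_abs] using this
  have hA0 : 0 ≤ A := I_nonneg hR fun r hr => mul_nonneg (sq_nonneg _) hr.1
  have hbd : ∀ r, |f r * dr f r| = |f r| * |dr f r| := fun r => abs_mul _ _
  -- boundary value
  have b1 : R ^ 2 * f (R, t) ^ 2 ≤ 2 * A + 2 * R * w := by
    have s1 : Sm R (fun x => x.1 ^ 2 * f x ^ 2) := (Sm.fst.pow 2).mul (hf.pow 2)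
    have e := I_dr hR s1 ht
    simp only [ne_eq, OfNat.ofNat_ne_zero, not_false_eq_true, zero_pow, zero_mul, sub_zero] at e
    rw [← e, hA, hw, ← I_mul, ← I_mul, ← I_add hR (by fun_prop) (by fun_prop) ht]
    refine I_mono hR s1.dr.cont (by fun_prop) ht fun r hr => ?_
    have hk : (r, t) ∈ Kc R := ⟨hr, ht⟩
    have := (s1.hr hk).unique (((hasDerivAt_id' r).fun_pow 2).fun_mul ((hf.hr hk).fun_pow 2))
    rw [this]
    have h0 := hr.1
    have h1 := le_abs_self (f (r,t) * dr f (r,t))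
    rw [hbd] at h1
    have h2 : r ^ 2 * (f (r,t) * dr f (r,t)) ≤ R * r * (|f (r,t)| * |dr f (r,t)|) := by
      calc _ ≤ r ^ 2 * (|f (r,t)| * |dr f (r,t)|) := by gcongr
        _ = r * r * (|f (r,t)| * |dr f (r,t)|) := by ring
        _ ≤ _ := by gcongr; exact hr.2
    push_cast
    nlinarith
  -- unweighted integral
  have b2 : I R (fun x => f x ^ 2) t ≤ (2 / R) * A + 4 * w := by
    have s1 : Sm R (fun x => x.1 * f x ^ 2) := Sm.fst.mul (hf.pow 2)
    have e := I_dr hR s1 ht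
    simp only [zero_mul, sub_zero] at e
    have e2 : I R (fun x => f x ^ 2) t ≤ R * f (R,t) ^ 2 + 2 * w := by
      rw [← e, hw, ← I_mul, ← I_add hR s1.dr.cont (by fun_prop) ht]
      refine I_mono hR (by fun_prop) (kad s1.dr.cont (by fun_prop)) ht fun r hr => ?_
      have hk : (r, t) ∈ Kc R := ⟨hr, ht⟩
      have := (s1.hr hk).unique ((hasDerivAt_id' r).fun_mul ((hf.hr hk).fun_pow 2))
      rw [this]
      have h1 := neg_abs_le (f (r,t) * dr f (r,t))
      rw [hbd] at h1
      have := mul_le_mul_of_nonneg_left h1 hr.1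
      push_cast
      nlinarith
    have e3 : R * f (R,t) ^ 2 ≤ (2 / R) * A + 2 * w := by
      have : (2 / R) * A + 2 * w = (2 * A + 2 * R * w) / R := by field_simp
      rw [this, le_div_iff₀ hR]; linarith
    linarith
  have b3 : ∀ r ∈ Icc 0 R, r * f (r, t) ^ 2 ≤ (2 / R) * A + 6 * w := by
    intro r hr
    have s1 : Sm R (fun x => x.1 * f x ^ 2) := Sm.fst.mul (hf.pow 2)
    have hcont : ContinuousOn (fun x => f x ^ 2 + 2 * (|f x| * |dr f x| * x.1)) (Kc R) := by fun_prop
    have hsub : Icc 0 r ⊆ Icc 0 R := Icc_subset_Icc_right hr.2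
    have i1 : IntervalIntegrable (fun s => dr (fun x => x.1 * f x ^ 2) (s, t)) volume 0 r :=
      ((s1.dr.cr ht).mono (by rw [uIcc_of_le hr.1]; exact hsub)).intervalIntegrable
    have i2 : IntervalIntegrable (fun s => f (s,t) ^ 2 + 2 * (|f (s,t)| * |dr f (s,t)| * s)) volume 0 r :=
      ((hcont.cr ht).mono (by rw [uIcc_of_le hr.1]; exact hsub)).intervalIntegrable
    have e1 : ∫ s in (0:ℝ)..r, dr (fun x => x.1 * f x ^ 2) (s, t) = r * f (r, t) ^ 2 := by
      rw [intervalIntegral.integral_eq_sub_of_hasDerivAt (f := fun s => s * f (s, t) ^ 2) (fun s hs => ?_) i1]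
      · simp
      · rw [uIcc_of_le hr.1] at hs
        exact s1.hr ⟨hsub hs, ht⟩
    rw [← e1]
    calc _ ≤ ∫ s in (0:ℝ)..r, (f (s,t) ^ 2 + 2 * (|f (s,t)| * |dr f (s,t)| * s)) := by
          refine intervalIntegral.integral_mono_on hr.1 i1 i2 fun s hs => ?_
          have hk : (s, t) ∈ Kc R := ⟨hsub hs, ht⟩
          have := (s1.hr hk).unique ((hasDerivAt_id' s).fun_mul ((hf.hr hk).fun_pow 2))
          rw [this]
          have h1 := le_abs_self (f (s,t) * dr f (s,t))
          rw [hbd] at h1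
          have := mul_le_mul_of_nonneg_left h1 hs.1
          push_cast
          nlinarith
      _ ≤ I R (fun x => f x ^ 2 + 2 * (|f x| * |dr f x| * x.1)) t := by
          refine intervalIntegral.integral_mono_interval le_rfl hr.1 hr.2 ?_ (ii hR hcont ht)
          refine (ae_restrict_iff' measurableSet_Ioc).2 (Eventually.of_forall fun s hs => ?_)
          have : 0 ≤ s := hs.1.le
          simp only [Pi.zero_apply]; positivity
      _ = I R (fun x => f x ^ 2) t + 2 * w := by
          rw [I_add hR (by fun_prop) (by fun_prop) ht, I_mul]
      _ ≤ _ := by linarith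
  refine ⟨w, hw0, hw2, b1, ?_⟩
  have hp : 0 ≤ (2 / R) * A + 6 * w := by positivity
  calc I R (fun x => f x ^ 4 * x.1) t ≤ I R (fun x => ((2 / R) * A + 6 * w) * f x ^ 2) t := by
        refine I_mono hR (by fun_prop) (by fun_prop) ht fun r hr => ?_
        have := mul_le_mul_of_nonneg_right (b3 r hr) (sq_nonneg (f (r,t)))
        simp only
        nlinarith
    _ ≤ _ := by
        rw [I_mul, pow_two]
        exact mul_le_mul_of_nonneg_left (by linarith) hp

namespace Sol
variable {μ β γ R : ℝ} {ρ u V : ℝ × ℝ → ℝ}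
/-- acceleration -/
def ac (u : ℝ × ℝ → ℝ) (x : ℝ × ℝ) : ℝ := dt u x + u x * dr u x
/-- acceleration divided by the radius -/
def Wf (u V : ℝ × ℝ → ℝ) (x : ℝ × ℝ) : ℝ := dt V x + V x * dr u x
theorem s_ac (S : Sol μ β γ R ρ u V) : Sm R (ac u) := S.su.dt.add (S.su.mul S.su.dr)
theorem s_W (S : Sol μ β γ R ρ u V) : Sm R (Wf u V) := S.sV.dt.add (S.sV.mul S.su.dr)
theorem acW (S : Sol μ β γ R ρ u V) {x} (hx : x ∈ Kc R) : ac u x = x.1 * Wf u V x := by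
  rw [ac, Wf, S.dtV x hx, S.uV x hx]; ring
theorem ac_R (S : Sol μ β γ R ρ u V) {t : ℝ} (ht : 0 < t) : ac u (R, t) = 0 := by
  have hk : (R, t) ∈ Kc R := ⟨⟨S.hR.le, le_rfl⟩, ht.le⟩
  have : dt u (R, t) = 0 := by
    have h1 := S.su.ht hk
    have h2 : (fun s => u (R, s)) =ᶠ[𝓝 t] fun _ => 0 := by
      filter_upwards [Ioi_mem_nhds ht] with s hs using S.uR s (le_of_lt hs)
    exact h1.unique ((hasDerivAt_const t (0:ℝ)).congr_of_eventuallyEq h2)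
  rw [ac, this, S.uR t ht.le]; ring
theorem ac_0 (S : Sol μ β γ R ρ u V) {t : ℝ} (ht : 0 ≤ t) : ac u (0, t) = 0 := by
  rw [S.acW (⟨⟨le_rfl, S.hR.le⟩, ht⟩ : ((0:ℝ), t) ∈ Kc R)]; simp

theorem d_mat (S : Sol μ β γ R ρ u V) {r t : ℝ} (hk : (r, t) ∈ Kc R) :
    dt (dv u V) (r, t) = dr (ac u) (r, t) + Wf u V (r, t) - dr u (r, t) ^ 2 - V (r, t) ^ 2 - u (r, t) * dr (dv u V) (r, t) := by
  have e1 := (S.sd.ht hk).unique ((S.su.dr.ht hk).fun_add (S.sV.ht hk))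
  have e2 := (S.sd.hr hk).unique ((S.su.dr.hr hk).fun_add (S.sV.hr hk))
  have e3 := (S.s_ac.hr hk).unique ((S.su.dt.hr hk).fun_add ((S.su.hr hk).fun_mul (S.su.dr.hr hk)))
  have e4 := S.drV _ hk
  have e5 := S.uV _ hk
  rw [e1, e2, e3, S.su.symm hk, Wf, e5]
  simp only at e4 ⊢
  linear_combination (- V (r,t)) * e4

end Sol

namespace Ev
variable {μ β γ R σ m : ℝ} {ρ u V : ℝ × ℝ → ℝ}
open Sol

/-- pressure fluctuation -/
def pf (γ σ : ℝ) (ρ : ℝ × ℝ → ℝ) (x : ℝ × ℝ) : ℝ := ρ x ^ γ - σ ^ γ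
theorem s_pf (h : Ev μ β γ R σ m ρ u V) : Sm R (pf γ σ ρ) := (h.S.sp γ).sub (Sm.const _)
/-- viscosity coefficient -/
def kf (μ β : ℝ) (ρ : ℝ × ℝ → ℝ) (x : ℝ × ℝ) : ℝ := 2 * μ + ρ x ^ β
theorem s_kf (h : Ev μ β γ R σ m ρ u V) : Sm R (kf μ β ρ) := (Sm.const _).add (h.S.sp β)
/-- effective flux -/
def Ph (μ β γ σ : ℝ) (ρ u V : ℝ × ℝ → ℝ) (x : ℝ × ℝ) : ℝ := kf μ β ρ x * dv u V x - pf γ σ ρ x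
theorem s_Ph (h : Ev μ β γ R σ m ρ u V) : Sm R (Ph μ β γ σ ρ u V) := (h.s_kf.mul h.S.sd).sub h.s_pf

theorem dr_Ph (h : Ev μ β γ R σ m ρ u V) {x} (hx : x ∈ Kc R) : dr (Ph μ β γ σ ρ u V) x = ρ x * ac u x := by
  obtain ⟨r, t⟩ := x
  have := (h.S.sF.hr hx).add_const (σ ^ γ)
  rw [h.S.mom _ hx] at this
  refine ((h.s_Ph.hr hx).congr_of_eventuallyEq ?_).unique this
  refine Eventually.of_forall fun s => ?_
  simp only [Ph, Fx, kf, pf]; ring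

theorem k_mat (h : Ev μ β γ R σ m ρ u V) {r t : ℝ} (hk : (r, t) ∈ Kc R) :
    dt (kf μ β ρ) (r, t) = - β * ρ (r,t) ^ β * dv u V (r,t) - u (r, t) * dr (kf μ β ρ) (r, t) := by
  have e1 := (h.s_kf.ht hk).unique ((h.S.pt β hk).const_add (2 * μ))
  have e2 := (h.s_kf.hr hk).unique ((h.S.pr β hk).const_add (2 * μ))
  have e3 := h.S.mass _ hk
  have e4 := h.S.pe β hk
  rw [e1, e2, e3, e4]; ring
theorem p_mat (h : Ev μ β γ R σ m ρ u V) {r t : ℝ} (hk : (r, t) ∈ Kc R) :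
    dt (pf γ σ ρ) (r, t) = - γ * ρ (r,t) ^ γ * dv u V (r,t) - u (r, t) * dr (pf γ σ ρ) (r, t) := by
  have e1 := (h.s_pf.ht hk).unique ((h.S.pt γ hk).sub_const (σ ^ γ))
  have e2 := (h.s_pf.hr hk).unique ((h.S.pr γ hk).sub_const (σ ^ γ))
  have e3 := h.S.mass _ hk
  have e4 := h.S.pe γ hk
  rw [e1, e2, e3, e4]; ring

set_option maxHeartbeats 800000 in
theorem bal_B (h : Ev μ β γ R σ m ρ u V) {t : ℝ} (ht : 0 < t) :
    HasDerivAt (I R (fun x => (1/2 * kf μ β ρ x * dv u V x ^ 2 - pf γ σ ρ x * dv u V x) * x.1))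
      (I R (fun x => - (ρ x * ac u x ^ 2 * x.1) - ρ x * ac u x * u x * V x * x.1
        + (- (Ph μ β γ σ ρ u V x * dv u V x ^ 2) - 1/2 * β * ρ x ^ β * dv u V x ^ 3 + γ * ρ x ^ γ * dv u V x ^ 2
          + 1/2 * kf μ β ρ x * dv u V x ^ 3 - pf γ σ ρ x * dv u V x ^ 2) * x.1) t) t := by
  have S := h.S
  have c1 := S.sρ.cont
  have c2 := S.su.cont
  have c3 := S.sd.cont
  have c4 := S.sV.cont
  have c5 := h.s_kf.cont
  have c6 := h.s_pf.cont
  have c7 := h.s_Ph.cont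
  have c8 := S.s_ac.cont
  have c9 := (S.sp β).cont
  have c10 := (S.sp γ).cont
  have sG : Sm R (fun x => 1/2 * kf μ β ρ x * dv u V x ^ 2 - pf γ σ ρ x * dv u V x) :=
    (((Sm.const (1/2)).mul h.s_kf).mul (S.sd.pow 2)).sub (h.s_pf.mul S.sd)
  have key : ∀ L P : ℝ × ℝ → ℝ, ContinuousOn L (Kc R) → ContinuousOn P (Kc R) → ContinuousOn
      (fun x => - (ρ x * ac u x ^ 2 * x.1) - ρ x * ac u x * u x * V x * x.1
        + (- (Ph μ β γ σ ρ u V x * dv u V x ^ 2) - 1/2 * β * L x * dv u V x ^ 3 + γ * P x * dv u V x ^ 2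
          + 1/2 * kf μ β ρ x * dv u V x ^ 3 - pf γ σ ρ x * dv u V x ^ 2) * x.1) (Kc R) := by intros; fun_prop
  have := balance S.hR (sG.mul Sm.fst) (((((S.su.mul sG).mul Sm.fst).neg).add ((h.s_Ph.mul S.s_ac).mul Sm.fst)).add (h.s_Ph.mul (S.su.pow 2)))
    (key _ _ c9 c10) ?_ ht
  · simpa [S.uR t ht.le, S.u0 ht.le, S.ac_R ht] using this
  · intro r t hx
    have hk := Oc_sub R hx
    refine ⟨_, _, ((((h.s_kf.ht hk).const_mul (1/2)).fun_mul ((S.sd.ht hk).fun_pow 2)).fun_sub ((h.s_pf.ht hk).fun_mul (S.sd.ht hk))).mul_const r,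
      ((((S.su.hr hk).fun_mul ((((h.s_kf.hr hk).const_mul (1/2)).fun_mul ((S.sd.hr hk).fun_pow 2)).fun_sub ((h.s_pf.hr hk).fun_mul (S.sd.hr hk)))).fun_mul (hasDerivAt_id' r)).fun_neg.fun_add
        (((h.s_Ph.hr hk).fun_mul (S.s_ac.hr hk)).fun_mul (hasDerivAt_id' r))).fun_add ((h.s_Ph.hr hk).fun_mul ((S.su.hr hk).fun_pow 2)), ?_⟩
    have e1 := S.uV _ hk
    have e2 := S.acW hk
    simp only at e1 e2
    rw [h.k_mat hk, h.p_mat hk, S.d_mat hk, h.dr_Ph hk]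
    have e3 : dr u (r, t) = dv u V (r,t) - V (r,t) := by simp [dv]
    rw [e3, e2, e1]
    simp only [Ph]
    push_cast
    ring
end Ev
end NS
end

section
open scoped ContDiff Topology
namespace NS
namespace Ev
variable {μ β γ R σ m : ℝ} {ρ u V : ℝ × ℝ → ℝ}
open Sol

def X (R : ℝ) (ρ u : ℝ × ℝ → ℝ) : ℝ → ℝ := I R (fun x => ρ x * ac u x ^ 2 * x.1)

theorem X_nonneg (h : Ev μ β γ R σ m ρ u V) {t : ℝ} (ht : 0 ≤ t) : 0 ≤ X R ρ u t :=
  I_nonneg h.S.hR fun r hr => mul_nonneg (mul_nonneg (h.S.pos (r, t) ⟨hr, ht⟩).le (sq_nonneg _)) hr.1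

theorem pf_le (h : Ev μ β γ R σ m ρ u V) {x} (hx : x ∈ Kc R) :
    pf γ σ ρ x ^ 2 ≤ (γ * m ^ (γ - 1)) ^ 2 * (ρ x - σ) ^ 2 := by
  have := p_upper h.S.hγ (h.S.pos x hx) h.σ0 (h.bd x hx) h.σm
  rw [← mul_pow, sq_le_sq, abs_mul, abs_of_nonneg (a := γ * m ^ (γ - 1))]
  · exact this
  · have := h.S.hγ; have := h.hm; positivity

theorem kd_cont (h : Ev μ β γ R σ m ρ u V) {f : ℝ × ℝ → ℝ} (hf : f = fun x => (ρ x - σ) ^ 2 * x.1) : ContinuousOn f (Kc R) := by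
  have c1 := h.S.sρ.cont
  rw [hf]; fun_prop

theorem A_le (h : Ev μ β γ R σ m ρ u V) : ∃ C, 0 < C ∧ ∀ t, 0 ≤ t →
    I R (fun x => Ph μ β γ σ ρ u V x ^ 2 * x.1) t ≤ C * aa R σ ρ u V t := by
  have hm := h.hm
  have hμ := h.S.hμ
  have hγ := h.S.hγ
  have hR := h.S.hR
  have c1 := h.S.sρ.cont
  have c2 := h.S.sd.cont
  have c3 := h.s_Ph.cont
  set K := 2 * μ + m ^ β
  set L := γ * m ^ (γ - 1)
  have hK : 0 < K := by positivity
  have hL : 0 < L := by positivity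
  refine ⟨2 * K ^ 2 + 2 * L ^ 2, by positivity, fun t ht => ?_⟩
  unfold aa Dd Y
  rw [← I_add hR (by fun_prop) (by fun_prop) ht, ← I_mul]
  refine I_mono hR (by fun_prop) (by fun_prop) ht fun r hr => ?_
  have hk : (r, t) ∈ Kc R := ⟨hr, ht⟩
  have h1 := h.pf_le hk
  have h2 : (kf μ β ρ (r,t) * dv u V (r,t)) ^ 2 ≤ K ^ 2 * dv u V (r,t) ^ 2 := by
    rw [mul_pow]
    have := (h.kap hk).1
    have h3 : kf μ β ρ (r,t) ≤ K := (h.kap hk).2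
    have h4 : 0 ≤ kf μ β ρ (r,t) := by unfold kf; linarith
    gcongr
  have h3 : Ph μ β γ σ ρ u V (r,t) ^ 2 ≤ (2 * K ^ 2 + 2 * L ^ 2) * (dv u V (r,t) ^ 2 + (ρ (r,t) - σ) ^ 2) := by
    unfold Ph
    have : 0 ≤ K ^ 2 * (ρ (r,t) - σ) ^ 2 := by positivity
    have : 0 ≤ L ^ 2 * dv u V (r,t) ^ 2 := by positivity
    nlinarith [sq_nonneg (kf μ β ρ (r,t) * dv u V (r,t) + pf γ σ ρ (r,t))]
  have := mul_le_mul_of_nonneg_right h3 hr.1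
  simp only
  linarith

theorem B_le (h : Ev μ β γ R σ m ρ u V) {t : ℝ} (ht : 0 ≤ t) :
    I R (fun x => dr (Ph μ β γ σ ρ u V) x ^ 2 * x.1) t ≤ m * X R ρ u t := by
  have hR := h.S.hR
  have c1 := h.S.sρ.cont
  have c2 := h.S.s_ac.cont
  have c3 := h.s_Ph.dr.cont
  unfold X
  rw [← I_mul]
  refine I_mono hR (by fun_prop) (by fun_prop) ht fun r hr => ?_
  have hk : (r, t) ∈ Kc R := ⟨hr, ht⟩
  simp only
  rw [h.dr_Ph hk]
  have h1 := h.bd _ hk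
  have h2 := h.S.pos _ hk
  have h0 := hr.1
  calc (ρ (r,t) * ac u (r,t)) ^ 2 * r = ρ (r,t) * (ρ (r,t) * ac u (r,t) ^ 2 * r) := by ring
    _ ≤ _ := by gcongr

theorem d4_le (h : Ev μ β γ R σ m ρ u V) : ∃ C, 0 < C ∧ ∀ t, 0 ≤ t →
    I R (fun x => dv u V x ^ 4 * x.1) t ≤ C * (aa R σ ρ u V t * (1 + aa R σ ρ u V t + X R ρ u t)) := by
  obtain ⟨C, hC, hA⟩ := h.A_le
  have hm := h.hm
  have hμ := h.S.hμ
  have hγ := h.S.hγ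
  have hR := h.S.hR
  have c1 := h.S.sρ.cont
  have c2 := h.S.sd.cont
  have c3 := h.s_Ph.cont
  set L := γ * m ^ (γ - 1) with hL'
  have hL : 0 < L := by positivity
  set c := (2 * μ) ^ 4 with hc
  have hc0 : 0 < c := by positivity
  refine ⟨8 / c * ((8 / R ^ 2) * C ^ 2 + 72 * C * m + L ^ 4 * m ^ 2), by positivity, fun t ht => ?_⟩
  set a := aa R σ ρ u V t with ha
  have ha0 : 0 ≤ a := h.a_nonneg
  have hX0 : 0 ≤ X R ρ u t := h.X_nonneg ht
  obtain ⟨w, w0, w1, -, w2⟩ := lady hR h.s_Ph ht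
  have hA' := hA t ht
  have hB' := h.B_le ht
  set A := I R (fun x => Ph μ β γ σ ρ u V x ^ 2 * x.1) t with hAd
  have hA0 : 0 ≤ A := I_nonneg hR fun r hr => mul_nonneg (sq_nonneg _) hr.1
  have w3 : w ^ 2 ≤ (C * a) * (m * X R ρ u t) := by
    refine w1.trans ?_
    have : 0 ≤ C * a := by positivity
    exact mul_le_mul hA' hB' (I_nonneg hR fun r hr => mul_nonneg (sq_nonneg _) hr.1) this
  have w4 : I R (fun x => Ph μ β γ σ ρ u V x ^ 4 * x.1) t ≤ (8 / R ^ 2) * (C * a) ^ 2 + 72 * (C * a * (m * X R ρ u t)) := by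
    have e1 : ((2 / R) * A + 6 * w) ^ 2 ≤ 8 / R ^ 2 * A ^ 2 + 72 * w ^ 2 := by
      have : 8 / R ^ 2 * A ^ 2 = 2 * ((2 / R) * A) ^ 2 := by field_simp; ring
      rw [this]
      nlinarith [sq_nonneg ((2 / R) * A - 6 * w)]
    have e2 : 8 / R ^ 2 * A ^ 2 ≤ 8 / R ^ 2 * (C * a) ^ 2 := by gcongr
    linarith
  have w5 : I R (fun x => dv u V x ^ 4 * x.1) t ≤ 8 / c * (I R (fun x => Ph μ β γ σ ρ u V x ^ 4 * x.1) t + L ^ 4 * m ^ 2 * Y R σ ρ t) := by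
    unfold Y
    rw [← I_mul, ← I_add hR (by fun_prop) (by fun_prop) ht, ← I_mul]
    refine I_mono hR (by fun_prop) (by fun_prop) ht fun r hr => ?_
    have hk : (r, t) ∈ Kc R := ⟨hr, ht⟩
    have h1 := h.pf_le hk
    have h0 := hr.1
    have h2 : pf γ σ ρ (r,t) ^ 4 ≤ L ^ 4 * m ^ 2 * (ρ (r,t) - σ) ^ 2 := by
      have e1 : (ρ (r,t) - σ) ^ 2 ≤ m ^ 2 := sq_le_sq' (by linarith [(abs_le.1 (h.fl hk)).1]) (abs_le.1 (h.fl hk)).2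
      calc pf γ σ ρ (r,t) ^ 4 = (pf γ σ ρ (r,t) ^ 2) ^ 2 := by ring
        _ ≤ (L ^ 2 * (ρ (r,t) - σ) ^ 2) ^ 2 := by gcongr
        _ = L ^ 4 * (ρ (r,t) - σ) ^ 2 * (ρ (r,t) - σ) ^ 2 := by ring
        _ ≤ L ^ 4 * m ^ 2 * (ρ (r,t) - σ) ^ 2 := by gcongr
    have h3 : c * dv u V (r,t) ^ 4 ≤ 8 * (Ph μ β γ σ ρ u V (r,t) ^ 4 + pf γ σ ρ (r,t) ^ 4) := by
      have e1 : c * dv u V (r,t) ^ 4 ≤ (kf μ β ρ (r,t) * dv u V (r,t)) ^ 4 := by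
        rw [mul_pow, hc]
        have : 2 * μ ≤ kf μ β ρ (r,t) := (h.kap hk).1
        gcongr
      have e2 : kf μ β ρ (r,t) * dv u V (r,t) = Ph μ β γ σ ρ u V (r,t) + pf γ σ ρ (r,t) := by unfold Ph; ring
      rw [e2] at e1
      refine e1.trans ?_
      generalize Ph μ β γ σ ρ u V (r,t) = x
      generalize pf γ σ ρ (r,t) = y
      nlinarith [sq_nonneg (x - y), sq_nonneg (x + y), sq_nonneg (x ^ 2 - y ^ 2), mul_nonneg (sq_nonneg (x - y)) (sq_nonneg (x - y)), mul_nonneg (sq_nonneg (x - y)) (sq_nonneg (x + y)), sq_nonneg (x^2 + y^2), mul_nonneg (sq_nonneg (x - y)) (sq_nonneg x), mul_nonneg (sq_nonneg (x - y)) (sq_nonneg y)]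
    have h4 : dv u V (r,t) ^ 4 ≤ 8 / c * (Ph μ β γ σ ρ u V (r,t) ^ 4 + L ^ 4 * m ^ 2 * (ρ (r,t) - σ) ^ 2) := by
      rw [div_mul_eq_mul_div, le_div_iff₀ hc0]; linarith
    have := mul_le_mul_of_nonneg_right h4 h0
    simp only
    linarith
  refine w5.trans ?_
  rw [mul_assoc (8 / c)]
  refine mul_le_mul_of_nonneg_left ?_ (by positivity)
  have hY : Y R σ ρ t ≤ a := by have := h.S.D_nonneg (t := t); rw [ha, aa]; linarith
  have e1 : L ^ 4 * m ^ 2 * Y R σ ρ t ≤ L ^ 4 * m ^ 2 * a := by gcongr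
  have q1 : 0 ≤ 8 / R ^ 2 * C ^ 2 * (a * (1 + X R ρ u t)) := by positivity
  have q2 : 0 ≤ 72 * C * m * (a * (1 + a)) := by positivity
  have q3 : 0 ≤ L ^ 4 * m ^ 2 * (a * (a + X R ρ u t)) := by positivity
  nlinarith

theorem d3_le (h : Ev μ β γ R σ m ρ u V) {ε : ℝ} (hε : 0 < ε) : ∃ C, 0 < C ∧ ∀ t, 0 ≤ t →
    I R (fun x => |dv u V x| ^ 3 * x.1) t ≤ ε * X R ρ u t + C * (aa R σ ρ u V t * (1 + aa R σ ρ u V t)) := by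
  obtain ⟨C, hC, h4⟩ := h.d4_le
  have hR := h.S.hR
  have c2 := h.S.sd.cont
  refine ⟨C / (2 * ε) + C + 1, by positivity, fun t ht => ?_⟩
  have h4' := h4 t ht
  set a := aa R σ ρ u V t with ha
  have ha0 : 0 ≤ a := h.a_nonneg
  have hX0 : 0 ≤ X R ρ u t := h.X_nonneg ht
  set x := X R ρ u t
  have hD : Dd R u V t ≤ a := by have := h.Y_nonneg (t := t); rw [ha, aa]; linarith
  have cs := I_CSw (f := fun x => |dv u V x|) (g := fun x => dv u V x ^ 2) (w := fun x => x.1) hR (by fun_prop) (by fun_prop) (by fun_prop) ht (fun r hr => hr.1)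
  have e1 : I R (fun x => |dv u V x| * dv u V x ^ 2 * x.1) t = I R (fun x => |dv u V x| ^ 3 * x.1) t :=
    I_congr hR fun r _ => by simp only; rw [← sq_abs]; ring
  have e2 : I R (fun x => (dv u V x ^ 2) ^ 2 * x.1) t = I R (fun x => dv u V x ^ 4 * x.1) t :=
    I_congr hR fun r _ => by ring
  simp only [sq_abs] at cs
  rw [e1, e2] at cs
  have cs2 : (I R (fun x => |dv u V x| ^ 3 * x.1) t) ^ 2 ≤ a * (C * (a * (1 + a + x))) :=
    cs.trans (mul_le_mul hD h4' (I_nonneg hR fun r hr => mul_nonneg (Even.pow_nonneg (by decide) _) hr.1) ha0)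
  set K := C / (2 * ε) + C + 1 with hK
  have hK0 : 0 < K := by positivity
  refine abs_le_of_sq_le_sq' ?_ (by positivity) |>.2
  refine cs2.trans ?_
  have k1 : C ≤ 2 * ε * K := by
    have : 2 * ε * K = C + 2 * ε * (C + 1) := by rw [hK]; field_simp; ring
    rw [this]; have : 0 < 2 * ε * (C + 1) := by positivity
    linarith
  have k2 : C ≤ K ^ 2 := by
    have : 0 < C / (2 * ε) := by positivity
    have : C + 1 ≤ K := by rw [hK]; linarith
    nlinarith
  calc a * (C * (a * (1 + a + x))) = C * (a ^ 2 * (1 + a)) + C * (a ^ 2 * x) := by ring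
    _ ≤ K ^ 2 * (a ^ 2 * (1 + a)) + (2 * ε * K) * (a ^ 2 * x) := by gcongr
    _ ≤ K ^ 2 * (a ^ 2 * (1 + a) * (1 + a)) + (2 * ε * K) * (a * (1 + a) * x) + (ε * x) ^ 2 := by
      have q1 : 0 ≤ K ^ 2 * (a ^ 2 * (1 + a) * a) := by positivity
      have q2 : 0 ≤ (2 * ε * K) * (a * x) := by positivity
      nlinarith [sq_nonneg (ε * x)]
    _ = _ := by ring

end Ev
end NS
end

section
open scoped ContDiff Topology
namespace NS
namespace Ev
variable {μ β γ R σ m : ℝ} {ρ u V : ℝ × ℝ → ℝ}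
open Sol

theorem cube_abs (d : ℝ) : - d ^ 3 ≤ |d| ^ 3 := by
  rw [← abs_pow]; exact neg_le_abs _

theorem alg_B {q a U v d k L P p F r D m K Lm Pm β γ : ℝ} (hq : 0 ≤ q) (hqm : q ≤ m) (hU : U ^ 2 ≤ D)
    (hk : 0 ≤ k) (hkK : k ≤ K) (hL : 0 ≤ L) (hLm : L ≤ Lm) (hP : 0 ≤ P) (hPm : P ≤ Pm) (hβ : 0 ≤ β) (hγ : 0 ≤ γ) (hr : 0 ≤ r)
    (hF : F = k * d - p) :
    - (q * a ^ 2 * r) - q * a * U * v * r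
        + (- (F * d ^ 2) - 1/2 * β * L * d ^ 3 + γ * P * d ^ 2
          + 1/2 * k * d ^ 3 - p * d ^ 2) * r ≤
    (-(3/4)) * (q * a ^ 2 * r) + m * D * (v ^ 2 * r) + (1/2 * K + 1/2 * β * Lm) * (|d| ^ 3 * r) + γ * Pm * (d ^ 2 * r) := by
  have hm := hq.trans hqm
  have h1 : - (q * a * U * v) ≤ 1/4 * (q * a ^ 2) + m * D * v ^ 2 := by
    have e1 : - (q * a * U * v) ≤ 1/4 * (q * a ^ 2) + q * U ^ 2 * v ^ 2 := by
      nlinarith [mul_nonneg hq (sq_nonneg (1/2 * a + U * v))]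
    have e2 : q * U ^ 2 * v ^ 2 ≤ m * D * v ^ 2 := by gcongr
    linarith
  have h2 : (1/2 * k + 1/2 * β * L) * (- d ^ 3) ≤ (1/2 * K + 1/2 * β * Lm) * |d| ^ 3 :=
    (mul_le_mul_of_nonneg_left (cube_abs d) (by positivity)).trans (by gcongr)
  have h3 : γ * P * d ^ 2 ≤ γ * Pm * d ^ 2 := by gcongr
  rw [hF]
  nlinarith [mul_le_mul_of_nonneg_right h1 hr, mul_le_mul_of_nonneg_right h2 hr, mul_le_mul_of_nonneg_right h3 hr]

theorem Xcont (h : Ev μ β γ R σ m ρ u V) : ContinuousOn (fun x => ρ x * ac u x ^ 2 * x.1) (Kc R) :=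
  ((h.S.sρ.mul (h.S.s_ac.pow 2)).mul Sm.fst).cont

set_option maxHeartbeats 800000 in
theorem B_deriv (h : Ev μ β γ R σ m ρ u V) : ∃ C, 0 < C ∧ ∀ t, 0 < t → ∃ b',
    HasDerivAt (I R (fun x => (1/2 * kf μ β ρ x * dv u V x ^ 2 - pf γ σ ρ x * dv u V x) * x.1)) b' t ∧
    b' ≤ C * (aa R σ ρ u V t * (1 + aa R σ ρ u V t)) := by
  have S := h.S
  have hm := h.hm
  have hμ := S.hμ
  have hβ : 0 < β := by linarith [S.hβ]
  have hγ : 0 < γ := by linarith [S.hγ]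
  have hR := S.hR
  have c1 := S.sρ.cont
  have c2 := S.su.cont
  have c3 := S.sd.cont
  have c4 := S.sV.cont
  have c5 := h.s_kf.cont
  have c6 := h.s_pf.cont
  have c7 := h.s_Ph.cont
  have c8 := S.s_ac.cont
  have c9 := (S.sp β).cont
  have c10 := (S.sp γ).cont
  set K := 2 * μ + m ^ β with hK
  set k3 := 1/2 * K + 1/2 * β * m ^ β with hk3
  have hk30 : 0 < k3 := by positivity
  obtain ⟨C, hC, hd3⟩ := h.d3_le (ε := 1 / (4 * k3)) (by positivity)
  refine ⟨m + k3 * C + γ * m ^ γ, by positivity, fun t ht => ⟨_, h.bal_B ht, ?_⟩⟩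
  have hd3' := hd3 t ht.le
  have ha0 : 0 ≤ aa R σ ρ u V t := h.a_nonneg
  have hX0 : 0 ≤ X R ρ u t := h.X_nonneg ht.le
  have hD : Dd R u V t ≤ aa R σ ρ u V t := by have := h.Y_nonneg (t := t); rw [aa]; linarith
  have hD0 : 0 ≤ Dd R u V t := S.D_nonneg
  have key : ∀ L P : ℝ × ℝ → ℝ, ContinuousOn L (Kc R) → ContinuousOn P (Kc R) → ContinuousOn
      (fun x => - (ρ x * ac u x ^ 2 * x.1) - ρ x * ac u x * u x * V x * x.1
        + (- (Ph μ β γ σ ρ u V x * dv u V x ^ 2) - 1/2 * β * L x * dv u V x ^ 3 + γ * P x * dv u V x ^ 2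
          + 1/2 * kf μ β ρ x * dv u V x ^ 3 - pf γ σ ρ x * dv u V x ^ 2) * x.1) (Kc R) := by intros; fun_prop
  have e : I R (fun x => (-(3/4)) * (ρ x * ac u x ^ 2 * x.1) + m * Dd R u V t * (V x ^ 2 * x.1) + k3 * (|dv u V x| ^ 3 * x.1) + γ * m ^ γ * (dv u V x ^ 2 * x.1)) t
      = (-(3/4)) * X R ρ u t + m * Dd R u V t * I R (fun x => V x ^ 2 * x.1) t + k3 * I R (fun x => |dv u V x| ^ 3 * x.1) t + γ * m ^ γ * Dd R u V t := by
    rw [I_add hR (by fun_prop) (by fun_prop) ht.le, I_add hR (by fun_prop) (by fun_prop) ht.le,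
        I_add hR (by fun_prop) (by fun_prop) ht.le, I_mul, I_mul, I_mul, I_mul]; rfl
  have m1 := I_mono hR (key _ _ c9 c10) (g := fun x => (-(3/4)) * (ρ x * ac u x ^ 2 * x.1) + m * Dd R u V t * (V x ^ 2 * x.1) + k3 * (|dv u V x| ^ 3 * x.1) + γ * m ^ γ * (dv u V x ^ 2 * x.1))
    (by fun_prop) ht.le (fun r hr => by
      have hk : (r, t) ∈ Kc R := ⟨hr, ht.le⟩
      have hp := S.pos _ hk
      exact alg_B hp.le (h.bd _ hk) (S.u_le ht.le hr) (by have := (h.kap hk).1; unfold kf; linarith) (h.kap hk).2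
        (Real.rpow_nonneg hp.le _) (Real.rpow_le_rpow hp.le (h.bd _ hk) hβ.le)
        (Real.rpow_nonneg hp.le _) (Real.rpow_le_rpow hp.le (h.bd _ hk) hγ.le) hβ.le hγ.le hr.1 rfl)
  refine m1.trans ?_
  rw [e]
  have hV := S.V_le ht.le
  set a := aa R σ ρ u V t
  set D := Dd R u V t
  have t1 : m * D * I R (fun x => V x ^ 2 * x.1) t ≤ m * a * a := by
    have : I R (fun x => V x ^ 2 * x.1) t ≤ a := hV.trans hD
    have h0 : 0 ≤ I R (fun x => V x ^ 2 * x.1) t := I_nonneg hR fun r hr => mul_nonneg (sq_nonneg _) hr.1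
    gcongr
  have t2 : k3 * I R (fun x => |dv u V x| ^ 3 * x.1) t ≤ 1/4 * X R ρ u t + k3 * C * (a * (1 + a)) := by
    refine (mul_le_mul_of_nonneg_left hd3' hk30.le).trans (le_of_eq ?_)
    field_simp
  have t3 : γ * m ^ γ * D ≤ γ * m ^ γ * a := by gcongr
  have t4 : 0 ≤ γ * m ^ γ * a ^ 2 := by positivity
  have t5 : 0 ≤ m * a := by positivity
  nlinarith

set_option maxHeartbeats 800000 in
theorem a_lim (h : Ev μ β γ R σ m ρ u V) : Tendsto (aa R σ ρ u V) atTop (𝓝 0) ∧ ∃ M, 0 < M ∧ ∀ t, 0 ≤ t → aa R σ ρ u V t ≤ M := by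
  have S := h.S
  have hm := h.hm
  have hμ := S.hμ
  have hγ : 0 < γ := by linarith [S.hγ]
  have hR := S.hR
  have c1 := S.sρ.cont
  have c3 := S.sd.cont
  have c5 := h.s_kf.cont
  have c6 := h.s_pf.cont
  obtain ⟨C1, hC1, hB⟩ := h.B_deriv
  obtain ⟨C2, hC2, hY⟩ := h.Y_deriv
  obtain ⟨H, E, hL⟩ := h.lyap2
  set L := γ * m ^ (γ - 1) with hLd
  have hL0 : 0 < L := by positivity
  set Q := L ^ 2 / (2 * μ) + μ / 2 with hQ
  have hQ0 : 0 < Q := by positivity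
  set K := 2 * μ + m ^ β with hKd
  have hK0 : 0 < K := by positivity
  set B := I R (fun x => (1/2 * kf μ β ρ x * dv u V x ^ 2 - pf γ σ ρ x * dv u V x) * x.1) with hBd
  set f := fun t => B t + Q * Y R σ ρ t with hf
  have lo : ∀ t, 0 ≤ t → μ / 2 * aa R σ ρ u V t ≤ f t := by
    intro t ht
    simp only [hf, hBd, aa, Y, Dd]
    rw [← I_mul, ← I_add hR (by fun_prop) (by fun_prop) ht, ← I_add hR (by fun_prop) (by fun_prop) ht, ← I_mul]
    refine I_mono hR (by fun_prop) (by fun_prop) ht fun r hr => ?_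
    have hk : (r, t) ∈ Kc R := ⟨hr, ht⟩
    have h1 := h.pf_le hk
    have h2 : 2 * μ ≤ kf μ β ρ (r,t) := (h.kap hk).1
    have h0 := hr.1
    simp only
    have e1 : pf γ σ ρ (r,t) * dv u V (r,t) ≤ μ / 2 * dv u V (r,t) ^ 2 + L ^ 2 / (2 * μ) * (ρ (r,t) - σ) ^ 2 := by
      have : pf γ σ ρ (r,t) * dv u V (r,t) ≤ μ / 2 * dv u V (r,t) ^ 2 + pf γ σ ρ (r,t) ^ 2 / (2 * μ) := by
        have : μ / 2 * dv u V (r,t) ^ 2 + pf γ σ ρ (r,t) ^ 2 / (2 * μ) - pf γ σ ρ (r,t) * dv u V (r,t) = (μ * dv u V (r,t) - pf γ σ ρ (r,t)) ^ 2 / (2 * μ) := by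
          field_simp; ring
        have : 0 ≤ (μ * dv u V (r,t) - pf γ σ ρ (r,t)) ^ 2 / (2 * μ) := by positivity
        linarith
      have : pf γ σ ρ (r,t) ^ 2 / (2 * μ) ≤ L ^ 2 / (2 * μ) * (ρ (r,t) - σ) ^ 2 := by
        rw [div_mul_eq_mul_div]; gcongr
      linarith
    have e2 : 2 * μ * dv u V (r,t) ^ 2 ≤ kf μ β ρ (r,t) * dv u V (r,t) ^ 2 := by gcongr
    have e3 : μ / 2 * (dv u V (r,t) ^ 2 + (ρ (r,t) - σ) ^ 2) ≤ (1/2 * kf μ β ρ (r,t) * dv u V (r,t) ^ 2 - pf γ σ ρ (r,t) * dv u V (r,t)) + Q * (ρ (r,t) - σ) ^ 2 := by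
      rw [hQ]; linarith
    nlinarith [mul_le_mul_of_nonneg_right e3 h0]
  have up : ∀ t, 0 ≤ t → f t ≤ (K + 1 + L ^ 2 + Q) * aa R σ ρ u V t := by
    intro t ht
    simp only [hf, hBd, aa, Y, Dd]
    rw [← I_mul, ← I_add hR (by fun_prop) (by fun_prop) ht, ← I_add hR (by fun_prop) (by fun_prop) ht, ← I_mul]
    refine I_mono hR (by fun_prop) (by fun_prop) ht fun r hr => ?_
    have hk : (r, t) ∈ Kc R := ⟨hr, ht⟩
    have h1 := h.pf_le hk
    have h2 : kf μ β ρ (r,t) ≤ K := (h.kap hk).2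
    have h0 := hr.1
    simp only
    have e2 : kf μ β ρ (r,t) * dv u V (r,t) ^ 2 ≤ K * dv u V (r,t) ^ 2 := by gcongr
    have q1 : 0 ≤ (L ^ 2 + Q) * dv u V (r,t) ^ 2 := by positivity
    have q2 : 0 ≤ (K + 1) * (ρ (r,t) - σ) ^ 2 := by positivity
    have q3 : 0 ≤ K * dv u V (r,t) ^ 2 := by positivity
    have q4 : 0 ≤ L ^ 2 * (ρ (r,t) - σ) ^ 2 := by positivity
    have e3 : (1/2 * kf μ β ρ (r,t) * dv u V (r,t) ^ 2 - pf γ σ ρ (r,t) * dv u V (r,t)) + Q * (ρ (r,t) - σ) ^ 2 ≤ (K + 1 + L ^ 2 + Q) * (dv u V (r,t) ^ 2 + (ρ (r,t) - σ) ^ 2) := by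
      nlinarith [sq_nonneg (pf γ σ ρ (r,t) + dv u V (r,t))]
    nlinarith [mul_le_mul_of_nonneg_right e3 h0]
  have ha0 : ∀ t, 0 ≤ aa R σ ρ u V t := fun t => h.a_nonneg
  have f0 : ∀ t, 0 ≤ t → 0 ≤ f t := fun t ht => (mul_nonneg (by positivity) (ha0 t)).trans (lo t ht)
  have fc : ContinuousOn f (Ici 0) := by
    have k1 : ContinuousOn (fun x => (1/2 * kf μ β ρ x * dv u V x ^ 2 - pf γ σ ρ x * dv u V x) * x.1) (Kc R) := by fun_prop
    have k2 : ContinuousOn (fun x => (ρ x - σ) ^ 2 * x.1) (Kc R) := by fun_prop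
    exact (I_cont hR k1).add (continuousOn_const.mul (I_cont hR k2))
  have fd : ∀ t, 0 < t → ∃ f', HasDerivAt f f' t ∧ f' ≤ (C1 + Q * C2) * (aa R σ ρ u V t * (1 + aa R σ ρ u V t)) := by
    intro t ht
    obtain ⟨b', hb, hb'⟩ := hB t ht
    obtain ⟨y', hy, hy'⟩ := hY t ht
    refine ⟨_, hb.fun_add (hy.const_mul Q), ?_⟩
    have := mul_le_mul_of_nonneg_left hy' hQ0.le
    have : 0 ≤ Q * C2 * aa R σ ρ u V t ^ 2 := by positivity
    nlinarith
  have al : ∀ t, 0 ≤ t → aa R σ ρ u V t ≤ 2 / μ * f t := by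
    intro t ht
    have := lo t ht
    rw [div_mul_eq_mul_div, le_div_iff₀ hμ]; linarith
  obtain ⟨M, hM, hfM⟩ := gronwall (C := (C1 + Q * C2) * (1 + 2 / μ)) fc f0 (by positivity) (fun t ht => by
    obtain ⟨f', a1, a2⟩ := fd t ht
    refine ⟨f', a1, a2.trans ?_⟩
    have b1 := al t ht.le
    have b2 := f0 t ht.le
    have b3 := ha0 t
    have : 1 + aa R σ ρ u V t ≤ (1 + 2 / μ) * (1 + f t) := by
      have : 0 ≤ 2 / μ := by positivity
      nlinarith
    calc (C1 + Q * C2) * (aa R σ ρ u V t * (1 + aa R σ ρ u V t)) ≤ (C1 + Q * C2) * (aa R σ ρ u V t * ((1 + 2 / μ) * (1 + f t))) := by gcongr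
      _ = _ := by ring) hL
  have aM : ∀ t, 0 ≤ t → aa R σ ρ u V t ≤ 2 / μ * M := fun t ht => (al t ht).trans (by have := hfM t ht; gcongr)
  refine ⟨?_, 2 / μ * M, by positivity, aM⟩
  have flim := decay (C := (C1 + Q * C2) * (1 + 2 / μ * M) + (K + 1 + L ^ 2 + Q)) fc f0 (by positivity) (fun t _ => ha0 t) (fun t ht => (up t ht).trans (by
      refine mul_le_mul_of_nonneg_right ?_ (ha0 t)
      have : 0 ≤ (C1 + Q * C2) * (1 + 2 / μ * M) := by positivity
      linarith)) (fun t ht => by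
    obtain ⟨f', a1, a2⟩ := fd t ht
    refine ⟨f', a1, a2.trans ?_⟩
    have b1 := aM t ht.le
    have b3 := ha0 t
    calc (C1 + Q * C2) * (aa R σ ρ u V t * (1 + aa R σ ρ u V t)) ≤ (C1 + Q * C2) * (aa R σ ρ u V t * (1 + 2 / μ * M)) := by gcongr
      _ = (C1 + Q * C2) * (1 + 2 / μ * M) * aa R σ ρ u V t := by ring
      _ ≤ _ := by
        refine mul_le_mul_of_nonneg_right ?_ (ha0 t)
        have : 0 ≤ K + 1 + L ^ 2 + Q := by positivity
        linarith) hL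
  have := flim.const_mul (2 / μ)
  rw [mul_zero] at this
  refine tendsto_of_tendsto_of_tendsto_of_le_of_le' tendsto_const_nhds this (Eventually.of_forall ha0) ?_
  filter_upwards [eventually_ge_atTop 0] with t ht using al t ht

end Ev
end NS
end

section
open scoped ContDiff Topology
namespace NS
namespace Ev
variable {μ β γ R σ m : ℝ} {ρ u V : ℝ × ℝ → ℝ}
open Sol

theorem hardy (S : Sol μ β γ R ρ u V) {t : ℝ} (ht : 0 ≤ t) :
    3 * I R (fun x => V x ^ 4 * x.1) t ≤ I R (fun x => dv u V x ^ 4 * x.1) t := by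
  have hR := S.hR
  have c3 := S.sd.cont
  have c4 := S.sV.cont
  have sv := (Sm.fst (R := R).pow 2).mul (S.sV.pow 4)
  have e1 := I_dr hR sv ht
  simp only [S.V_R ht] at e1
  have e2 : I R (dr (fun x => x.1 ^ 2 * V x ^ 4)) t = I R (fun x => (4 * dv u V x * V x ^ 3 - 6 * V x ^ 4) * x.1) t := by
    refine I_congr hR fun r hr => ?_
    have hk : (r, t) ∈ Kc R := ⟨hr, ht⟩
    have := (sv.hr hk).unique (((hasDerivAt_id' r).fun_pow 2).fun_mul ((S.sV.hr hk).fun_pow 4))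
    have e4 := S.drV _ hk
    rw [this]
    simp only [dv] at e4 ⊢
    push_cast
    linear_combination (-4 * r * V (r,t) ^ 3) * e4
  have e3 : I R (fun x => 3 * (V x ^ 4 * x.1) + (4 * dv u V x * V x ^ 3 - 6 * V x ^ 4) * x.1) t = 3 * I R (fun x => V x ^ 4 * x.1) t := by
    rw [I_add hR (by fun_prop) (by fun_prop) ht, I_mul, ← e2, e1]; simp
  rw [← e3]
  refine I_mono hR (by fun_prop) (by fun_prop) ht fun r hr => ?_
  simp only
  have h0 := hr.1
  have : 3 * V (r,t) ^ 4 + (4 * dv u V (r,t) * V (r,t) ^ 3 - 6 * V (r,t) ^ 4) ≤ dv u V (r,t) ^ 4 := by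
    generalize dv u V (r,t) = d
    generalize V (r,t) = v
    nlinarith [sq_nonneg (d ^ 2 - v ^ 2), mul_nonneg (sq_nonneg (d - v)) (sq_nonneg (d + v)), mul_nonneg (sq_nonneg (d - v)) (sq_nonneg v)]
  nlinarith [mul_le_mul_of_nonneg_right this h0]

/-- material derivative of the flux -/
def Nf (μ β γ σ : ℝ) (ρ u V : ℝ × ℝ → ℝ) (x : ℝ × ℝ) : ℝ :=
  dt (Ph μ β γ σ ρ u V) x + u x * dr (Ph μ β γ σ ρ u V) x
theorem s_N (h : Ev μ β γ R σ m ρ u V) : Sm R (Nf μ β γ σ ρ u V) := h.s_Ph.dt.add (h.S.su.mul h.s_Ph.dr)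

theorem N_eq (h : Ev μ β γ R σ m ρ u V) {r t : ℝ} (hk : (r, t) ∈ Kc R) :
    Nf μ β γ σ ρ u V (r,t) = kf μ β ρ (r,t) * ((dr (ac u) (r,t) + Wf u V (r,t)) - (dr u (r,t) ^ 2 + V (r,t) ^ 2))
      - β * ρ (r,t) ^ β * dv u V (r,t) ^ 2 + γ * ρ (r,t) ^ γ * dv u V (r,t) := by
  have S := h.S
  have e1 := (h.s_Ph.ht hk).unique (((h.s_kf.ht hk).fun_mul (S.sd.ht hk)).fun_sub (h.s_pf.ht hk))
  have e2 := (h.s_Ph.hr hk).unique (((h.s_kf.hr hk).fun_mul (S.sd.hr hk)).fun_sub (h.s_pf.hr hk))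
  rw [Nf, e1, e2, h.k_mat hk, h.p_mat hk, S.d_mat hk]; ring

theorem dr_N (h : Ev μ β γ R σ m ρ u V) {r t : ℝ} (hk : (r, t) ∈ Kc R) :
    dr (Nf μ β γ σ ρ u V) (r,t) = ρ (r,t) * (dt (ac u) (r,t) + u (r,t) * dr (ac u) (r,t)) - ρ (r,t) * ac u (r,t) * V (r,t) := by
  have S := h.S
  have sa : Sm R (fun x => ρ x * ac u x) := S.sρ.mul S.s_ac
  have e1 := (h.s_N.hr hk).unique ((h.s_Ph.dt.hr hk).fun_add ((S.su.hr hk).fun_mul (h.s_Ph.dr.hr hk)))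
  have e2 : dr (dt (Ph μ β γ σ ρ u V)) (r,t) = dt ρ (r,t) * ac u (r,t) + ρ (r,t) * dt (ac u) (r,t) := by
    rw [← h.s_Ph.symm hk, dt_eq S.hR h.s_Ph.dr sa (fun x hx => h.dr_Ph hx) _ hk]
    exact (sa.ht hk).unique ((S.sρ.ht hk).fun_mul (S.s_ac.ht hk))
  have e3 : dr (dr (Ph μ β γ σ ρ u V)) (r,t) = dr ρ (r,t) * ac u (r,t) + ρ (r,t) * dr (ac u) (r,t) := by
    rw [dr_eq S.hR h.s_Ph.dr sa (fun x hx => h.dr_Ph hx) _ hk]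
    exact (sa.hr hk).unique ((S.sρ.hr hk).fun_mul (S.s_ac.hr hk))
  rw [e1, e2, e3, h.dr_Ph hk, S.mass _ hk, dv]; ring

theorem bal_X (h : Ev μ β γ R σ m ρ u V) {t : ℝ} (ht : 0 < t) :
    HasDerivAt (X R ρ u) (I R (fun x => -2 * (Nf μ β γ σ ρ u V x * (dr (ac u) x + Wf u V x)) * x.1 + 2 * (ρ x * ac u x ^ 2 * V x) * x.1) t) t := by
  have S := h.S
  have c1 := S.sρ.cont
  have c4 := S.sV.cont
  have c7 := h.s_N.cont
  have c8 := S.s_ac.cont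
  have c9 := S.s_ac.dr.cont
  have c10 := S.s_W.cont
  have := balance S.hR ((S.sρ.mul (S.s_ac.pow 2)).mul Sm.fst) ((((S.sρ.mul S.su).mul (S.s_ac.pow 2)).mul Sm.fst).neg.add
    ((Sm.const 2).mul ((Sm.fst.mul S.s_ac).mul h.s_N)))
    (S := fun x => -2 * (Nf μ β γ σ ρ u V x * (dr (ac u) x + Wf u V x)) * x.1 + 2 * (ρ x * ac u x ^ 2 * V x) * x.1) (by fun_prop) ?_ ht
  · unfold X; simpa [S.uR t ht.le, S.ac_R ht] using this
  · intro r t hx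
    have hk := Oc_sub R hx
    refine ⟨_, _, ((S.sρ.ht hk).fun_mul ((S.s_ac.ht hk).fun_pow 2)).mul_const r,
      ((((S.sρ.hr hk).fun_mul (S.su.hr hk)).fun_mul ((S.s_ac.hr hk).fun_pow 2)).fun_mul (hasDerivAt_id' r)).fun_neg.fun_add
       ((((hasDerivAt_id' r).fun_mul (S.s_ac.hr hk)).fun_mul (h.s_N.hr hk)).const_mul 2), ?_⟩
    have h1 := S.mass _ hk
    have h3 := S.uV _ hk
    have h4 := S.acW hk
    simp only at h3 h4
    rw [h1, h.dr_N hk, dv, h3, h4]; push_cast; ring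

theorem alg_X {k K z G L Lm P Pm d μ β γ N : ℝ} (hμ : 0 < μ) (hk : 2 * μ ≤ k) (hkK : k ≤ K)
    (hL : 0 ≤ L) (hLm : L ≤ Lm) (hP : 0 ≤ P) (hPm : P ≤ Pm) (hβ : 0 ≤ β) (hγ : 0 ≤ γ) (hG : 0 ≤ G)
    (hN : N = k * (z - G) - β * L * d ^ 2 + γ * P * d) :
    -2 * (N * z) ≤ -2 * μ * z ^ 2 + 3 / (2 * μ) * (K ^ 2 * G ^ 2 + (β * Lm) ^ 2 * d ^ 4 + (γ * Pm) ^ 2 * d ^ 2) := by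
  have hk0 : 0 ≤ k := by linarith
  have h1 : (k * G + β * L * d ^ 2 - γ * P * d) ^ 2 ≤ 3 * (K ^ 2 * G ^ 2 + (β * Lm) ^ 2 * d ^ 4 + (γ * Pm) ^ 2 * d ^ 2) := by
    have a1 : (k * G) ^ 2 ≤ K ^ 2 * G ^ 2 := by rw [mul_pow]; gcongr
    have a2 : (β * L * d ^ 2) ^ 2 ≤ (β * Lm) ^ 2 * d ^ 4 := by
      calc _ = (β * L) ^ 2 * d ^ 4 := by ring
        _ ≤ _ := by gcongr
    have a3 : (γ * P * d) ^ 2 ≤ (γ * Pm) ^ 2 * d ^ 2 := by rw [mul_pow]; gcongr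
    nlinarith [sq_nonneg (k * G - β * L * d ^ 2), sq_nonneg (k * G + γ * P * d), sq_nonneg (β * L * d ^ 2 + γ * P * d)]
  set T := k * G + β * L * d ^ 2 - γ * P * d with hT
  have h2 : -2 * (N * z) = -2 * k * z ^ 2 + 2 * T * z := by rw [hN, hT]; ring
  have h3 : 2 * T * z ≤ 2 * μ * z ^ 2 + T ^ 2 / (2 * μ) := by
    have : 2 * μ * z ^ 2 + T ^ 2 / (2 * μ) - 2 * T * z = (2 * μ * z - T) ^ 2 / (2 * μ) := by field_simp; ring
    have : 0 ≤ (2 * μ * z - T) ^ 2 / (2 * μ) := by positivity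
    linarith
  have h4 : T ^ 2 / (2 * μ) ≤ 3 / (2 * μ) * (K ^ 2 * G ^ 2 + (β * Lm) ^ 2 * d ^ 4 + (γ * Pm) ^ 2 * d ^ 2) := by
    rw [div_mul_eq_mul_div]; gcongr
  have h5 : 2 * μ * z ^ 2 ≤ k * z ^ 2 := by gcongr
  rw [h2]; linarith

theorem G4 {d v w : ℝ} (hw : d = w + v) : (w ^ 2 + v ^ 2) ^ 2 ≤ 16 * d ^ 4 + 18 * v ^ 4 := by
  have e : w = d - v := by linarith
  have h1 : w ^ 4 ≤ 8 * d ^ 4 + 8 * v ^ 4 := by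
    have : w ^ 2 ≤ 2 * d ^ 2 + 2 * v ^ 2 := by rw [e]; nlinarith [sq_nonneg (d + v)]
    calc w ^ 4 = (w ^ 2) ^ 2 := by ring
      _ ≤ (2 * d ^ 2 + 2 * v ^ 2) ^ 2 := by gcongr
      _ ≤ _ := by nlinarith [sq_nonneg (d ^ 2 - v ^ 2)]
  nlinarith [sq_nonneg (w ^ 2 - v ^ 2)]

set_option maxHeartbeats 1000000 in
theorem X_bd (h : Ev μ β γ R σ m ρ u V) : ∃ M, 0 < M ∧ ∀ t, 0 ≤ t → X R ρ u t ≤ M := by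
  have S := h.S
  have hm := h.hm
  have hμ := S.hμ
  have hβ : 0 < β := by linarith [S.hβ]
  have hγ : 0 < γ := by linarith [S.hγ]
  have hR := S.hR
  have c1 := S.sρ.cont
  have c2 := S.su.dr.cont
  have c3 := S.sd.cont
  have c4 := S.sV.cont
  have c7 := h.s_N.cont
  have c8 := S.s_ac.cont
  have c9 := S.s_ac.dr.cont
  have c10 := S.s_W.cont
  obtain ⟨-, M, hM, haM⟩ := h.a_lim
  obtain ⟨C, hC, hd4⟩ := h.d4_le
  obtain ⟨H, E, hL⟩ := h.lyap2
  set K := 2 * μ + m ^ β with hK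
  set q := 3 / (2 * μ) with hq
  have hq0 : 0 < q := by positivity
  set A4 := q * (K ^ 2 * 22 + (β * m ^ β) ^ 2) with hA4
  set A2 := q * (γ * m ^ γ) ^ 2 with hA2
  refine gronwall (a := aa R σ ρ u V) (C := A4 * (C * (1 + M)) + A2 + m / μ) (I_cont hR h.Xcont) (fun t ht => h.X_nonneg ht) (by positivity) (fun t ht => ⟨_, h.bal_X ht, ?_⟩) hL
  have hd4' := hd4 t ht.le
  have ha0 : 0 ≤ aa R σ ρ u V t := h.a_nonneg
  have hX0 : 0 ≤ X R ρ u t := h.X_nonneg ht.le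
  have hD : Dd R u V t ≤ aa R σ ρ u V t := by have := h.Y_nonneg (t := t); rw [aa]; linarith
  have hD0 : 0 ≤ Dd R u V t := S.D_nonneg
  have haM' := haM t ht.le
  set a := aa R σ ρ u V t
  set Z := I R (fun x => (dr (ac u) x + Wf u V x) ^ 2 * x.1) t with hZ
  have hZ0 : 0 ≤ Z := I_nonneg hR fun r hr => mul_nonneg (sq_nonneg _) hr.1
  have hsup : ∀ r ∈ Icc 0 R, ac u (r,t) ^ 2 ≤ Z := fun r hr => by
    rw [hZ, grad_eq hR S.s_ac S.s_W (fun x hx => S.acW hx) ht.le (S.ac_R ht)]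
    exact sup_le hR S.s_ac S.s_W (fun x hx => S.acW hx) ht.le (S.ac_R ht) hr
  set s := Real.sqrt Z with hs
  have hs0 : 0 ≤ s := Real.sqrt_nonneg _
  have hs2 : s ^ 2 = Z := Real.sq_sqrt hZ0
  have ksup : ∀ r ∈ Icc 0 R, |ac u (r,t)| ≤ s := fun r hr => Real.abs_le_sqrt (hsup r hr)
  set y := I R (fun x => |ac u x| * |V x| * (ρ x * x.1)) t with hy
  have hy2 : y ^ 2 ≤ X R ρ u t * (m * a) := by
    have cs := I_CSw (f := fun x => |ac u x|) (g := fun x => |V x|) (w := fun x => ρ x * x.1) hR (by fun_prop) (by fun_prop) (by fun_prop) ht.le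
      (fun r hr => mul_nonneg (S.pos (r,t) ⟨hr, ht.le⟩).le hr.1)
    simp only [sq_abs] at cs
    refine cs.trans ?_
    have e1 : I R (fun x => ac u x ^ 2 * (ρ x * x.1)) t = X R ρ u t := I_congr hR fun r _ => by ring
    rw [e1]
    refine mul_le_mul_of_nonneg_left ?_ hX0
    calc _ ≤ I R (fun x => m * (V x ^ 2 * x.1)) t := by
          refine I_mono hR (by fun_prop) (by fun_prop) ht.le fun r hr => ?_
          have h1 := h.bd _ (⟨hr, ht.le⟩ : (r,t) ∈ Kc R)
          have h0 := hr.1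
          calc V (r,t) ^ 2 * (ρ (r,t) * r) ≤ V (r,t) ^ 2 * (m * r) := by gcongr
            _ = _ := by ring
      _ ≤ _ := by rw [I_mul]; exact mul_le_mul_of_nonneg_left ((S.V_le ht.le).trans hD) hm.le
  set d4 := I R (fun x => dv u V x ^ 4 * x.1) t with hd4d
  have hv4 := hardy S ht.le
  have m1 : I R (fun x => -2 * (Nf μ β γ σ ρ u V x * (dr (ac u) x + Wf u V x)) * x.1 + 2 * (ρ x * ac u x ^ 2 * V x) * x.1) t
      ≤ I R (fun x => -2 * μ * ((dr (ac u) x + Wf u V x) ^ 2 * x.1) + q * (K ^ 2 * 16 + (β * m ^ β) ^ 2) * (dv u V x ^ 4 * x.1) + q * K ^ 2 * 18 * (V x ^ 4 * x.1) + A2 * (dv u V x ^ 2 * x.1)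
        + 2 * s * (|ac u x| * |V x| * (ρ x * x.1))) t := by
    refine I_mono hR (by fun_prop) (by fun_prop) ht.le fun r hr => ?_
    have hk : (r, t) ∈ Kc R := ⟨hr, ht.le⟩
    have hp := S.pos _ hk
    have h0 := hr.1
    have a1 := alg_X (z := dr (ac u) (r,t) + Wf u V (r,t)) (d := dv u V (r,t)) (G := dr u (r,t) ^ 2 + V (r,t) ^ 2) hμ (h.kap hk).1 (h.kap hk).2
      (Real.rpow_nonneg hp.le β) (Real.rpow_le_rpow hp.le (h.bd _ hk) hβ.le)
      (Real.rpow_nonneg hp.le γ) (Real.rpow_le_rpow hp.le (h.bd _ hk) hγ.le) hβ.le hγ.le (by positivity) (h.N_eq hk)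
    have a2 := G4 (d := dv u V (r,t)) (v := V (r,t)) (w := dr u (r,t)) rfl
    have a3 : ρ (r,t) * ac u (r,t) ^ 2 * V (r,t) ≤ s * (|ac u (r,t)| * |V (r,t)| * ρ (r,t)) := by
      calc ρ (r,t) * ac u (r,t) ^ 2 * V (r,t) ≤ ρ (r,t) * ac u (r,t) ^ 2 * |V (r,t)| := by gcongr; exact le_abs_self _
        _ = ρ (r,t) * |ac u (r,t)| * |ac u (r,t)| * |V (r,t)| := by rw [← sq_abs]; ring
        _ ≤ ρ (r,t) * |ac u (r,t)| * s * |V (r,t)| := by have := ksup r hr; gcongr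
        _ = _ := by ring
    have a4 := mul_le_mul_of_nonneg_left a2 (by positivity : 0 ≤ q * K ^ 2)
    have a5 : -2 * (Nf μ β γ σ ρ u V (r,t) * (dr (ac u) (r,t) + Wf u V (r,t))) + 2 * (ρ (r,t) * ac u (r,t) ^ 2 * V (r,t)) ≤
        -2 * μ * (dr (ac u) (r,t) + Wf u V (r,t)) ^ 2 + q * (K ^ 2 * 16 + (β * m ^ β) ^ 2) * dv u V (r,t) ^ 4 + q * K ^ 2 * 18 * V (r,t) ^ 4 + A2 * dv u V (r,t) ^ 2 + 2 * s * (|ac u (r,t)| * |V (r,t)| * ρ (r,t)) := by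
      rw [hA2]; linarith
    have a6 := mul_le_mul_of_nonneg_right a5 h0
    simp only
    linarith
  refine m1.trans ?_
  rw [I_add hR (by fun_prop) (by fun_prop) ht.le, I_add hR (by fun_prop) (by fun_prop) ht.le, I_add hR (by fun_prop) (by fun_prop) ht.le,
    I_add hR (by fun_prop) (by fun_prop) ht.le, I_mul, I_mul, I_mul, I_mul, I_mul, ← hZ, ← hd4d, ← hy]
  change -2 * μ * Z + _ + _ + A2 * Dd R u V t + _ ≤ _
  have b1 : 2 * s * y ≤ μ * Z + X R ρ u t * (m * a) / μ := by
    have e1 : 2 * s * y ≤ μ * s ^ 2 + y ^ 2 / μ := by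
      have : μ * s ^ 2 + y ^ 2 / μ - 2 * s * y = (μ * s - y) ^ 2 / μ := by field_simp; ring
      have : 0 ≤ (μ * s - y) ^ 2 / μ := by positivity
      linarith
    have e2 : y ^ 2 / μ ≤ X R ρ u t * (m * a) / μ := by gcongr
    rw [hs2] at e1; linarith
  have b2 : d4 ≤ C * (1 + M) * (a * (1 + X R ρ u t)) := by
    refine hd4'.trans ?_
    rw [mul_assoc C]
    refine mul_le_mul_of_nonneg_left ?_ hC.le
    have : 1 + a + X R ρ u t ≤ (1 + M) * (1 + X R ρ u t) := by nlinarith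
    calc a * (1 + a + X R ρ u t) ≤ a * ((1 + M) * (1 + X R ρ u t)) := by gcongr
      _ = _ := by ring
  have b3 := mul_le_mul_of_nonneg_left b2 (by positivity : 0 ≤ A4)
  have b4 := mul_le_mul_of_nonneg_left hv4 (by positivity : 0 ≤ q * K ^ 2 * 6)
  have b5 : A2 * Dd R u V t ≤ A2 * (a * (1 + X R ρ u t)) := by
    refine mul_le_mul_of_nonneg_left ?_ (by positivity)
    nlinarith
  have b6 : X R ρ u t * (m * a) / μ ≤ m / μ * (a * (1 + X R ρ u t)) := by
    have : m / μ * (a * (1 + X R ρ u t)) - X R ρ u t * (m * a) / μ = m / μ * a := by ring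
    have : 0 ≤ m / μ * a := by positivity
    linarith
  have b7 : 0 ≤ μ * Z := by positivity
  have b8 : A4 * d4 = q * (K ^ 2 * 16 + (β * m ^ β) ^ 2) * d4 + q * K ^ 2 * 6 * d4 := by rw [hA4]; ring
  nlinarith
end Ev
end NS
end

section
open scoped ContDiff Topology
namespace NS
namespace Ev
variable {μ β γ R σ m : ℝ} {ρ u V : ℝ × ℝ → ℝ}
open Sol

theorem Ph_R (h : Ev μ β γ R σ m ρ u V) : ∃ F, 0 < F ∧ ∀ t, 0 ≤ t → |Ph μ β γ σ ρ u V (R, t)| ≤ F := by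
  obtain ⟨-, M, hM, haM⟩ := h.a_lim
  obtain ⟨N, hN, hXN⟩ := h.X_bd
  obtain ⟨C, hC, hA⟩ := h.A_le
  have hm := h.hm
  have hR := h.S.hR
  set T := C * M + m * N with hT
  have hT0 : 0 < T := by positivity
  refine ⟨Real.sqrt ((2 * T + 2 * R * T) / R ^ 2), by positivity, fun t ht => ?_⟩
  refine Real.abs_le_sqrt ?_
  rw [le_div_iff₀ (by positivity)]
  obtain ⟨w, w0, w1, w2, -⟩ := lady hR h.s_Ph ht
  have a1 : I R (fun x => Ph μ β γ σ ρ u V x ^ 2 * x.1) t ≤ C * M := (hA t ht).trans (by have := haM t ht; gcongr)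
  have a2 : I R (fun x => dr (Ph μ β γ σ ρ u V) x ^ 2 * x.1) t ≤ m * N := (h.B_le ht).trans (by have := hXN t ht; gcongr)
  have p1 : 0 < C * M := by positivity
  have p2 : 0 < m * N := by positivity
  have a3 : w ≤ T := by
    refine abs_le_of_sq_le_sq' ?_ hT0.le |>.2
    refine w1.trans ?_
    have : I R (fun x => Ph μ β γ σ ρ u V x ^ 2 * x.1) t * I R (fun x => dr (Ph μ β γ σ ρ u V) x ^ 2 * x.1) t ≤ (C * M) * (m * N) :=
      mul_le_mul a1 a2 (I_nonneg hR fun r hr => mul_nonneg (sq_nonneg _) hr.1) p1.le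
    rw [hT]; nlinarith
  have a4 : 2 * R * w ≤ 2 * R * T := by gcongr
  linarith

theorem Ph_pt (h : Ev μ β γ R σ m ρ u V) : ∃ F, 0 < F ∧ ∀ t, 0 ≤ t → ∀ r ∈ Ioc 0 R,
    |Ph μ β γ σ ρ u V (r, t)| ≤ F * (1 + Real.log (R / r)) := by
  obtain ⟨F, hF, hFR⟩ := h.Ph_R
  obtain ⟨N, hN, hXN⟩ := h.X_bd
  have hm := h.hm
  have S := h.S
  have hR := S.hR
  refine ⟨F + N + m, by positivity, fun t ht r hr => ?_⟩
  have hr0 : 0 < r := hr.1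
  have hsub : Icc r R ⊆ Icc 0 R := Icc_subset_Icc_left hr.1.le
  have c1 : ContinuousOn (fun s => ρ (s,t) * ac u (s,t)) (Icc r R) := ((S.sρ.mul S.s_ac).cr ht).mono hsub
  have c2 : ContinuousOn (fun s => ρ (s,t) * ac u (s,t) ^ 2 * s) (Icc r R) := (h.Xcont.cr ht).mono hsub
  have i1 : IntervalIntegrable (fun s => ρ (s,t) * ac u (s,t)) volume r R := ContinuousOn.intervalIntegrable (by rwa [uIcc_of_le hr.2])
  have i2 : IntervalIntegrable (fun s => ρ (s,t) * ac u (s,t) ^ 2 * s) volume r R := ContinuousOn.intervalIntegrable (by rwa [uIcc_of_le hr.2])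
  have i3 : IntervalIntegrable (fun s : ℝ => s⁻¹) volume r R := by
    refine ContinuousOn.intervalIntegrable ?_
    rw [uIcc_of_le hr.2]
    exact continuousOn_id.inv₀ fun s hs => (hr0.trans_le hs.1).ne'
  have e1 : ∫ s in r..R, ρ (s,t) * ac u (s,t) = Ph μ β γ σ ρ u V (R, t) - Ph μ β γ σ ρ u V (r, t) := by
    refine intervalIntegral.integral_eq_sub_of_hasDerivAt (f := fun s => Ph μ β γ σ ρ u V (s, t)) (fun s hs => ?_) i1
    rw [uIcc_of_le hr.2] at hs
    have hk : (s, t) ∈ Kc R := ⟨hsub hs, ht⟩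
    have := h.s_Ph.hr hk
    rwa [h.dr_Ph hk] at this
  have e2 : |∫ s in r..R, ρ (s,t) * ac u (s,t)| ≤ N + m * Real.log (R / r) := by
    calc _ ≤ ∫ s in r..R, |ρ (s,t) * ac u (s,t)| := intervalIntegral.abs_integral_le_integral_abs hr.2
      _ ≤ ∫ s in r..R, (ρ (s,t) * ac u (s,t) ^ 2 * s + m * s⁻¹) := by
        refine intervalIntegral.integral_mono_on hr.2 i1.abs (i2.add (i3.const_mul m)) fun s hs => ?_
        have hk : (s, t) ∈ Kc R := ⟨hsub hs, ht⟩
        have hp := S.pos _ hk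
        have hs0 : 0 < s := hr0.trans_le hs.1
        rw [abs_mul, abs_of_pos hp]
        have a1 : |ac u (s,t)| ≤ ac u (s,t) ^ 2 * s + s⁻¹ := by
          have : ac u (s,t) ^ 2 * s + s⁻¹ - |ac u (s,t)| = ((|ac u (s,t)| * s - 1/2) ^ 2 + 3/4) * s⁻¹ := by
            rw [← sq_abs]; field_simp; ring
          have : 0 ≤ ((|ac u (s,t)| * s - 1/2) ^ 2 + 3/4) * s⁻¹ := by positivity
          linarith
        have a2 : ρ (s,t) * s⁻¹ ≤ m * s⁻¹ := by have := h.bd _ hk; gcongr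
        have a3 := mul_le_mul_of_nonneg_left a1 hp.le
        linarith
      _ = (∫ s in r..R, ρ (s,t) * ac u (s,t) ^ 2 * s) + m * Real.log (R / r) := by
        rw [intervalIntegral.integral_add i2 (i3.const_mul m), intervalIntegral.integral_const_mul, integral_inv_of_pos hr0 hR]
      _ ≤ N + m * Real.log (R / r) := by
        gcongr
        refine le_trans ?_ (hXN t ht)
        refine intervalIntegral.integral_mono_interval hr.1.le hr.2 le_rfl ?_ (ii hR h.Xcont ht)
        refine (ae_restrict_iff' measurableSet_Ioc).2 (Eventually.of_forall fun s hs => ?_)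
        have hp := S.pos (s,t) ⟨⟨hs.1.le, hs.2⟩, ht⟩
        have : 0 < s := hs.1
        simp only [Pi.zero_apply]; positivity
  rw [e1] at e2
  have e3 := hFR t ht
  have l0 : 0 ≤ Real.log (R / r) := Real.log_nonneg ((one_le_div hr0).2 hr.2)
  have e4 : |Ph μ β γ σ ρ u V (r, t)| ≤ F + (N + m * Real.log (R / r)) := by
    rw [abs_le] at *
    constructor <;> linarith [e2.1, e2.2, e3.1, e3.2]
  nlinarith [mul_nonneg hF.le l0, mul_nonneg hN.le l0]

theorem d_pt (h : Ev μ β γ R σ m ρ u V) {ε : ℝ} (hε : 0 < ε) : ∃ C, 0 < C ∧ ∀ t, 0 ≤ t → ∀ r ∈ Ioc 0 R,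
    |dv u V (r, t)| ≤ C * (R / r) ^ ε := by
  obtain ⟨F, hF, hP⟩ := h.Ph_pt
  have hm := h.hm
  have S := h.S
  have hR := S.hR
  have hμ := S.hμ
  have hγ : 0 < γ := by linarith [S.hγ]
  set L := γ * m ^ (γ - 1) with hL'
  have hL : 0 < L := by positivity
  refine ⟨(F * (1 + 1 / ε) + L * m) / (2 * μ), by positivity, fun t ht r hr => ?_⟩
  have hk : (r, t) ∈ Kc R := ⟨⟨hr.1.le, hr.2⟩, ht⟩
  have hr0 : 0 < r := hr.1
  have h1 : 1 ≤ R / r := (one_le_div hr0).2 hr.2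
  have h2 : 1 ≤ (R / r) ^ ε := Real.one_le_rpow h1 hε.le
  have h3 : Real.log (R / r) ≤ (R / r) ^ ε / ε := Real.log_le_rpow_div (by positivity) hε
  have h4 := hP t ht r hr
  have h5 : |pf γ σ ρ (r,t)| ≤ L * m := by
    refine (p_upper S.hγ (S.pos _ hk) h.σ0 (h.bd _ hk) h.σm).trans ?_
    have := h.fl hk
    gcongr
  have h6 : 2 * μ * |dv u V (r,t)| ≤ |Ph μ β γ σ ρ u V (r,t)| + |pf γ σ ρ (r,t)| := by
    have e2 : kf μ β ρ (r,t) * dv u V (r,t) = Ph μ β γ σ ρ u V (r,t) + pf γ σ ρ (r,t) := by unfold Ph; ring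
    have h7 : 2 * μ ≤ kf μ β ρ (r,t) := (h.kap hk).1
    calc 2 * μ * |dv u V (r,t)| ≤ kf μ β ρ (r,t) * |dv u V (r,t)| := by gcongr
      _ = |kf μ β ρ (r,t) * dv u V (r,t)| := by rw [abs_mul, abs_of_nonneg (by linarith : 0 ≤ kf μ β ρ (r,t))]
      _ ≤ _ := by rw [e2]; exact abs_add_le _ _
  have h8 : F * (1 + Real.log (R / r)) ≤ F * ((R / r) ^ ε + (R / r) ^ ε / ε) := by gcongr
  have h9 : L * m ≤ L * m * (R / r) ^ ε := le_mul_of_one_le_right (by positivity) h2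
  rw [div_mul_eq_mul_div, le_div_iff₀ (by positivity)]
  have : (F * (1 + 1 / ε) + L * m) * (R / r) ^ ε = F * ((R / r) ^ ε + (R / r) ^ ε / ε) + L * m * (R / r) ^ ε := by ring
  rw [this]; linarith

theorem grad_pt (h : Ev μ β γ R σ m ρ u V) {ε : ℝ} (hε : 0 < ε) (hε1 : ε ≤ 1) : ∃ C, 0 < C ∧ ∀ t, 0 ≤ t → ∀ r ∈ Ioc 0 R,
    dr u (r, t) ^ 2 + V (r, t) ^ 2 ≤ (C * (R / r) ^ ε) ^ 2 := by
  obtain ⟨C, hC, hd⟩ := h.d_pt hε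
  have S := h.S
  have hR := S.hR
  refine ⟨3 * C, by positivity, fun t ht r hr => ?_⟩
  have hr0 : 0 < r := hr.1
  have hk : (r, t) ∈ Kc R := ⟨⟨hr.1.le, hr.2⟩, ht⟩
  have hsub : Icc 0 r ⊆ Icc 0 R := Icc_subset_Icc_right hr.2
  have sd : Sm R (fun x => dv u V x * x.1) := S.sd.mul Sm.fst
  have i1 : IntervalIntegrable (fun s => dv u V (s,t) * s) volume 0 r := by
    refine ContinuousOn.intervalIntegrable ?_
    rw [uIcc_of_le hr0.le]; exact (sd.cr ht).mono hsub
  have e1 : ∫ s in (0:ℝ)..r, dv u V (s,t) * s = r * u (r,t) := by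
    rw [intervalIntegral.integral_eq_sub_of_hasDerivAt (f := fun s => s * u (s, t)) (fun s hs => ?_) i1]
    · simp
    · rw [uIcc_of_le hr0.le] at hs
      have hk : (s, t) ∈ Kc R := ⟨hsub hs, ht⟩
      have := (hasDerivAt_id' s).fun_mul (S.su.hr hk)
      have hu := S.uV _ hk
      simp only at hu
      have e : dv u V (s,t) * s = 1 * u (s,t) + s * dr u (s,t) := by rw [hu, dv]; ring
      rw [e]; exact this
  have e2 : |∫ s in (0:ℝ)..r, dv u V (s,t) * s| ≤ (C * (R / r) ^ ε * r) * |r - 0| := by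
    rw [← Real.norm_eq_abs]
    refine intervalIntegral.norm_integral_le_of_norm_le_const fun s hs => ?_
    rw [uIoc_of_le hr0.le] at hs
    have hs0 : 0 < s := hs.1
    rw [norm_mul, Real.norm_eq_abs, Real.norm_of_nonneg hs0.le]
    have a1 := hd t ht s ⟨hs.1, hs.2.trans hr.2⟩
    have a2 : (R / s) ^ ε * s ≤ (R / r) ^ ε * r := by
      have q : ∀ x : ℝ, 0 < x → (R / x) ^ ε * x = R ^ ε * x ^ (1 - ε) := fun x hx => by
        rw [Real.div_rpow hR.le hx.le, Real.rpow_sub hx, Real.rpow_one]; ring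
      rw [q s hs0, q r hr0]
      have := Real.rpow_le_rpow hs0.le hs.2 (by linarith : 0 ≤ 1 - ε)
      gcongr
    calc _ ≤ C * (R / s) ^ ε * s := by gcongr
      _ = C * ((R / s) ^ ε * s) := by ring
      _ ≤ C * ((R / r) ^ ε * r) := by gcongr
      _ = _ := by ring
  rw [e1, S.uV _ hk, sub_zero, abs_of_pos hr0, abs_mul, abs_mul, abs_of_pos hr0] at e2
  have e3 : |V (r,t)| ≤ C * (R / r) ^ ε := by
    have : |V (r,t)| * (r * r) ≤ (C * (R / r) ^ ε) * (r * r) := by linarith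
    exact le_of_mul_le_mul_right this (by positivity)
  have e4 := hd t ht r hr
  have p0 : 0 ≤ C * (R / r) ^ ε := by positivity
  have e5 : dr u (r,t) = dv u V (r,t) - V (r,t) := by rw [dv]; ring
  have e6 : |dr u (r,t)| ≤ 2 * (C * (R / r) ^ ε) := by
    rw [e5]; exact (abs_sub _ _).trans (by linarith)
  have e7 := sq_le_sq' (by linarith [abs_nonneg (V (r,t))]) e3
  have e8 := sq_le_sq' (by linarith [abs_nonneg (dr u (r,t))]) e6
  rw [sq_abs] at e7 e8
  have e9 : (3 * C * (R / r) ^ ε) ^ 2 = 9 * (C * (R / r) ^ ε) ^ 2 := by ring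
  rw [e9]
  nlinarith [sq_nonneg (C * (R / r) ^ ε)]

theorem grad_lim (h : Ev μ β γ R σ m ρ u V) {p : ℝ} (hp : 1 ≤ p) :
    Tendsto (I R (fun x => (dr u x ^ 2 + V x ^ 2) ^ (p / 2) * x.1)) atTop (𝓝 0) := by
  have S := h.S
  have hR := S.hR
  have p0 : 0 < p := by linarith
  obtain ⟨C, hC, hg⟩ := h.grad_pt (ε := 1 / (2 * p)) (by positivity) (by rw [div_le_one (by positivity)]; linarith)
  have c1 := S.su.dr.cont
  have c4 := S.sV.cont
  have cg : ContinuousOn (fun x => dr u x ^ 2 + V x ^ 2) (Kc R) := by fun_prop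
  have cp : ContinuousOn (fun x => (dr u x ^ 2 + V x ^ 2) ^ (p / 2) * x.1) (Kc R) :=
    (cg.rpow_const fun x _ => Or.inr (by positivity)).mul continuousOn_fst
  have cs : ContinuousOn (fun x => Real.sqrt ((dr u x ^ 2 + V x ^ 2) * x.1)) (Kc R) := (cg.mul continuousOn_fst).sqrt
  set A := C ^ (p - 1) * Real.sqrt R with hA
  have key : ∀ t, 0 ≤ t → I R (fun x => (dr u x ^ 2 + V x ^ 2) ^ (p / 2) * x.1) t ≤ A * Real.sqrt (R * aa R σ ρ u V t) := by
    intro t ht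
    have k1 : I R (fun x => (dr u x ^ 2 + V x ^ 2) ^ (p / 2) * x.1) t ≤ A * I R (fun x => Real.sqrt ((dr u x ^ 2 + V x ^ 2) * x.1)) t := by
      rw [← I_mul]
      refine I_mono hR cp (continuousOn_const.mul cs) ht fun r hr => ?_
      rcases hr.1.eq_or_lt with h0 | h0
      · subst h0; simp
      have hb := hg t ht r ⟨h0, hr.2⟩
      simp only
      set g := dr u (r,t) ^ 2 + V (r,t) ^ 2 with hgd
      have hg0 : 0 ≤ g := by positivity
      have h1 : 1 ≤ R / r := (one_le_div h0).2 hr.2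
      set s := Real.sqrt g with hs
      have hs0 : 0 ≤ s := Real.sqrt_nonneg _
      have e1 : g ^ (p / 2) = s ^ p := by
        rw [hs, Real.sqrt_eq_rpow, ← Real.rpow_mul hg0]; congr 1; ring
      have e2 : s ≤ C * (R / r) ^ (1 / (2 * p)) := by
        rw [hs]; exact Real.sqrt_le_iff.2 ⟨by positivity, hb⟩
      have e3 : s ^ p = s * s ^ (p - 1) := by
        rcases hs0.eq_or_lt with h | h
        · rw [← h, Real.zero_rpow p0.ne', zero_mul]
        · rw [Real.rpow_sub_one h.ne']; field_simp
      have e4 : s ^ (p - 1) ≤ C ^ (p - 1) * Real.sqrt (R / r) := by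
        calc s ^ (p - 1) ≤ (C * (R / r) ^ (1 / (2 * p))) ^ (p - 1) := Real.rpow_le_rpow hs0 e2 (by linarith)
          _ = C ^ (p - 1) * (R / r) ^ (1 / (2 * p) * (p - 1)) := by
            rw [Real.mul_rpow hC.le (by positivity), ← Real.rpow_mul (by positivity)]
          _ ≤ C ^ (p - 1) * (R / r) ^ (1 / 2 : ℝ) := by
            gcongr
            rw [div_mul_eq_mul_div, div_le_div_iff₀ (by positivity) (by positivity)]; linarith
          _ = _ := by rw [Real.sqrt_eq_rpow]
      have e5 : Real.sqrt (R / r) * r = Real.sqrt R * Real.sqrt r := by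
        rw [Real.sqrt_div hR.le]
        have : Real.sqrt r * Real.sqrt r = r := Real.mul_self_sqrt h0.le
        have : 0 < Real.sqrt r := Real.sqrt_pos.2 h0
        field_simp
        nlinarith
      change g ^ (p / 2) * r ≤ A * Real.sqrt (g * r)
      rw [e1, e3, Real.sqrt_mul hg0, ← hs]
      calc s * s ^ (p - 1) * r ≤ s * (C ^ (p - 1) * Real.sqrt (R / r)) * r := by gcongr
        _ = s * C ^ (p - 1) * (Real.sqrt (R / r) * r) := by ring
        _ = _ := by rw [e5, hA]; ring
    refine k1.trans ?_
    refine mul_le_mul_of_nonneg_left ?_ (by positivity)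
    refine Real.le_sqrt_of_sq_le ?_
    have q := I_CS (f := fun x => Real.sqrt ((dr u x ^ 2 + V x ^ 2) * x.1)) (g := fun _ => 1) hR cs continuousOn_const ht
    simp only [mul_one, one_pow] at q
    refine q.trans ?_
    have q1 : I R (fun _ => (1:ℝ)) t = R := by simp [I]
    have q2 : I R (fun x => Real.sqrt ((dr u x ^ 2 + V x ^ 2) * x.1) ^ 2) t = Dd R u V t := by
      rw [S.D_eq ht]
      refine I_congr hR fun r hr => ?_
      have := hr.1
      exact Real.sq_sqrt (by simp only; positivity)
    rw [q1, q2, mul_comm]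
    have := h.Y_nonneg (t := t)
    rw [aa]; gcongr; linarith
  have lim := (((h.a_lim.1.const_mul R).sqrt).const_mul A)
  rw [mul_zero, Real.sqrt_zero, mul_zero] at lim
  refine tendsto_of_tendsto_of_tendsto_of_le_of_le' tendsto_const_nhds lim ?_ ?_
  · refine Eventually.of_forall fun t => I_nonneg hR fun r hr => ?_
    exact mul_nonneg (Real.rpow_nonneg (by positivity) _) hr.1
  · filter_upwards [eventually_ge_atTop 0] with t ht using key t ht

theorem rho_lim (h : Ev μ β γ R σ m ρ u V) {p : ℝ} (hp : 1 ≤ p) :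
    Tendsto (I R (fun x => |ρ x - σ| ^ p * x.1)) atTop (𝓝 0) := by
  have S := h.S
  have hR := S.hR
  have hm := h.hm
  have p0 : 0 < p := by linarith
  have c1 := S.sρ.cont
  have ca : ContinuousOn (fun x => |ρ x - σ|) (Kc R) := by fun_prop
  have cp : ContinuousOn (fun x => |ρ x - σ| ^ p * x.1) (Kc R) :=
    (ca.rpow_const fun x _ => Or.inr (by positivity)).mul continuousOn_fst
  have key : ∀ t, 0 ≤ t → I R (fun x => |ρ x - σ| ^ p * x.1) t ≤ m ^ (p - 1) * Real.sqrt (R ^ 2 / 2 * aa R σ ρ u V t) := by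
    intro t ht
    have k1 : I R (fun x => |ρ x - σ| ^ p * x.1) t ≤ m ^ (p - 1) * I R (fun x => |ρ x - σ| * 1 * x.1) t := by
      rw [← I_mul]
      refine I_mono hR cp (by fun_prop) ht fun r hr => ?_
      have hk : (r, t) ∈ Kc R := ⟨hr, ht⟩
      have hb := h.fl hk
      have h0 := hr.1
      simp only
      set s := |ρ (r,t) - σ|
      have hs0 : 0 ≤ s := abs_nonneg _
      have e3 : s ^ p = s * s ^ (p - 1) := by
        rcases hs0.eq_or_lt with h | h
        · rw [← h, Real.zero_rpow p0.ne', zero_mul]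
        · rw [Real.rpow_sub_one h.ne']; field_simp
      have e4 : s ^ (p - 1) ≤ m ^ (p - 1) := Real.rpow_le_rpow hs0 hb (by linarith)
      rw [e3]
      calc s * s ^ (p - 1) * r ≤ s * m ^ (p - 1) * r := by gcongr
        _ = _ := by ring
    refine k1.trans ?_
    refine mul_le_mul_of_nonneg_left ?_ (by positivity)
    refine Real.le_sqrt_of_sq_le ?_
    have q := I_CSw (f := fun x => |ρ x - σ|) (g := fun _ => 1) (w := fun x => x.1) hR ca continuousOn_const continuousOn_fst ht (fun r hr => hr.1)
    simp only [one_pow, one_mul, sq_abs] at q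
    rw [I_id] at q
    refine q.trans ?_
    have := S.D_nonneg (t := t)
    rw [aa, mul_comm]; gcongr
    change Y R σ ρ t ≤ _
    linarith
  have lim := (((h.a_lim.1.const_mul (R ^ 2 / 2)).sqrt).const_mul (m ^ (p - 1)))
  rw [mul_zero, Real.sqrt_zero, mul_zero] at lim
  refine tendsto_of_tendsto_of_tendsto_of_le_of_le' tendsto_const_nhds lim ?_ ?_
  · refine Eventually.of_forall fun t => I_nonneg hR fun r hr => ?_
    exact mul_nonneg (Real.rpow_nonneg (abs_nonneg _) _) hr.1
  · filter_upwards [eventually_ge_atTop 0] with t ht using key t ht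
end Ev
end NS
end

section
open scoped ContDiff Topology
namespace NS

theorem gradSq_eq {μ β γ R : ℝ} {ρ u : ℝ → ℝ → ℝ} {V : ℝ × ℝ → ℝ}
    (S : Sol μ β γ R (Function.uncurry ρ) (Function.uncurry u) V) {r t : ℝ} (hr : r ∈ Ioo 0 R) (ht : 0 ≤ t) :
    gradSq u r t = dr (Function.uncurry u) (r, t) ^ 2 + V (r, t) ^ 2 := by
  have hk : (r, t) ∈ Kc R := ⟨⟨hr.1.le, hr.2.le⟩, ht⟩
  have h1 : deriv (fun s => u s t) r = dr (Function.uncurry u) (r, t) := (S.su.hr hk).deriv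
  have h2 : u r t = r * V (r, t) := S.uV _ hk
  rw [gradSq, h1, h2, mul_div_cancel_left₀ _ hr.1.ne']

theorem Ioo_eq_I {R t : ℝ} (hR : 0 < R) {f : ℝ → ℝ} {g : ℝ × ℝ → ℝ} (h : ∀ r ∈ Ioo 0 R, f r = g (r, t)) :
    ∫ r in Ioo 0 R, f r = I R g t := by
  rw [I, intervalIntegral.integral_of_le hR.le, integral_Ioc_eq_integral_Ioo]
  exact setIntegral_congr_fun measurableSet_Ioo h

theorem lim_aux {f : ℝ → ℝ} (hf : Tendsto f atTop (𝓝 0)) {p : ℝ} (hp : 1 ≤ p) :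
    Tendsto (fun t => (2 * Real.pi * f t) ^ (1 / p)) atTop (𝓝 0) := by
  have p0 : 0 < p := by linarith
  have h := (hf.const_mul (2 * Real.pi)).rpow_const (p := 1 / p) (Or.inr (by positivity))
  rwa [mul_zero, Real.zero_rpow (by positivity)] at h

end NS
end

/-- **Uniform bound of the density and large-time behavior.** Suppose `γ > 1` and
`max{1, (γ+2)/4} < β ≤ γ`. Then for any global radially symmetric strong solution there
is a constant `C` depending only on `μ, β, γ, ‖ρ₀‖_{L^∞}, ‖u₀‖_{H¹}` (and `Ω`) such that
`sup_{0 ≤ t < ∞} ‖ρ(·,t)‖_{L^∞} ≤ C`, and moreover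
`lim_{t→∞} (‖ρ(·,t) − ρ_s‖_{L^p} + ‖∇u(·,t)‖_{L^p}) = 0` for every `p ∈ [1,∞)`, where
`ρ_s = (1/|Ω|) ∫_Ω ρ₀ dx`.  Here the `L^p` norms over the 2D ball `Ω` of radius `R` are
expressed in radial coordinates by `‖f‖_p^p = 2π ∫₀ᴿ |f(r)|^p r dr`. -/
theorem density_uniform_bound_and_asymptotics
    (μ β γ R M₁ M₂ : ℝ)
    (hμ : 0 < μ) (hγ : 1 < γ) (hβ : max 1 ((γ + 2) / 4) < β) (hβγ : β ≤ γ) (hR : 0 < R) :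
    ∃ C > 0, ∀ ρ u : ℝ → ℝ → ℝ,
      RadialSolutionGlobal μ β γ R ρ u →
      (∀ r ∈ Icc (0:ℝ) R, ρ r 0 ≤ M₁) →
      (2 * Real.pi * (∫ r in Ioo (0:ℝ) R, ((u r 0) ^ 2 + gradSq u r 0) * r) ≤ M₂) →
      (∀ r ∈ Icc (0:ℝ) R, ∀ t ∈ Ici (0:ℝ), ρ r t ≤ C) ∧
      (∀ p : ℝ, 1 ≤ p →
        Tendsto (fun t =>
            (2 * Real.pi * ∫ r in Ioo (0:ℝ) R,
                |ρ r t - (Real.pi * R ^ 2)⁻¹ *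
                    (2 * Real.pi * ∫ s in Ioo (0:ℝ) R, ρ s 0 * s)| ^ p * r) ^ (1 / p)
            + (2 * Real.pi * ∫ r in Ioo (0:ℝ) R, (gradSq u r t) ^ (p / 2) * r) ^ (1 / p))
          atTop (nhds 0)) := by
  obtain ⟨C, hC, hb⟩ := NS.density_bound μ β γ R M₁ (M₂ / (2 * Real.pi)) hμ hγ hβ hβγ hR
  refine ⟨C, hC, fun ρ u hs h1 h2 => ?_⟩
  have S := NS.sol_of_radial hs
  have hpi : 0 < 2 * Real.pi := by positivity
  have h3 : NS.Data μ β γ R M₁ (M₂ / (2 * Real.pi)) (Function.uncurry ρ) (Function.uncurry u)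
      (NS.avg (NS.dr (Function.uncurry u))) := by
    refine ⟨S, fun r hr => h1 r hr, ?_⟩
    rw [le_div_iff₀' hpi]
    rw [NS.Ioo_eq_I (t := 0) (g := fun x => (Function.uncurry u x ^ 2 + (NS.dr (Function.uncurry u) x ^ 2
      + NS.avg (NS.dr (Function.uncurry u)) x ^ 2)) * x.1) hR
      (fun r hr => by rw [NS.gradSq_eq S hr le_rfl]; rfl)] at h2
    exact h2
  have h4 := hb _ _ _ h3
  refine ⟨fun r hr t ht => h4 r hr t ht, fun p hp => ?_⟩
  obtain ⟨m, hE⟩ := NS.mkEv h3 h4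
  have hσ : (Real.pi * R ^ 2)⁻¹ * (2 * Real.pi * ∫ s in Ioo (0:ℝ) R, ρ s 0 * s)
      = 2 / R ^ 2 * NS.I R (fun x => Function.uncurry ρ x * x.1) 0 := by
    rw [NS.Ioo_eq_I (t := 0) (f := fun s => ρ s 0 * s) (g := fun x => Function.uncurry ρ x * x.1) hR (fun r hr => rfl)]
    have := Real.pi_pos
    field_simp
  rw [hσ]
  have l := (NS.lim_aux (hE.rho_lim hp) hp).add (NS.lim_aux (hE.grad_lim hp) hp)
  rw [add_zero] at l
  refine l.congr' ?_
  filter_upwards [eventually_ge_atTop 0] with t ht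
  congr 4
  · exact (NS.Ioo_eq_I hR fun r hr => rfl).symm
  · exact (NS.Ioo_eq_I hR fun r hr => by rw [NS.gradSq_eq S hr ht]).symm
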